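/- Let M and N be real analytic manifolds, f : M → N a real analytic map, V a subanalytic open subset of N, and U = f⁻¹(V). If ψ is a tempered smooth function on V, then ψ ∘ f is a tempered smooth function on U. -/

import Mathlib

open scoped Topology
open Set

/-- A subset of a real normed space is *semianalytic* if, locally, it is a finite union of
finite intersections of zero sets and positivity sets of real-analytic functions. -/
def Semianalytic {E : Type*} [NormedAddCommGroup E] [NormedSpace ℝ E] (A : Set E) : Prop :=
  ∀ x : E, ∃ U ∈ 𝓝 x, ∃ (p q : ℕ) (f g : Fin p → Fin q → E → ℝ),
    (∀ i j, AnalyticOnNhd ℝ (f i j) U) ∧ (∀ i j, AnalyticOnNhd ℝ (g i j) U) ∧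
    A ∩ U = (⋃ i, ⋂ j, {y | f i j y = 0} ∩ {y | 0 < g i j y}) ∩ U

/-- A subset of a real normed space is *subanalytic* if, locally, it is the projection of a
relatively compact semianalytic subset of a product with some `ℝ^m`. -/
def Subanalytic {E : Type*} [NormedAddCommGroup E] [NormedSpace ℝ E] (A : Set E) : Prop :=
  ∀ x : E, ∃ U ∈ 𝓝 x, ∃ (m : ℕ) (B : Set (E × (Fin m → ℝ))),
    Semianalytic B ∧ IsCompact (closure B) ∧ A ∩ U = (Prod.fst '' B) ∩ U

/-- A function `f`, considered on the open set `U`, has *polynomial growth* at a point `p`: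
there are a compact neighbourhood `K` of `p` and a positive integer `N` with
`sup_{x ∈ K ∩ U} dist(x, K \ U)^N ‖f x‖ < ∞`. -/
def HasPolyGrowthAt {E F : Type*} [NormedAddCommGroup E] [NormedSpace ℝ E]
    [NormedAddCommGroup F] (f : E → F) (U : Set E) (p : E) : Prop :=
  ∃ K : Set E, IsCompact K ∧ K ∈ 𝓝 p ∧ ∃ N : ℕ, 0 < N ∧ ∃ C : ℝ,
    ∀ x ∈ K ∩ U, Metric.infDist x (K \ U) ^ N * ‖f x‖ ≤ C

/-- A smooth function on the open set `U` is *tempered* if all of its (iterated) derivatives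
have polynomial growth at every point. -/
def IsTemperedOn {E : Type*} [NormedAddCommGroup E] [NormedSpace ℝ E]
    (f : E → ℂ) (U : Set E) : Prop :=
  ∀ (k : ℕ) (p : E),
    HasPolyGrowthAt (fun x => ‖iteratedFDerivWithin ℝ k f U x‖) U p

section PartA1
set_option autoImplicit true
namespace TA

section calc0
variable {𝒜 : Type} [NormedRing 𝒜] [NormedAlgebra ℝ 𝒜] [NormOneClass 𝒜]

/-- One monomial of the extension of a formal multilinear series to operators. -/
noncomputable def opMono {n : ℕ} (p : FormalMultilinearSeries ℝ (Fin n → ℝ) ℝ) (k : ℕ)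
    (w : Fin k → Fin n) :
    ContinuousMultilinearMap ℝ (fun _ : Fin k => (Fin n → 𝒜)) 𝒜 :=
  (p k (fun i => Pi.single (w i) 1)) •
    (ContinuousMultilinearMap.mkPiAlgebraFin ℝ k 𝒜).compContinuousLinearMap
      (fun i => ContinuousLinearMap.proj (R := ℝ) (φ := fun _ : Fin n => 𝒜) (w i))

/-- Extension of a formal multilinear series on `ℝⁿ` to tuples of operators. -/
noncomputable def opSeries {n : ℕ} (p : FormalMultilinearSeries ℝ (Fin n → ℝ) ℝ) :
    FormalMultilinearSeries ℝ (Fin n → 𝒜) 𝒜 := fun k =>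
  ∑ w : Fin k → Fin n, opMono p k w

lemma opMono_norm_le {n : ℕ} (p : FormalMultilinearSeries ℝ (Fin n → ℝ) ℝ) (k : ℕ)
    (w : Fin k → Fin n) (m : Fin k → (Fin n → 𝒜)) :
    ‖opMono (𝒜 := 𝒜) p k w m‖ ≤ ‖p k‖ * ∏ i, ‖m i‖ := by
  have e : opMono (𝒜 := 𝒜) p k w m =
      (p k (fun i => Pi.single (w i) 1)) • (List.ofFn (fun i => m i (w i))).prod := by
    simp [opMono]
  rw [e, norm_smul]
  have h1 : ‖p k (fun i => Pi.single (w i) 1)‖ ≤ ‖p k‖ := by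
    refine ((p k).le_opNorm _).trans ?_
    have : ∏ i, ‖(Pi.single (w i) (1 : ℝ) : Fin n → ℝ)‖ = 1 := by
      apply Finset.prod_eq_one
      intro i _
      rw [Pi.norm_single, norm_one]
    rw [this, mul_one]
  have h2 : ‖(List.ofFn (fun i => m i (w i))).prod‖ ≤ ∏ i, ‖m i‖ := by
    refine (List.norm_prod_le _).trans ?_
    rw [List.map_ofFn, List.prod_ofFn]
    exact Finset.prod_le_prod (fun i _ => norm_nonneg _) (fun i _ => norm_le_pi_norm (m i) (w i))
  exact mul_le_mul h1 h2 (norm_nonneg _) (norm_nonneg _)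

lemma opSeries_norm_le {n : ℕ} (p : FormalMultilinearSeries ℝ (Fin n → ℝ) ℝ) (k : ℕ) :
    ‖opSeries (𝒜 := 𝒜) p k‖ ≤ (n : ℝ) ^ k * ‖p k‖ := by
  refine ContinuousMultilinearMap.opNorm_le_bound (by positivity) fun m => ?_
  have e : opSeries (𝒜 := 𝒜) p k m = ∑ w : Fin k → Fin n, opMono p k w m := by
    simp [opSeries]
  rw [e]
  refine (norm_sum_le _ _).trans
    ((Finset.sum_le_sum (fun w _ => opMono_norm_le p k w m)).trans ?_)
  simp [mul_assoc]

end calc0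

section calc1
variable {B : Type} [NormedAddCommGroup B] [NormedSpace ℝ B] [CompleteSpace B] [Nontrivial B]

lemma comp_list_prod (φ : B →L[ℝ] ℝ) {n : ℕ} (z : Fin n → (B →L[ℝ] B)) (c : Fin n → ℝ)
    (h : ∀ i, φ.comp (z i) = c i • φ) :
    ∀ {k : ℕ} (w : Fin k → Fin n),
    φ.comp ((List.ofFn (fun i => z (w i))).prod) = (∏ i, c (w i)) • φ := by
  intro k
  induction k with
  | zero => intro w; ext x; simp
  | succ k ih =>
    intro w
    rw [List.ofFn_succ, List.prod_cons, Fin.prod_univ_succ]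
    ext x
    have h1 := fun y => congrArg (fun L => L y) (h (w 0))
    have h2 := fun y => congrArg (fun L => L y) (ih (fun i => w i.succ))
    simp at h1 h2
    simp [h1, h2, mul_assoc]

lemma comp_opSeries (p : FormalMultilinearSeries ℝ (Fin n → ℝ) ℝ) (φ : B →L[ℝ] ℝ)
    (z : Fin n → (B →L[ℝ] B)) (c : Fin n → ℝ)
    (h : ∀ i, φ.comp (z i) = c i • φ) (k : ℕ) :
    φ.comp (opSeries p k (fun _ => z)) = (p k (fun _ => c)) • φ := by
  have hc : c = ∑ i, c i • (Pi.single i (1:ℝ) : Fin n → ℝ) := by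
    ext j; simp [Finset.sum_apply, Pi.single_apply]
  have e1 : p k (fun _ => c) = ∑ w : Fin k → Fin n, (∏ i, c (w i)) *
      p k (fun i => Pi.single (w i) 1) := by
    conv_lhs => rw [hc]
    rw [ContinuousMultilinearMap.map_sum]
    refine Finset.sum_congr rfl fun w _ => ?_
    rw [ContinuousMultilinearMap.map_smul_univ, smul_eq_mul]
  rw [e1]
  ext x
  have h2 := fun w : Fin k → Fin n => congrArg (fun L => L x) (comp_list_prod φ z c h w)
  simp at h2
  simp [opSeries, opMono, Finset.sum_mul, h2]
  refine Finset.sum_congr rfl fun w _ => ?_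
  ring

lemma calc_core {n : ℕ} (f : (Fin n → ℝ) → ℝ) (hf : AnalyticAt ℝ f 0) :
    ∃ Φ : (Fin n → (B →L[ℝ] B)) → (B →L[ℝ] B), AnalyticAt ℝ Φ 0 ∧
      ∀ᶠ z in 𝓝 0, ∀ (φ : B →L[ℝ] ℝ) (c : Fin n → ℝ), (∀ i, φ.comp (z i) = c i • φ) →
        φ.comp (Φ z) = f c • φ := by
  obtain ⟨p, R, hp⟩ := hf
  have hR := hp.r_pos
  obtain ⟨r, hr0, hrR⟩ := ENNReal.lt_iff_exists_nnreal_btwn.1 hR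
  have hr0' : 0 < r := by exact_mod_cast hr0
  obtain ⟨C, hC0, hC⟩ := p.norm_mul_pow_le_of_lt_radius (r := r) (hrR.trans_le hp.r_le)
  have hrad : ((r / (n + 1) : NNReal) : ENNReal) ≤ (opSeries (𝒜 := B →L[ℝ] B) p).radius := by
    apply FormalMultilinearSeries.le_radius_of_bound _ C
    intro k
    calc ‖opSeries (𝒜 := B →L[ℝ] B) p k‖ * ((r / (n+1) : NNReal) : ℝ) ^ k
        ≤ ((n : ℝ) ^ k * ‖p k‖) * ((r / (n+1) : NNReal) : ℝ) ^ k := by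
          gcongr; exact opSeries_norm_le p k
      _ = ‖p k‖ * ((n / (n+1) : ℝ) * r) ^ k := by
          push_cast; rw [mul_comm ((n:ℝ)^k), mul_assoc, ← mul_pow]; congr 2; ring
      _ ≤ ‖p k‖ * (r:ℝ) ^ k := by
          gcongr
          have : (n / (n+1) : ℝ) ≤ 1 := by rw [div_le_one (by positivity)]; linarith
          exact mul_le_of_le_one_left r.2 this
      _ ≤ C := hC k
  have hpos : 0 < (opSeries (𝒜 := B →L[ℝ] B) p).radius :=
    lt_of_lt_of_le (by exact_mod_cast (by positivity : 0 < r / (n+1))) hrad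
  have hs := (opSeries (𝒜 := B →L[ℝ] B) p).hasFPowerSeriesOnBall hpos
  refine ⟨(opSeries p).sum, hs.analyticAt, ?_⟩
  have h1 : Metric.eball (0 : Fin n → (B →L[ℝ] B)) (opSeries (𝒜 := B →L[ℝ] B) p).radius ∈ 𝓝 0 :=
    Metric.eball_mem_nhds _ hpos
  have h2 : Metric.eball (0 : Fin n → (B →L[ℝ] B)) R ∈ 𝓝 0 := Metric.eball_mem_nhds _ hR
  filter_upwards [h1, h2] with z hz1 hz2 φ c h
  by_cases hφ : φ = 0
  · subst hφ; simp
  have hφ' : 0 < ‖φ‖ := norm_pos_iff.2 hφ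
  have hci : ∀ i, ‖c i‖ ≤ ‖z i‖ := by
    intro i
    have := φ.opNorm_comp_le (z i)
    rw [h i, norm_smul, mul_comm] at this
    exact le_of_mul_le_mul_left this hφ'
  have hc : c ∈ Metric.eball (0 : Fin n → ℝ) R := by
    rw [Metric.mem_eball, edist_zero_right] at hz2 ⊢
    refine lt_of_le_of_lt ?_ hz2
    rw [← ofReal_norm, ← ofReal_norm]
    apply ENNReal.ofReal_le_ofReal
    refine (pi_norm_le_iff_of_nonneg (norm_nonneg _)).2 fun i => (hci i).trans (norm_le_pi_norm z i)
  have s1 := hs.hasSum hz1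
  rw [zero_add] at s1
  have s2 := hp.hasSum hc
  rw [zero_add] at s2
  ext x
  have s3 : HasSum (fun k => φ (opSeries p k (fun _ => z) x)) (φ ((opSeries p).sum z x)) := by
    have := (((ContinuousLinearMap.apply ℝ B x).hasSum s1).mapL φ)
    simpa using this
  have s4 : HasSum (fun k => φ (opSeries p k (fun _ => z) x)) (f c * φ x) := by
    have := s2.mul_right (φ x)
    have e : (fun k => φ (opSeries p k (fun _ => z) x)) = fun k => p k (fun _ => c) * φ x := by
      funext k
      have := congrArg (fun L => L x) (comp_opSeries p φ z c h k)
      simpa using this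
    rw [e]; exact this
  simpa using s3.unique s4

lemma calc_prod {E : Type} [NormedAddCommGroup E] [NormedSpace ℝ E] [FiniteDimensional ℝ E]
    (f : E × ℝ → ℝ) (y0 : E) (hf : AnalyticAt ℝ f (y0, 0)) :
    ∃ Φ : E × (B →L[ℝ] B) → (B →L[ℝ] B), AnalyticAt ℝ Φ (y0, 0) ∧
      ∀ᶠ z in 𝓝 (y0, (0 : B →L[ℝ] B)), ∀ (φ : B →L[ℝ] ℝ) (t : ℝ), φ.comp z.2 = t • φ →
        φ.comp (Φ z) = f (z.1, t) • φ := by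
  obtain ⟨n, hn⟩ : ∃ n, n = Module.finrank ℝ E := ⟨_, rfl⟩
  let e : E ≃L[ℝ] (Fin n → ℝ) := ContinuousLinearEquiv.ofFinrankEq (by simp [hn])
  let A : (Fin (n+1) → ℝ) → E × ℝ := fun c => (y0 + e.symm (fun i => c i.succ), c 0)
  have hA : AnalyticAt ℝ A 0 := by
    apply AnalyticAt.prod
    · apply AnalyticAt.add analyticAt_const
      apply (e.symm.toContinuousLinearMap.analyticAt _).comp
      apply AnalyticAt.pi
      intro i
      exact (ContinuousLinearMap.proj (R := ℝ) (φ := fun _ : Fin (n+1) => ℝ) i.succ).analyticAt _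
    · exact (ContinuousLinearMap.proj (R := ℝ) (φ := fun _ : Fin (n+1) => ℝ) 0).analyticAt _
  have hA0 : A 0 = (y0, 0) := by
    have : e.symm (fun i : Fin n => (0 : Fin (n+1) → ℝ) i.succ) = 0 := e.symm.map_zero
    show (y0 + e.symm (fun i : Fin n => (0 : Fin (n+1) → ℝ) i.succ), (0:ℝ)) = _
    rw [this, add_zero]
  obtain ⟨Φ, hΦ, h⟩ := calc_core (B := B) (f ∘ A) (AnalyticAt.comp (by rw [hA0]; exact hf) hA)
  let D : E × (B →L[ℝ] B) → (Fin (n+1) → (B →L[ℝ] B)) := fun z =>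
    Fin.cons z.2 (fun i => (e (z.1 - y0) i) • (1 : B →L[ℝ] B))
  have hD : AnalyticAt ℝ D (y0, 0) := by
    apply AnalyticAt.pi
    intro i
    refine Fin.cases ?_ (fun i => ?_) i
    · simpa [D] using analyticAt_snd
    · simp only [D, Fin.cons_succ]
      refine AnalyticAt.fun_smul ?_ analyticAt_const
      have h1 : AnalyticAt ℝ (fun z : E × (B →L[ℝ] B) => e (z.1 - y0)) (y0, 0) :=
        (e.toContinuousLinearMap.analyticAt _).comp (analyticAt_fst.sub analyticAt_const)
      exact ((ContinuousLinearMap.proj (R := ℝ) (φ := fun _ : Fin n => ℝ) i).analyticAt _).comp h1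
  have hD0 : D (y0, 0) = 0 := by
    ext i
    refine Fin.cases ?_ (fun i => ?_) i <;> simp [D]
  refine ⟨Φ ∘ D, AnalyticAt.comp (by rw [hD0]; exact hΦ) hD, ?_⟩
  have hc := hD.continuousAt.tendsto
  rw [hD0] at hc
  filter_upwards [hc.eventually h] with z hz φ t ht
  have := hz φ (Fin.cons t (e (z.1 - y0))) (fun i => by
    refine Fin.cases ?_ (fun i => ?_) i
    · simpa [D] using ht
    · ext x; simp [D])
  rw [Function.comp_apply, this]
  simp only [Function.comp_apply, A]
  simp only [Fin.cons_succ, Fin.cons_zero, ContinuousLinearEquiv.symm_apply_apply, add_sub_cancel]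

end calc1
end TA
end PartA1

section PartA2
open scoped Topology BoundedContinuousFunction
namespace TA

/-- The Banach space of bounded sequences. -/
abbrev BS := ℕ →ᵇ ℝ

/-- Right shift. -/
noncomputable def shR : BS →L[ℝ] BS :=
  LinearMap.mkContinuous
    { toFun := fun h => BoundedContinuousFunction.ofNormedAddCommGroupDiscrete
        (fun n => Nat.casesOn n 0 (fun k => h k)) ‖h‖
        (fun n => by cases n with
          | zero => simp
          | succ k => exact h.norm_coe_le_norm k)
      map_add' := fun a b => by ext n; cases n <;> simp
      map_smul' := fun c a => by ext n; cases n <;> simp } 1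
    (fun h => by
      rw [one_mul]
      refine (BoundedContinuousFunction.norm_le (norm_nonneg _)).2 fun n => ?_
      cases n with
      | zero => simp
      | succ k => exact h.norm_coe_le_norm k)

/-- Left shift. -/
noncomputable def shL : BS →L[ℝ] BS :=
  LinearMap.mkContinuous
    { toFun := fun h => BoundedContinuousFunction.ofNormedAddCommGroupDiscrete
        (fun n => h (n+1)) ‖h‖ (fun n => h.norm_coe_le_norm _)
      map_add' := fun a b => by ext n; simp
      map_smul' := fun c a => by ext n; simp } 1
    (fun h => by
      rw [one_mul]
      exact (BoundedContinuousFunction.norm_le (norm_nonneg _)).2 fun n => h.norm_coe_le_norm _)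

/-- Evaluation at `0`. -/
noncomputable def dlt : BS →L[ℝ] ℝ := BoundedContinuousFunction.evalCLM ℝ 0

/-- First basis vector. -/
noncomputable def bse : BS := BoundedContinuousFunction.ofNormedAddCommGroupDiscrete
  (fun n => if n = 0 then 1 else 0) 1 (fun n => by split_ifs <;> simp)

@[simp] lemma shR_zero (h : BS) : shR h 0 = 0 := rfl
@[simp] lemma shR_succ (h : BS) (n : ℕ) : shR h (n+1) = h n := rfl
@[simp] lemma shL_apply (h : BS) (n : ℕ) : shL h n = h (n+1) := rfl
@[simp] lemma dlt_apply (h : BS) : dlt h = h 0 := rfl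
@[simp] lemma bse_zero : bse 0 = 1 := rfl
@[simp] lemma bse_succ (n : ℕ) : bse (n+1) = 0 := rfl

lemma norm_shL_le' : ‖shL‖ ≤ 1 := LinearMap.mkContinuous_norm_le _ zero_le_one _
lemma norm_shR_le' : ‖shR‖ ≤ 1 := LinearMap.mkContinuous_norm_le _ zero_le_one _

lemma shL_pow_apply (h : BS) (k n : ℕ) : (shL ^ k) h n = h (n + k) := by
  induction k generalizing n with
  | zero => simp
  | succ k ih =>
    rw [pow_succ', ContinuousLinearMap.mul_apply, shL_apply, ih]
    congr 1; omega

/-- A Banach space with shifts. -/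
structure Shift (B : Type) [NormedAddCommGroup B] [NormedSpace ℝ B] where
  shR : B →L[ℝ] B
  shL : B →L[ℝ] B
  dlt : B →L[ℝ] ℝ
  bse : B
  dlt_bse : dlt bse = 1
  dlt_shR : ∀ h, dlt (shR h) = 0
  norm_shL_le : ‖shL‖ ≤ 1
  norm_shR_le : ‖shR‖ ≤ 1
  shL_shR : ∀ h, shL (shR h) = h
  decomp : ∀ h, h = dlt h • bse + shR (shL h)
  shL_bse : shL bse = 0
  inj : ∀ h, (∀ n : ℕ, dlt ((shL ^ n) h) = 0) → h = 0

/-- The standard example. -/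
noncomputable def stdShift : Shift BS where
  shR := shR
  shL := shL
  dlt := dlt
  bse := bse
  dlt_bse := rfl
  dlt_shR := fun _ => rfl
  norm_shL_le := norm_shL_le'
  norm_shR_le := norm_shR_le'
  shL_shR := fun h => by ext n; simp
  decomp := fun h => by ext n; cases n <;> simp
  shL_bse := by ext n; simp
  inj := fun h hh => by
    ext n
    have h1 := hh n
    rw [dlt_apply, shL_pow_apply, zero_add] at h1
    exact h1

lemma exists_shift : ∃ (B : Type) (_ : NormedAddCommGroup B) (_ : NormedSpace ℝ B)
    (_ : CompleteSpace B), Nonempty (Shift B) := ⟨BS, inferInstance, inferInstance, inferInstance, ⟨stdShift⟩⟩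

lemma analyticAt_clm_apply {E X Y : Type*} [NormedAddCommGroup E] [NormedSpace ℝ E]
    [NormedAddCommGroup X] [NormedSpace ℝ X] [NormedAddCommGroup Y] [NormedSpace ℝ Y]
    {L : E → X →L[ℝ] Y} {v : E → X} {e : E} (hL : AnalyticAt ℝ L e) (hv : AnalyticAt ℝ v e) :
    AnalyticAt ℝ (fun z => L z (v z)) e := by
  have := ContinuousLinearMap.analyticAt_bilinear (ContinuousLinearMap.id ℝ (X →L[ℝ] Y)) (L e, v e)
  exact AnalyticAt.comp (g := fun z : (X →L[ℝ] Y) × X => z.1 z.2) (f := fun z => (L z, v z))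
    this (hL.prod hv)

namespace Shift
section
variable {B : Type} [NormedAddCommGroup B] [NormedSpace ℝ B] [CompleteSpace B] (Q : Shift B)

lemma nontriv (Q : Shift B) : Nontrivial B := ⟨⟨Q.bse, 0, fun h => by
    have := Q.dlt_bse
    rw [h] at this
    simp at this⟩⟩

/-- The evaluation functional at `t`. -/
noncomputable def ev (t : ℝ) : B →L[ℝ] ℝ := Q.dlt.comp (Ring.inverse (1 - t • Q.shL))

lemma isUnit_ev {t : ℝ} (ht : |t| < 1) : IsUnit (1 - t • Q.shL : B →L[ℝ] B) := by
  apply isUnit_one_sub_of_norm_lt_one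
  rw [norm_smul, Real.norm_eq_abs]
  calc |t| * ‖Q.shL‖ ≤ |t| * 1 := by gcongr; exact Q.norm_shL_le
    _ < 1 := by linarith

lemma ev_rec {t : ℝ} (ht : |t| < 1) (h : B) : Q.ev t h = Q.dlt h + t * Q.ev t (Q.shL h) := by
  have h1 := Ring.inverse_mul_cancel _ (Q.isUnit_ev ht)
  have h2 : Ring.inverse (1 - t • Q.shL : B →L[ℝ] B) =
      1 + Ring.inverse (1 - t • Q.shL : B →L[ℝ] B) * (t • Q.shL) := by
    rw [mul_sub, mul_one] at h1
    exact (sub_eq_iff_eq_add.1 h1)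
  unfold Shift.ev
  conv_lhs => rw [h2]
  simp

lemma ev_bse {t : ℝ} (ht : |t| < 1) : Q.ev t Q.bse = 1 := by
  rw [Q.ev_rec ht, Q.shL_bse]; simp [Q.dlt_bse]

lemma ev_shR {t : ℝ} (ht : |t| < 1) (h : B) : Q.ev t (Q.shR h) = t * Q.ev t h := by
  rw [Q.ev_rec ht, Q.shL_shR]; simp [Q.dlt_shR]

lemma ev_shR_pow {t : ℝ} (ht : |t| < 1) (h : B) (k : ℕ) :
    Q.ev t ((Q.shR ^ k) h) = t ^ k * Q.ev t h := by
  induction k with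
  | zero => simp
  | succ k ih =>
    rw [pow_succ', ContinuousLinearMap.mul_apply, Q.ev_shR ht, ih]; ring

lemma analyticAt_inv_ev : AnalyticAt ℝ (fun t : ℝ => Ring.inverse (1 - t • Q.shL : B →L[ℝ] B)) 0 := by
  have h1 : AnalyticAt ℝ (fun t : ℝ => (1 - t • Q.shL : B →L[ℝ] B)) 0 :=
    analyticAt_const.sub (analyticAt_id.fun_smul analyticAt_const)
  have h2 := analyticAt_inverse (𝕜 := ℝ) (1 : (B →L[ℝ] B)ˣ)
  exact AnalyticAt.comp (g := Ring.inverse) (f := fun t : ℝ => (1 - t • Q.shL : B →L[ℝ] B))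
    (by simpa using h2) h1

lemma analyticAt_ev {E : Type*} [NormedAddCommGroup E] [NormedSpace ℝ E] {t : E → ℝ} {v : E → B}
    {e : E} (ht : AnalyticAt ℝ t e) (ht0 : t e = 0) (hv : AnalyticAt ℝ v e) :
    AnalyticAt ℝ (fun z => Q.ev (t z) (v z)) e := by
  unfold Shift.ev
  have h1 : AnalyticAt ℝ (fun z => Ring.inverse (1 - t z • Q.shL : B →L[ℝ] B)) e :=
    AnalyticAt.comp (g := fun t : ℝ => Ring.inverse (1 - t • Q.shL : B →L[ℝ] B))
      (by rw [ht0]; exact Q.analyticAt_inv_ev) ht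
  exact (Q.dlt.analyticAt _).comp (analyticAt_clm_apply h1 hv)

lemma ev_inj (h : B) (h0 : ∀ᶠ t in 𝓝[>] (0:ℝ), Q.ev t h = 0) : h = 0 := by
  have hlt : ∀ᶠ t in 𝓝[>] (0:ℝ), 0 < t ∧ |t| < 1 := by
    have : Ioo (0:ℝ) 1 ∈ 𝓝[>] (0:ℝ) := Ioo_mem_nhdsGT one_pos
    filter_upwards [this] with t ht
    exact ⟨ht.1, by rw [abs_of_pos ht.1]; exact ht.2⟩
  have key : ∀ x : B, (∀ᶠ t in 𝓝[>] (0:ℝ), Q.ev t x = 0) → Q.dlt x = 0 := by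
    intro x hx
    have hc : ContinuousAt (fun t : ℝ => Q.ev t x) 0 :=
      (Q.analyticAt_ev analyticAt_id rfl analyticAt_const).continuousAt
    have h1 : Filter.Tendsto (fun t : ℝ => Q.ev t x) (𝓝[>] 0) (𝓝 (Q.ev 0 x)) :=
      hc.tendsto.mono_left nhdsWithin_le_nhds
    have h2 : Filter.Tendsto (fun t : ℝ => Q.ev t x) (𝓝[>] 0) (𝓝 0) :=
      tendsto_const_nhds.congr' (by filter_upwards [hx] with t ht using ht.symm)
    have := tendsto_nhds_unique h1 h2
    rw [Q.ev_rec (by simp)] at this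
    simpa using this
  have hn : ∀ n, ∀ᶠ t in 𝓝[>] (0:ℝ), Q.ev t ((Q.shL ^ n) h) = 0 := by
    intro n
    induction n with
    | zero => simpa using h0
    | succ n ih =>
      have hd := key _ ih
      filter_upwards [ih, hlt] with t ht1 ht2
      rw [Q.ev_rec ht2.2, hd, zero_add] at ht1
      rw [pow_succ']
      exact (mul_eq_zero.1 ht1).resolve_left ht2.1.ne'
  exact Q.inj _ fun n => key _ (hn n)

lemma decomp_pow (h : B) (d : ℕ) :
    h = (∑ j : Fin d, Q.dlt ((Q.shL ^ (j:ℕ)) h) • (Q.shR ^ (j:ℕ)) Q.bse) + (Q.shR ^ d) ((Q.shL ^ d) h) := by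
  induction d with
  | zero => simp
  | succ d ih =>
    rw [Fin.sum_univ_castSucc]
    conv_lhs => rw [ih]
    rw [add_assoc]
    congr 1
    conv_lhs => rw [Q.decomp ((Q.shL ^ d) h), map_add, map_smul]
    simp only [Fin.val_last]
    congr 1
    rw [pow_succ, pow_succ' Q.shL]
    rfl

end
end Shift

set_option maxHeartbeats 1000000 in
theorem wdiv {E : Type} [NormedAddCommGroup E] [NormedSpace ℝ E] [FiniteDimensional ℝ E]
    (y0 : E) (g f : E × ℝ → ℝ) (hg : AnalyticAt ℝ g (y0, 0)) (hf : AnalyticAt ℝ f (y0, 0))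
    (d : ℕ) (u : ℝ → ℝ) (hu : AnalyticAt ℝ u 0) (hu0 : u 0 ≠ 0)
    (hgu : ∀ᶠ t in 𝓝 (0:ℝ), g (y0, t) = t ^ d * u t) :
    ∃ q : E × ℝ → ℝ, AnalyticAt ℝ q (y0, 0) ∧ ∃ r : Fin d → E → ℝ,
      (∀ j, AnalyticAt ℝ (r j) y0) ∧
      ∀ᶠ z in 𝓝 (y0, (0:ℝ)), f z = g z * q z + ∑ j, r j z.1 * z.2 ^ (j:ℕ) := by
  obtain ⟨B, _, _, _, ⟨Q⟩⟩ := exists_shift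
  haveI : Nontrivial B := Q.nontriv
  obtain ⟨Φg, hΦg, hg'⟩ := calc_prod (B := B) g y0 hg
  obtain ⟨Φf, hΦf, hf'⟩ := calc_prod (B := B) f y0 hf
  obtain ⟨Φu, hΦu, hu'⟩ := calc_prod (B := B) (fun z : E × ℝ => u z.2) y0
    (AnalyticAt.comp (g := u) hu analyticAt_snd)
  have hU0 : Φu (y0, 0) = u 0 • (1 : B →L[ℝ] B) := by
    have h1 := hu'.self_of_nhds
    ext1 x
    rw [← sub_eq_zero]
    apply Q.inj
    intro n
    have := congrArg (fun L => L x) (h1 (Q.dlt.comp (Q.shL ^ n)) 0 (by ext; simp))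
    simp only [ContinuousLinearMap.comp_apply, ContinuousLinearMap.smul_apply] at this
    rw [map_sub, map_sub, this]
    simp
  -- choose ρ
  have htend : Filter.Tendsto (fun ρ : ℝ => (y0, ρ • Q.shR)) (𝓝[>] 0)
      (𝓝 (y0, (0 : B →L[ℝ] B))) := by
    have : ContinuousAt (fun ρ : ℝ => (y0, ρ • Q.shR)) 0 := by fun_prop
    have h2 := this.tendsto
    rw [zero_smul] at h2
    exact h2.mono_left nhdsWithin_le_nhds
  have hnorm : ∀ᶠ z in 𝓝 (y0, (0 : B →L[ℝ] B)), ‖(u 0)⁻¹ • Φu z - 1‖ < 1 := by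
    have ha : AnalyticAt ℝ (fun z => (u 0)⁻¹ • Φu z - 1) (y0, 0) :=
      ((analyticAt_const (v := (u 0)⁻¹)).fun_smul hΦu).fun_sub analyticAt_const
    have hc : ContinuousAt (fun z => ‖(u 0)⁻¹ • Φu z - 1‖) (y0, 0) := ha.continuousAt.norm
    have h0 : ‖(u 0)⁻¹ • Φu (y0, 0) - 1‖ < 1 := by
      rw [hU0, smul_smul, inv_mul_cancel₀ hu0]; simp
    exact hc.eventually (gt_mem_nhds h0)
  obtain ⟨ε, hε, hball⟩ := Metric.eventually_nhds_iff.1 hgu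
  have hρε : ∀ᶠ ρ in 𝓝[>] (0:ℝ), ρ ∈ Ioo 0 ε := Ioo_mem_nhdsGT hε
  obtain ⟨ρ, hρ⟩ := (hρε.and
    ((htend.eventually hg'.eventually_nhds).and ((htend.eventually hf'.eventually_nhds).and
    ((htend.eventually hu').and ((htend.eventually hnorm).and
    ((htend.eventually hΦg.eventually_analyticAt).and
      (htend.eventually hΦf.eventually_analyticAt))))))).exists
  have hρ0 := hρ.1.1
  have hρε' := hρ.1.2
  have hρ1 := hρ.2.1
  have hρ2 := hρ.2.2.1
  have hρ3 := hρ.2.2.2.1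
  have hρ4 := hρ.2.2.2.2.1
  have hρ5 := hρ.2.2.2.2.2.1
  have hρ6 := hρ.2.2.2.2.2.2
  clear hρ
  let c := u 0 * ρ ^ d
  have hc0 : c ≠ 0 := mul_ne_zero hu0 (pow_ne_zero _ hρ0.ne')
  let G : E → (B →L[ℝ] B) := fun y => Φg (y, ρ • Q.shR)
  let F : E → B := fun y => Φf (y, ρ • Q.shR) Q.bse
  have hpair : AnalyticAt ℝ (fun y : E => (y, ρ • Q.shR)) y0 := analyticAt_id.prod analyticAt_const
  have hG : AnalyticAt ℝ G y0 := AnalyticAt.comp (g := Φg) hρ5 hpair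
  have hF : AnalyticAt ℝ F y0 :=
    analyticAt_clm_apply (AnalyticAt.comp (g := Φf) hρ6 hpair) analyticAt_const
  have hcomp : ∀ {t : ℝ}, |t| < 1 → (Q.ev t).comp (ρ • Q.shR) = (ρ * t) • Q.ev t := by
    intro t ht
    ext h
    simp [Q.ev_shR ht, mul_assoc]
  let T : E → (B →L[ℝ] B) := fun y => 1 + (c⁻¹ • G y - Q.shR ^ d) * Q.shL ^ d
  have hT : AnalyticAt ℝ T y0 :=
    analyticAt_const.add (((analyticAt_const.fun_smul hG).sub analyticAt_const).mul analyticAt_const)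
  have hG0 : G y0 = ρ ^ d • (Q.shR ^ d * Φu (y0, ρ • Q.shR)) := by
    ext1 h
    rw [← sub_eq_zero]
    apply Q.ev_inj
    filter_upwards [Ioo_mem_nhdsGT (one_pos : (0:ℝ) < 1)] with t ht
    have ht' : |t| < 1 := by rw [abs_of_pos ht.1]; exact ht.2
    have e1 := congrArg (fun L => L h) (hρ1.self_of_nhds (Q.ev t) _ (hcomp ht'))
    have e2 := congrArg (fun L => L h) (hρ3 (Q.ev t) _ (hcomp ht'))
    simp only [ContinuousLinearMap.comp_apply, ContinuousLinearMap.smul_apply, smul_eq_mul] at e1 e2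
    rw [map_sub]
    simp only [G, ContinuousLinearMap.smul_apply, ContinuousLinearMap.mul_apply, map_smul,
      smul_eq_mul, Q.ev_shR_pow ht', e1, e2]
    rw [hball (y := ρ * t)]
    · ring
    · rw [dist_zero_right, norm_mul, Real.norm_eq_abs, Real.norm_eq_abs, abs_of_pos hρ0]
      nlinarith [abs_nonneg t]
  have hTu : IsUnit (T y0) := by
    have e : T y0 = 1 - (- (Q.shR ^ d * ((u 0)⁻¹ • Φu (y0, ρ • Q.shR) - 1) * Q.shL ^ d)) := by
      simp only [T]
      rw [hG0, smul_smul]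
      have : c⁻¹ * ρ ^ d = (u 0)⁻¹ := by
        simp only [c]; field_simp
      rw [this, sub_neg_eq_add, mul_sub, mul_one, mul_smul_comm]
    rw [e]
    apply isUnit_one_sub_of_norm_lt_one
    rw [norm_neg]
    have hR : ‖Q.shR ^ d‖ ≤ 1 := (norm_pow_le _ _).trans (pow_le_one₀ (norm_nonneg _) Q.norm_shR_le)
    have hL : ‖Q.shL ^ d‖ ≤ 1 := (norm_pow_le _ _).trans (pow_le_one₀ (norm_nonneg _) Q.norm_shL_le)
    calc _ ≤ ‖Q.shR ^ d‖ * ‖(u 0)⁻¹ • Φu (y0, ρ • Q.shR) - 1‖ * ‖Q.shL ^ d‖ :=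
          (norm_mul_le _ _).trans (by gcongr; exact norm_mul_le _ _)
      _ ≤ 1 * ‖(u 0)⁻¹ • Φu (y0, ρ • Q.shR) - 1‖ * 1 := by gcongr
      _ < 1 := by simpa using hρ4
  have hTe : ∀ᶠ y in 𝓝 y0, IsUnit (T y) :=
    hT.continuousAt.eventually (Units.isOpen.mem_nhds hTu)
  let H : E → B := fun y => Ring.inverse (T y) (F y)
  have hH : AnalyticAt ℝ H y0 := by
    apply analyticAt_clm_apply _ hF
    obtain ⟨z, hz⟩ := hTu
    exact AnalyticAt.comp (g := Ring.inverse) (by rw [← hz]; exact analyticAt_inverse z) hT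
  refine ⟨fun z => c⁻¹ * Q.ev (z.2 / ρ) ((Q.shL ^ d) (H z.1)), ?_,
    fun j y => Q.dlt ((Q.shL ^ (j:ℕ)) (H y)) / ρ ^ (j:ℕ), ?_, ?_⟩
  · apply analyticAt_const.mul
    apply Q.analyticAt_ev
    · simp only [div_eq_mul_inv]; exact analyticAt_snd.mul analyticAt_const
    · simp
    · exact ((Q.shL ^ d).analyticAt _).comp (AnalyticAt.comp (g := H) hH analyticAt_fst)
  · intro j
    simp only [div_eq_mul_inv]
    exact ((Q.dlt.analyticAt _).comp (((Q.shL ^ (j:ℕ)).analyticAt _).comp hH)).mul analyticAt_const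
  · have hy1 : ∀ᶠ y in 𝓝 y0, ∀ (φ : B →L[ℝ] ℝ) (t : ℝ), φ.comp (ρ • Q.shR) = t • φ →
        φ.comp (Φg (y, ρ • Q.shR)) = g (y, t) • φ := hpair.continuousAt.eventually hρ1
    have hy2 : ∀ᶠ y in 𝓝 y0, ∀ (φ : B →L[ℝ] ℝ) (t : ℝ), φ.comp (ρ • Q.shR) = t • φ →
        φ.comp (Φf (y, ρ • Q.shR)) = f (y, t) • φ := hpair.continuousAt.eventually hρ2
    have hs : ∀ᶠ s in 𝓝 (0:ℝ), |s| < ρ := by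
      have := Metric.ball_mem_nhds (0:ℝ) hρ0
      filter_upwards [this] with s hs
      simpa using hs
    rw [nhds_prod_eq]
    filter_upwards [(hy1.and (hy2.and hTe)).prod_mk hs] with z hz
    obtain ⟨⟨h1, h2, h3⟩, h4⟩ := hz
    obtain ⟨y, s⟩ := z
    dsimp only at h1 h2 h3 h4 ⊢
    have ht : |s / ρ| < 1 := by
      rw [abs_div, abs_of_pos hρ0, div_lt_one hρ0]; exact h4
    have hst : ρ * (s / ρ) = s := by field_simp
    have e1 := fun x => congrArg (fun L => L x) (h1 (Q.ev (s/ρ)) _ (hcomp ht))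
    have e2 := congrArg (fun L => L Q.bse) (h2 (Q.ev (s/ρ)) _ (hcomp ht))
    rw [hst] at e2
    simp only [hst, ContinuousLinearMap.comp_apply, ContinuousLinearMap.smul_apply, smul_eq_mul,
      Q.ev_bse ht, mul_one] at e1 e2
    have e3 : T y (H y) = F y := by
      have := Ring.mul_inverse_cancel _ h3
      calc T y (H y) = (T y * Ring.inverse (T y)) (F y) := rfl
        _ = F y := by rw [this]; rfl
    have e4 : F y = (∑ j : Fin d, Q.dlt ((Q.shL ^ (j:ℕ)) (H y)) • (Q.shR ^ (j:ℕ)) Q.bse) +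
        G y (c⁻¹ • (Q.shL ^ d) (H y)) := by
      rw [← e3]
      have hd := Q.decomp_pow (H y) d
      have : T y (H y) = H y - (Q.shR ^ d) ((Q.shL ^ d) (H y)) + G y (c⁻¹ • (Q.shL ^ d) (H y)) := by
        simp only [T, ContinuousLinearMap.add_apply, ContinuousLinearMap.one_apply,
          ContinuousLinearMap.mul_apply, ContinuousLinearMap.sub_apply,
          ContinuousLinearMap.smul_apply, map_smul]
        abel
      rw [this]
      congr 1
      conv_lhs => enter [1]; rw [hd]
      abel
    have e5 := congrArg (Q.ev (s/ρ)) e4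
    rw [map_add, map_sum] at e5
    simp only [F, G] at e5
    rw [e2, e1] at e5
    rw [e5, add_comm]
    congr 1
    · rw [map_smul, smul_eq_mul]
    · refine Finset.sum_congr rfl fun j _ => ?_
      rw [map_smul, Q.ev_shR_pow ht, Q.ev_bse ht, mul_one, smul_eq_mul, div_pow]
      ring
end TA
end PartA2

section PartA3
namespace TA

lemma exists_order {h : ℝ → ℝ} (hh : AnalyticAt ℝ h 0) (h0 : ¬ ∀ᶠ t in 𝓝 (0:ℝ), h t = 0) :
    ∃ (d : ℕ) (u : ℝ → ℝ), AnalyticAt ℝ u 0 ∧ u 0 ≠ 0 ∧ ∀ᶠ t in 𝓝 (0:ℝ), h t = t ^ d * u t := by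
  obtain ⟨d, u, hu, hu0, he⟩ := hh.exists_eventuallyEq_pow_smul_nonzero_iff.2 h0
  refine ⟨d, u, hu, hu0, ?_⟩
  filter_upwards [he] with t ht
  simpa using ht

lemma exists_dir {G : Type*} [NormedAddCommGroup G] [NormedSpace ℝ G] {f : G → ℝ} {p : G}
    (hf : AnalyticAt ℝ f p) (h0 : ¬ ∀ᶠ z in 𝓝 p, f z = 0) :
    ∃ c : G, ¬ ∀ᶠ t in 𝓝 (0:ℝ), f (p + t • c) = 0 := by
  obtain ⟨ε, hε, hb⟩ := Metric.eventually_nhds_iff_ball.1 hf.eventually_analyticAt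
  by_contra hcon
  push Not at hcon
  apply h0
  rw [Metric.eventually_nhds_iff_ball]
  refine ⟨ε, hε, fun z hz => ?_⟩
  have hz' : ‖z - p‖ < ε := by rwa [Metric.mem_ball, dist_eq_norm] at hz
  have ha : AnalyticOnNhd ℝ (fun t : ℝ => f (p + t • (z - p))) (Icc 0 1) := by
    intro t ht
    refine AnalyticAt.comp (g := f) (f := fun t : ℝ => p + t • (z - p)) (hb _ ?_)
      (analyticAt_const.fun_add (analyticAt_id.fun_smul analyticAt_const))
    rw [Metric.mem_ball, dist_eq_norm, add_sub_cancel_left, norm_smul, Real.norm_eq_abs,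
      abs_of_nonneg ht.1]
    calc t * ‖z - p‖ ≤ 1 * ‖z - p‖ := by gcongr; exact ht.2
      _ < ε := by rwa [one_mul]
  have := ha.eqOn_zero_of_preconnected_of_eventuallyEq_zero isPreconnected_Icc
    (show (0:ℝ) ∈ Icc (0:ℝ) 1 by simp) (hcon (z - p))
  have h1 := this (show (1:ℝ) ∈ Icc (0:ℝ) 1 by simp)
  simpa using h1

lemma exists_coord {n : ℕ} {E : Type*} [NormedAddCommGroup E] [NormedSpace ℝ E]
    [FiniteDimensional ℝ E] (hn : Module.finrank ℝ E = n + 1) {c : E} (hc : c ≠ 0) :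
    ∃ L : E ≃L[ℝ] (Fin n → ℝ) × ℝ, L c = (0, 1) := by
  let e : E ≃L[ℝ] (Fin n → ℝ) × ℝ := ContinuousLinearEquiv.ofFinrankEq (by simp [hn])
  have h1 : e c ≠ 0 := by simpa using hc
  have h2 : ((0 : Fin n → ℝ), (1:ℝ)) ≠ 0 := by simp [Prod.ext_iff]
  obtain ⟨A, hA⟩ := SeparatingDual.exists_continuousLinearEquiv_apply_eq (R := ℝ) h1 h2
  exact ⟨e.trans A, hA⟩

lemma poly_zero (d : ℕ) : ∀ (c : Fin d → ℝ) (w : ℝ → ℝ), ContinuousAt w 0 →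
    (∀ᶠ t in 𝓝[≠] (0:ℝ), ∑ j, c j * t ^ (j:ℕ) = t ^ d * w t) → (∀ j, c j = 0) ∧ w 0 = 0 := by
  have ev0 : ∀ (u : ℝ → ℝ), ContinuousAt u 0 → (∀ᶠ t in 𝓝[≠] (0:ℝ), u t = 0) → u 0 = 0 := by
    intro u hu h
    have h1 : Filter.Tendsto u (𝓝[≠] 0) (𝓝 (u 0)) := hu.tendsto.mono_left nhdsWithin_le_nhds
    have h2 : Filter.Tendsto u (𝓝[≠] 0) (𝓝 0) :=
      tendsto_const_nhds.congr' (by filter_upwards [h] with t ht using ht.symm)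
    exact tendsto_nhds_unique h1 h2
  induction d with
  | zero =>
    intro c w hw h
    refine ⟨fun j => j.elim0, ev0 w hw ?_⟩
    filter_upwards [h] with t ht
    simpa using ht.symm
  | succ d ih =>
    intro c w hw h
    have h0 : c 0 = 0 := by
      have := ev0 (fun t => (∑ j, c j * t ^ (j:ℕ)) - t ^ (d+1) * w t)
        (ContinuousAt.sub (by fun_prop) (ContinuousAt.mul (by fun_prop) hw))
        (by filter_upwards [h] with t ht; rw [ht, sub_self])
      simpa [Fin.sum_univ_succ] using this
    have := ih (fun j => c j.succ) w hw (by
      filter_upwards [h, self_mem_nhdsWithin] with t ht ht0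
      rw [Fin.sum_univ_succ, h0] at ht
      have ht0' : t ≠ 0 := ht0
      apply mul_left_cancel₀ ht0'
      rw [Finset.mul_sum]
      simp only [zero_mul, zero_add, Fin.val_succ] at ht
      calc _ = ∑ i : Fin d, c i.succ * t ^ ((i:ℕ)+1) := by
            refine Finset.sum_congr rfl fun j _ => ?_
            ring
        _ = t ^ (d+1) * w t := ht
        _ = _ := by ring)
    exact ⟨fun j => by refine Fin.cases h0 (fun j => this.1 j) j, this.2⟩

section
variable {E : Type} [NormedAddCommGroup E] [NormedSpace ℝ E] [FiniteDimensional ℝ E]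

theorem wprep (y0 : E) (g : E × ℝ → ℝ) (hg : AnalyticAt ℝ g (y0, 0))
    (h0 : ¬ ∀ᶠ t in 𝓝 (0:ℝ), g (y0, t) = 0) :
    ∃ (d : ℕ) (r : Fin d → E → ℝ) (U : E × ℝ → ℝ), (∀ j, AnalyticAt ℝ (r j) y0) ∧
      AnalyticAt ℝ U (y0, 0) ∧ U (y0, 0) ≠ 0 ∧
      ∀ᶠ z in 𝓝 (y0, (0:ℝ)), g z = U z * (z.2 ^ d + ∑ j, r j z.1 * z.2 ^ (j:ℕ)) := by
  have hin : AnalyticAt ℝ (fun t : ℝ => (y0, t)) 0 := analyticAt_const.prod analyticAt_id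
  obtain ⟨d, u, hu, hu0, he⟩ := exists_order (h := fun t => g (y0, t))
    (AnalyticAt.comp (g := g) hg hin) h0
  obtain ⟨q, hq, r, hr, hz⟩ := wdiv y0 g (fun z => z.2 ^ d) hg (analyticAt_snd.pow d) d u hu hu0 he
  have hq0 : q (y0, 0) ≠ 0 := by
    have hqc : ContinuousAt (fun t : ℝ => q (y0, t)) 0 :=
      (AnalyticAt.comp (g := q) hq hin).continuousAt
    have := poly_zero d (fun j => r j y0) (fun t => 1 - u t * q (y0, t))
      (continuousAt_const.sub (hu.continuousAt.mul hqc)) (by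
        apply nhdsWithin_le_nhds
        filter_upwards [he, hin.continuousAt.eventually hz] with t h1 h2
        have h1' : g (y0, t) = t ^ d * u t := h1
        have h2' : t ^ d = g (y0, t) * q (y0, t) + ∑ j, r j y0 * t ^ (j:ℕ) := h2
        rw [h1'] at h2'
        linear_combination -h2')
    intro hq0
    have := this.2
    rw [hq0] at this
    simp at this
  refine ⟨d, fun j y => - r j y, fun z => (q z)⁻¹, fun j => (hr j).neg, hq.inv hq0,
    inv_ne_zero hq0, ?_⟩
  filter_upwards [hz, hq.continuousAt.eventually_ne hq0] with z h1 h2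
  simp only [neg_mul, Finset.sum_neg_distrib]
  rw [h1]
  field_simp
  ring

theorem hadamard (y0 : E) (f : E × ℝ → ℝ) (hf : AnalyticAt ℝ f (y0, 0)) :
    ∃ Q : E × ℝ → ℝ, AnalyticAt ℝ Q (y0, 0) ∧
      ∀ᶠ z in 𝓝 (y0, (0:ℝ)), f z = f (z.1, 0) + z.2 * Q z := by
  obtain ⟨q, hq, r, hr, hz⟩ := wdiv y0 (fun z => z.2) f analyticAt_snd hf 1 (fun _ => 1)
    analyticAt_const one_ne_zero (by simp)
  refine ⟨q, hq, ?_⟩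
  have hc : ContinuousAt (fun z : E × ℝ => (z.1, (0:ℝ))) (y0, 0) := by fun_prop
  filter_upwards [hz, hc.eventually hz] with z h1 h2
  simp at h1 h2
  rw [h2, h1]; ring

lemma analyticAt_at_zero {y0 : E} {f : E × ℝ → ℝ} (hf : AnalyticAt ℝ f (y0, 0)) :
    AnalyticAt ℝ (fun y => f (y, 0)) y0 :=
  AnalyticAt.comp (g := f) (f := fun y => (y, (0:ℝ))) hf (analyticAt_id.prod analyticAt_const)

/-- Existence of a coefficient representation. -/
def Rep (y0 : E) {k : ℕ} (F : Fin k → E × ℝ → ℝ) : Prop :=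
  ∃ (D : ℕ) (a : Fin D → Fin k → E → ℝ) (V : Fin D → E × ℝ → ℝ),
    (∀ β i, AnalyticAt ℝ (a β i) y0) ∧ (∀ β, AnalyticAt ℝ (V β) (y0, 0)) ∧
    ∀ᶠ z in 𝓝 (y0, (0:ℝ)), ∀ i, F i z =
      ∑ β : Fin D, a β i z.1 * (z.2 ^ (β:ℕ) * (1 + z.2 * V β z))

lemma Rep.mulT {y0 : E} {k : ℕ} {F G : Fin k → E × ℝ → ℝ} (h : Rep y0 F)
    (hG : ∀ᶠ z in 𝓝 (y0, (0:ℝ)), ∀ i, G i z = z.2 * F i z) : Rep y0 G := by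
  obtain ⟨D, a, V, ha, hV, he⟩ := h
  refine ⟨D + 1, Fin.cons (fun _ _ => 0) a, Fin.cons (fun _ => 0) V, ?_, ?_, ?_⟩
  · intro β i
    refine Fin.cases ?_ (fun β => ?_) β
    · exact analyticAt_const
    · exact ha β i
  · intro β
    refine Fin.cases ?_ (fun β => ?_) β
    · exact analyticAt_const
    · exact hV β
  · filter_upwards [he, hG] with z h1 h2 i
    rw [h2, h1, Fin.sum_univ_succ, Finset.mul_sum]
    simp only [Fin.cons_zero, Fin.cons_succ, zero_mul, zero_add, Fin.val_succ]
    refine Finset.sum_congr rfl fun j _ => ?_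
    ring

lemma Rep.pad {y0 : E} {k : ℕ} {F : Fin k → E × ℝ → ℝ} (h : Rep y0 F) :
    ∃ (D : ℕ) (a : Fin (D+1) → Fin k → E → ℝ) (V : Fin (D+1) → E × ℝ → ℝ),
    (∀ β i, AnalyticAt ℝ (a β i) y0) ∧ (∀ β, AnalyticAt ℝ (V β) (y0, 0)) ∧
    ∀ᶠ z in 𝓝 (y0, (0:ℝ)), ∀ i, F i z =
      ∑ β : Fin (D+1), a β i z.1 * (z.2 ^ (β:ℕ) * (1 + z.2 * V β z)) := by
  obtain ⟨D, a, V, ha, hV, he⟩ := h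
  refine ⟨D, Fin.snoc (α := fun _ => Fin k → E → ℝ) a (fun _ _ => 0),
    Fin.snoc (α := fun _ => E × ℝ → ℝ) V (fun _ => 0), ?_, ?_, ?_⟩
  · intro β i
    refine Fin.lastCases ?_ (fun β => ?_) β
    · simp only [Fin.snoc_last]; exact analyticAt_const
    · simp only [Fin.snoc_castSucc]; exact ha β i
  · intro β
    refine Fin.lastCases ?_ (fun β => ?_) β
    · simp only [Fin.snoc_last]; exact analyticAt_const
    · simp only [Fin.snoc_castSucc]; exact hV β
  · filter_upwards [he] with z h1 i
    rw [h1, Fin.sum_univ_castSucc]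
    simp

lemma elim (y0 : E) : ∀ (D : ℕ) (V : Fin D → E × ℝ → ℝ) (hV : ∀ β, AnalyticAt ℝ (V β) (y0, 0))
    (f : E × ℝ → ℝ) (hf : AnalyticAt ℝ f (y0, 0)),
    ∃ (a : Fin D → E → ℝ) (f' : E × ℝ → ℝ), (∀ β, AnalyticAt ℝ (a β) y0) ∧
      AnalyticAt ℝ f' (y0, 0) ∧ ∀ᶠ z in 𝓝 (y0, (0:ℝ)), f z =
      (∑ β : Fin D, a β z.1 * (z.2 ^ (β:ℕ) * (1 + z.2 * V β z))) + z.2 ^ D * f' z := by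
  intro D
  induction D with
  | zero => intro V hV f hf; exact ⟨fun β => β.elim0, f, fun β => β.elim0, hf, by simp⟩
  | succ D ih =>
    intro V hV f hf
    obtain ⟨a, f', ha, hf', he⟩ := ih (fun β => V β.castSucc) (fun β => hV _) f hf
    obtain ⟨Q, hQ, hQe⟩ := hadamard y0 f' hf'
    have h0 := analyticAt_at_zero hf'
    have h0' : AnalyticAt ℝ (fun z : E × ℝ => f' (z.1, 0)) (y0, 0) :=
      AnalyticAt.comp (g := fun y => f' (y, 0)) (f := fun z : E × ℝ => z.1) h0 analyticAt_fst
    refine ⟨Fin.snoc (α := fun _ => E → ℝ) a (fun y => f' (y, 0)),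
      fun z => Q z - f' (z.1, 0) * V (Fin.last D) z, ?_, hQ.sub (h0'.mul (hV _)), ?_⟩
    · intro β
      refine Fin.lastCases ?_ (fun β => ?_) β
      · simp only [Fin.snoc_last]; exact h0
      · simp only [Fin.snoc_castSucc]; exact ha β
    · filter_upwards [he, hQe] with z h1 h2
      rw [h1, Fin.sum_univ_castSucc]
      simp only [Fin.snoc_last, Fin.snoc_castSucc, Fin.val_castSucc, Fin.val_last]
      rw [h2]; ring

lemma vec_of_scalar (y0 : E)
    (hs : ∀ f : E × ℝ → ℝ, AnalyticAt ℝ f (y0, 0) → Rep y0 (fun _ : Fin 1 => f)) :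
    ∀ (k : ℕ) (F : Fin k → E × ℝ → ℝ), (∀ i, AnalyticAt ℝ (F i) (y0, 0)) → Rep y0 F := by
  intro k
  induction k with
  | zero => intro F hF; exact ⟨0, fun β => β.elim0, fun β => β.elim0, fun β => β.elim0,
      fun β => β.elim0, Filter.Eventually.of_forall fun z i => i.elim0⟩
  | succ k ih =>
    intro F hF
    obtain ⟨D, a, V, ha, hV, he⟩ := hs (F 0) (hF 0)
    choose b f' hb hf' hbe using fun i : Fin k => elim y0 D V hV (F i.succ) (hF _)
    obtain ⟨D', a', V', ha', hV', he'⟩ := ih f' hf'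
    refine ⟨D + D', Fin.append (fun β => Fin.cons (a β 0) (fun i => b i β))
      (fun β => Fin.cons (fun _ => 0) (a' β)), Fin.append V V', ?_, ?_, ?_⟩
    · intro β i
      refine Fin.addCases (fun β => ?_) (fun β => ?_) β
      · rw [Fin.append_left]
        refine Fin.cases ?_ (fun i => ?_) i
        · exact ha β 0
        · exact hb i β
      · rw [Fin.append_right]
        refine Fin.cases ?_ (fun i => ?_) i
        · exact analyticAt_const
        · exact ha' β i
    · intro β
      refine Fin.addCases (fun β => ?_) (fun β => ?_) β
      · rw [Fin.append_left]; exact hV β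
      · rw [Fin.append_right]; exact hV' β
    · filter_upwards [he, he', Filter.eventually_all.2 hbe] with z h1 h2 h3 i
      rw [Fin.sum_univ_add]
      simp only [Fin.append_left, Fin.append_right, Fin.val_castAdd, Fin.val_natAdd]
      refine Fin.cases ?_ (fun i => ?_) i
      · rw [h1 0]; simp
      · rw [h3 i, h2 i, Finset.mul_sum]
        simp only [Fin.cons_succ]
        congr 1
        refine Finset.sum_congr rfl fun j _ => ?_
        ring

lemma not_div (y0 : E) (f : E × ℝ → ℝ) (hf : AnalyticAt ℝ f (y0, 0))
    (h0 : ¬ ∀ᶠ z in 𝓝 (y0, (0:ℝ)), f z = 0) :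
    ∃ m : ℕ, ¬ ∃ h : E × ℝ → ℝ, AnalyticAt ℝ h (y0, 0) ∧
      ∀ᶠ z in 𝓝 (y0, (0:ℝ)), f z = z.2 ^ m * h z := by
  obtain ⟨c, hc⟩ := exists_dir hf h0
  have hl : AnalyticAt ℝ (fun s : ℝ => (y0, (0:ℝ)) + s • c) 0 :=
    analyticAt_const.fun_add (analyticAt_id.fun_smul analyticAt_const)
  have hl0 : (y0, (0:ℝ)) + (0:ℝ) • c = (y0, 0) := by simp
  obtain ⟨d, u, hu, hu0, he⟩ := exists_order (h := fun s : ℝ => f ((y0, (0:ℝ)) + s • c))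
    (AnalyticAt.comp (g := f) (by rw [hl0]; exact hf) hl) hc
  refine ⟨d + 1, ?_⟩
  rintro ⟨h, hh, hhe⟩
  apply hu0
  have hht := hl.continuousAt.tendsto
  rw [hl0] at hht
  have hhc : ContinuousAt (fun s : ℝ => h ((y0, (0:ℝ)) + s • c)) 0 :=
    (AnalyticAt.comp (g := h) (by rw [hl0]; exact hh) hl).continuousAt
  have := poly_zero d (fun _ => 0) (fun s => u s - s * c.2 ^ (d+1) * h ((y0, (0:ℝ)) + s • c))
    (hu.continuousAt.sub ((by fun_prop : ContinuousAt (fun s : ℝ => s * c.2 ^ (d+1)) 0).mul hhc)) (by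
      apply nhdsWithin_le_nhds
      filter_upwards [he, hht.eventually hhe] with s h1 h2
      rw [h1] at h2
      simp only [Prod.snd_add, Prod.smul_snd, smul_eq_mul, zero_add] at h2
      rw [mul_sub, h2]
      simp only [zero_mul, Finset.sum_const_zero]
      ring)
  simpa using this.2

lemma rep_ne (y0 : E) (f : E × ℝ → ℝ) (hf : AnalyticAt ℝ f (y0, 0)) (h0 : f (y0, 0) ≠ 0) :
    Rep y0 (fun _ : Fin 1 => f) := by
  have h1 := analyticAt_at_zero hf
  obtain ⟨Q, hQ, hQe⟩ := hadamard y0 f hf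
  have h2 : AnalyticAt ℝ (fun z : E × ℝ => f (z.1, 0)) (y0, 0) :=
    AnalyticAt.comp (g := fun y => f (y, 0)) (f := fun z : E × ℝ => z.1) h1 analyticAt_fst
  refine ⟨1, fun _ _ y => f (y, 0), fun _ z => (f (z.1, 0))⁻¹ * Q z, fun _ _ => h1,
    fun _ => (h2.inv h0).mul hQ, ?_⟩
  filter_upwards [hQe, h2.continuousAt.eventually_ne h0] with z hz hz0 i
  simp
  rw [hz]
  field_simp

/-- reduction of the scalar case to `f (·,0)` not identically zero -/
lemma scalar_of_main (y0 : E)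
    (hm : ∀ f : E × ℝ → ℝ, AnalyticAt ℝ f (y0, 0) → (¬ ∀ᶠ y in 𝓝 y0, f (y, 0) = 0) →
      Rep y0 (fun _ : Fin 1 => f)) :
    ∀ f : E × ℝ → ℝ, AnalyticAt ℝ f (y0, 0) → Rep y0 (fun _ : Fin 1 => f) := by
  have key : ∀ (m : ℕ) (f : E × ℝ → ℝ), AnalyticAt ℝ f (y0, 0) →
      (¬ ∃ h : E × ℝ → ℝ, AnalyticAt ℝ h (y0, 0) ∧
      ∀ᶠ z in 𝓝 (y0, (0:ℝ)), f z = z.2 ^ m * h z) → Rep y0 (fun _ : Fin 1 => f) := by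
    intro m
    induction m with
    | zero => intro f hf h; exact absurd ⟨f, hf, by simp⟩ h
    | succ m ih =>
      intro f hf h
      by_cases h0 : ∀ᶠ y in 𝓝 y0, f (y, 0) = 0
      · obtain ⟨Q, hQ, hQe⟩ := hadamard y0 f hf
        have h1 : ∀ᶠ z in 𝓝 (y0, (0:ℝ)), f z = z.2 * Q z := by
          have hc : ContinuousAt (fun z : E × ℝ => z.1) (y0, 0) := by fun_prop
          filter_upwards [hQe, hc.eventually h0] with z h1 h2
          rw [h1, h2, zero_add]
        refine Rep.mulT (ih Q hQ ?_) (F := fun _ => Q) (by filter_upwards [h1] with z h i using h)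
        rintro ⟨w, hw, hwe⟩
        refine h ⟨w, hw, ?_⟩
        filter_upwards [h1, hwe] with z h2 h3
        rw [h2, h3]; ring
      · exact hm f hf h0
  intro f hf
  by_cases h0 : ∀ᶠ z in 𝓝 (y0, (0:ℝ)), f z = 0
  · exact ⟨0, fun β => β.elim0, fun β => β.elim0, fun β => β.elim0, fun β => β.elim0, by
      filter_upwards [h0] with z hz i; simpa using hz⟩
  · obtain ⟨m, hm'⟩ := not_div y0 f hf h0
    exact key m f hf hm'

end

theorem coefRep (n : ℕ) : ∀ (E : Type) [NormedAddCommGroup E] [NormedSpace ℝ E]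
    [FiniteDimensional ℝ E], Module.finrank ℝ E = n → ∀ (y0 : E) (k : ℕ) (F : Fin k → E × ℝ → ℝ),
    (∀ i, AnalyticAt ℝ (F i) (y0, 0)) → Rep y0 F := by
  induction n with
  | zero =>
    intro E _ _ _ hn y0
    apply vec_of_scalar
    apply scalar_of_main
    intro f hf h0
    haveI : Subsingleton E := Module.finrank_zero_iff.1 hn
    have ha : f (y0, 0) ≠ 0 := by
      intro h
      apply h0
      filter_upwards with y
      rw [Subsingleton.elim y y0, h]
    obtain ⟨Q, hQ, hQe⟩ := hadamard y0 f hf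
    refine ⟨1, fun _ _ _ => f (y0, 0), fun _ z => (f (y0, 0))⁻¹ * Q z, fun _ _ => analyticAt_const,
      fun _ => analyticAt_const.mul hQ, ?_⟩
    filter_upwards [hQe] with z hz i
    have : z.1 = y0 := Subsingleton.elim _ _
    rw [hz, this]
    simp
    field_simp
  | succ n ih =>
    intro E _ _ _ hn y0
    apply vec_of_scalar
    apply scalar_of_main
    intro f hf h0
    have haA := analyticAt_at_zero hf
    by_cases hf0 : f (y0, 0) ≠ 0
    · exact rep_ne y0 f hf hf0
    push Not at hf0
    obtain ⟨c, hc⟩ := exists_dir haA h0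
    have hc0 : c ≠ 0 := by
      rintro rfl
      apply hc
      filter_upwards with t
      simpa using hf0
    obtain ⟨L, hL⟩ := exists_coord hn hc0
    have hLs : L.symm (0, 1) = c := by rw [← hL]; simp
    have hLi : AnalyticAt ℝ (fun w : ((Fin n → ℝ) × ℝ) × ℝ => y0 + L.symm (w.1.1, w.2))
        ((0, 0), 0) := by
      refine analyticAt_const.fun_add ?_
      exact AnalyticAt.comp (g := fun v => L.symm v)
        (f := fun w : ((Fin n → ℝ) × ℝ) × ℝ => (w.1.1, w.2))
        (L.symm.analyticAt _)
        (AnalyticAt.prod (AnalyticAt.comp (g := fun v : (Fin n → ℝ) × ℝ => v.1) analyticAt_fst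
          analyticAt_fst) analyticAt_snd)
    have hb : y0 + L.symm ((0 : Fin n → ℝ), (0:ℝ)) = y0 := by
      have : ((0 : Fin n → ℝ), (0:ℝ)) = 0 := rfl
      rw [this]; simp
    let g : ((Fin n → ℝ) × ℝ) × ℝ → ℝ := fun w => f (y0 + L.symm (w.1.1, w.2), 0)
    let ft : ((Fin n → ℝ) × ℝ) × ℝ → ℝ := fun w => f (y0 + L.symm (w.1.1, w.2), w.1.2)
    have hg : AnalyticAt ℝ g ((0, 0), 0) :=
      AnalyticAt.comp (g := f) (f := fun w : ((Fin n → ℝ) × ℝ) × ℝ =>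
        (y0 + L.symm (w.1.1, w.2), (0:ℝ)))
        (by simp only [hb]; exact hf) (hLi.prod analyticAt_const)
    have hft : AnalyticAt ℝ ft ((0, 0), 0) :=
      AnalyticAt.comp (g := f) (f := fun w : ((Fin n → ℝ) × ℝ) × ℝ =>
        (y0 + L.symm (w.1.1, w.2), w.1.2))
        (by simp only [hb]; exact hf) (hLi.prod (AnalyticAt.comp
          (g := fun v : (Fin n → ℝ) × ℝ => v.2) analyticAt_snd analyticAt_fst))
    have hgs : ∀ s : ℝ, g ((0, 0), s) = f (y0 + s • c, 0) := by
      intro s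
      have : ((0 : Fin n → ℝ), s) = s • ((0 : Fin n → ℝ), (1:ℝ)) := by simp
      simp only [g]
      rw [this, map_smul, hLs]
    obtain ⟨d, u, hu, hu0, he⟩ := exists_order (h := fun s => g ((0, 0), s))
      (AnalyticAt.comp (g := g) (f := fun s : ℝ => (((0 : Fin n → ℝ), (0:ℝ)), s)) hg
        (analyticAt_const.prod analyticAt_id)) (by simpa only [hgs] using hc)
    obtain ⟨q, hq, r, hr, hz⟩ := wdiv ((0 : Fin n → ℝ), (0:ℝ)) g ft hg hft d u hu hu0 he
    obtain ⟨D, b, Vb, hb', hVb, hbe⟩ := (ih (Fin n → ℝ) (by simp) 0 d r hr).pad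
    have hlam : AnalyticAt ℝ (fun y : E => L (y - y0)) y0 :=
      AnalyticAt.comp (g := fun v => L v) (L.analyticAt _) (analyticAt_id.fun_sub analyticAt_const)
    have hlam0 : L (y0 - y0) = ((0 : Fin n → ℝ), (0:ℝ)) := by simp; rfl
    have hlam1 : AnalyticAt ℝ (fun y : E => (L (y - y0)).1) y0 :=
      AnalyticAt.comp (g := fun v : (Fin n → ℝ) × ℝ => v.1) analyticAt_fst hlam
    have hlam2 : AnalyticAt ℝ (fun y : E => (L (y - y0)).2) y0 :=
      AnalyticAt.comp (g := fun v : (Fin n → ℝ) × ℝ => v.2) analyticAt_snd hlam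
    have hz1 : AnalyticAt ℝ (fun z : E × ℝ => (L (z.1 - y0)).1) (y0, 0) :=
      AnalyticAt.comp (g := fun y => (L (y - y0)).1) hlam1 analyticAt_fst
    have hz2 : AnalyticAt ℝ (fun z : E × ℝ => (L (z.1 - y0)).2) (y0, 0) :=
      AnalyticAt.comp (g := fun y => (L (y - y0)).2) hlam2 analyticAt_fst
    have hJ : AnalyticAt ℝ (fun z : E × ℝ => (((L (z.1 - y0)).1, z.2), (L (z.1 - y0)).2)) (y0, 0) :=
      (hz1.prod analyticAt_snd).prod hz2
    have hJ' : AnalyticAt ℝ (fun z : E × ℝ => ((L (z.1 - y0)).1, z.2)) (y0, 0) :=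
      (hz1.prod analyticAt_snd)
    let Q : E × ℝ → ℝ := fun z => q (((L (z.1 - y0)).1, z.2), (L (z.1 - y0)).2)
    have hQ : AnalyticAt ℝ Q (y0, 0) := AnalyticAt.comp (g := q)
      (f := fun z : E × ℝ => (((L (z.1 - y0)).1, z.2), (L (z.1 - y0)).2))
      (by simp only [hlam0]; exact hq) hJ
    obtain ⟨Q1, hQ1, hQe⟩ := hadamard y0 Q hQ
    have hQ0 : AnalyticAt ℝ (fun z : E × ℝ => Q (z.1, 0)) (y0, 0) :=
      AnalyticAt.comp (g := fun y => Q (y, 0)) (f := fun z : E × ℝ => z.1)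
        (analyticAt_at_zero hQ) analyticAt_fst
    let Vt : Fin (D+1) → E × ℝ → ℝ := fun γ z => Vb γ ((L (z.1 - y0)).1, z.2)
    have hVt : ∀ γ, AnalyticAt ℝ (Vt γ) (y0, 0) := fun γ => AnalyticAt.comp (g := Vb γ)
      (f := fun z : E × ℝ => ((L (z.1 - y0)).1, z.2)) (by simp only [hlam0]; exact hVb γ) hJ'
    let B : Fin (D+1) → E → ℝ := fun γ y => ∑ j : Fin d, b γ j (L (y - y0)).1 * (L (y - y0)).2 ^ (j:ℕ)
    have hB : ∀ γ, AnalyticAt ℝ (B γ) y0 := fun γ => Finset.analyticAt_fun_sum _ fun j _ =>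
      (AnalyticAt.comp (g := b γ j) (f := fun y : E => (L (y - y0)).1)
        (by simp only [hlam0]; exact hb' γ j) hlam1).mul (hlam2.pow _)
    have hJt : Filter.Tendsto (fun z : E × ℝ => (((L (z.1 - y0)).1, z.2), (L (z.1 - y0)).2))
        (𝓝 (y0, 0)) (𝓝 ((0, 0), 0)) := by
      have := hJ.continuousAt.tendsto
      simp only [hlam0] at this
      exact this
    have hJt' : Filter.Tendsto (fun z : E × ℝ => ((L (z.1 - y0)).1, z.2))
        (𝓝 (y0, 0)) (𝓝 (0, 0)) := by
      have := hJ'.continuousAt.tendsto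
      simp only [hlam0] at this
      exact this
    have main : ∀ᶠ z in 𝓝 (y0, (0:ℝ)), f z = f (z.1, 0) * Q z +
        ∑ γ : Fin (D+1), B γ z.1 * (z.2 ^ (γ:ℕ) * (1 + z.2 * Vt γ z)) := by
      filter_upwards [hJt.eventually hz, hJt'.eventually hbe] with z h1 h2
      have e1 : ft (((L (z.1 - y0)).1, z.2), (L (z.1 - y0)).2) = f z := by
        simp only [ft, Prod.mk.eta, ContinuousLinearEquiv.symm_apply_apply, add_sub_cancel]
      have e2 : g (((L (z.1 - y0)).1, z.2), (L (z.1 - y0)).2) = f (z.1, 0) := by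
        simp only [g, Prod.mk.eta, ContinuousLinearEquiv.symm_apply_apply, add_sub_cancel]
      rw [e1, e2] at h1
      rw [h1]
      congr 1
      simp only [B, Finset.sum_mul]
      rw [Finset.sum_comm]
      refine Finset.sum_congr rfl fun j _ => ?_
      rw [h2 j, Finset.sum_mul]
      refine Finset.sum_congr rfl fun γ _ => ?_
      simp only [Vt]
      ring
    have hc : Filter.Tendsto (fun z : E × ℝ => (z.1, (0:ℝ))) (𝓝 (y0, 0)) (𝓝 (y0, 0)) := by
      have : ContinuousAt (fun z : E × ℝ => (z.1, (0:ℝ))) (y0, 0) := by fun_prop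
      exact this
    refine ⟨D + 1, fun γ _ => Fin.cons (α := fun _ => E → ℝ) (fun y => f (y, 0)) (fun γ => B γ.succ) γ,
      Fin.cons (α := fun _ => E × ℝ → ℝ)
        (fun z => Q1 z + (1 - Q (z.1, 0)) * Vt 0 z) (fun γ => Vt γ.succ), ?_, ?_, ?_⟩
    · intro γ _
      refine Fin.cases ?_ (fun γ => ?_) γ
      · exact haA
      · exact hB γ.succ
    · intro γ
      refine Fin.cases ?_ (fun γ => ?_) γ
      · exact hQ1.add ((analyticAt_const.sub hQ0).mul (hVt 0))
      · exact hVt γ.succ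
    · filter_upwards [main, hc.eventually main, hQe] with z h1 h2 h3 i
      rw [Fin.sum_univ_succ] at h1 h2 ⊢
      simp only [Fin.cons_zero, Fin.cons_succ, Fin.val_zero, Fin.val_succ, pow_zero] at h1 h2 ⊢
      simp only [zero_mul, add_zero, mul_one, pow_succ, mul_zero, Finset.sum_const_zero] at h2
      rw [h1, h3]
      simp only [pow_succ]
      linear_combination (-(z.2 * Vt 0 z) - 1) * h2
end TA
end PartA3

section PartA4
namespace TA

lemma ev_zero {u : ℝ → ℝ} (hu : ContinuousAt u 0) (h : ∀ᶠ t in 𝓝[≠] (0:ℝ), u t = 0) : u 0 = 0 := by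
  have h1 : Filter.Tendsto u (𝓝[≠] 0) (𝓝 (u 0)) := hu.tendsto.mono_left nhdsWithin_le_nhds
  have h2 : Filter.Tendsto u (𝓝[≠] 0) (𝓝 0) :=
    tendsto_const_nhds.congr' (by filter_upwards [h] with t ht using ht.symm)
  exact tendsto_nhds_unique h1 h2

lemma poly_zero2 (d : ℕ) : ∀ (c : Fin d → ℝ) (v : Fin d → ℝ → ℝ), (∀ j, ContinuousAt (v j) 0) →
    (∀ᶠ t in 𝓝[≠] (0:ℝ), ∑ j, c j * (t ^ (j:ℕ) * (1 + t * v j t)) = 0) → ∀ j, c j = 0 := by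
  induction d with
  | zero => intro c v hv h j; exact j.elim0
  | succ d ih =>
    intro c v hv h
    have hcont : ContinuousAt (fun t => ∑ j, c j * (t ^ (j:ℕ) * (1 + t * v j t))) 0 := by
      have := hv
      apply tendsto_finsetSum
      intro j _
      have := hv j
      have h2 : ContinuousAt (fun t => c j * (t ^ (j:ℕ) * (1 + t * v j t))) 0 := by fun_prop
      exact h2
    have h0 : c 0 = 0 := by
      have := ev_zero hcont h
      simpa [Fin.sum_univ_succ] using this
    have := ih (fun j => c j.succ) (fun j => v j.succ) (fun j => hv _) (by
      filter_upwards [h, self_mem_nhdsWithin] with t ht ht0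
      rw [Fin.sum_univ_succ, h0] at ht
      have ht0' : t ≠ 0 := ht0
      apply mul_left_cancel₀ ht0'
      rw [Finset.mul_sum, mul_zero]
      simp only [zero_mul, zero_add, Fin.val_succ] at ht
      rw [← ht]
      refine Finset.sum_congr rfl fun j _ => ?_
      ring)
    intro j
    exact Fin.cases h0 this j

lemma analyticAt_cons {n : ℕ} (w : (Fin n → ℝ) × ℝ) :
    AnalyticAt ℝ (fun w : (Fin n → ℝ) × ℝ => (Fin.cons w.2 w.1 : Fin (n+1) → ℝ)) w := by
  rw [analyticAt_pi_iff]
  intro i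
  refine Fin.cases ?_ (fun i => ?_) i
  · simp only [Fin.cons_zero]; exact analyticAt_snd
  · simp only [Fin.cons_succ]
    exact ((ContinuousLinearMap.proj (R := ℝ) (φ := fun _ : Fin n => ℝ) i).comp
      (ContinuousLinearMap.fst ℝ (Fin n → ℝ) ℝ)).analyticAt w

lemma analyticAt_proj {n : ℕ} (i : Fin n) (x : Fin n → ℝ) :
    AnalyticAt ℝ (fun x : Fin n → ℝ => x i) x :=
  (ContinuousLinearMap.proj (R := ℝ) (φ := fun _ : Fin n => ℝ) i).analyticAt x

lemma analyticAt_tail {n : ℕ} (x : Fin (n+1) → ℝ) :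
    AnalyticAt ℝ (fun x : Fin (n+1) → ℝ => (Fin.tail x : Fin n → ℝ)) x := by
  rw [analyticAt_pi_iff]
  intro i
  exact analyticAt_proj i.succ x

theorem good (n : ℕ) : ∀ (E : Type) [NormedAddCommGroup E] [NormedSpace ℝ E]
    [FiniteDimensional ℝ E] (y0 : E) (κ : Type) [Fintype κ] (F : κ → E × (Fin n → ℝ) → ℝ)
    (_ : ∀ i, AnalyticAt ℝ (F i) (y0, 0)),
    ∃ (ι : Type) (_ : Fintype ι) (a : ι → κ → E → ℝ) (W : ι → E × (Fin n → ℝ) → ℝ),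
      (∀ β i, AnalyticAt ℝ (a β i) y0) ∧ (∀ β, AnalyticAt ℝ (W β) (y0, 0)) ∧
      (∀ᶠ z in 𝓝 (y0, (0 : Fin n → ℝ)), ∀ i, F i z = ∑ β, a β i z.1 * W β z) ∧
      ∀ c : ι → ℝ, (∀ᶠ x in 𝓝 (0 : Fin n → ℝ), ∑ β, c β * W β (y0, x) = 0) → c = 0 := by
  induction n with
  | zero =>
    intro E _ _ _ y0 κ _ F hF
    refine ⟨Unit, inferInstance, fun _ i y => F i (y, 0), fun _ _ => 1, fun _ i => ?_,
      fun _ => analyticAt_const, ?_, ?_⟩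
    · exact AnalyticAt.comp (g := F i) (f := fun y => (y, (0 : Fin 0 → ℝ))) (hF i)
        (analyticAt_id.prod analyticAt_const)
    · filter_upwards with z i
      simp only [Finset.univ_unique, Finset.sum_const, Finset.card_singleton, one_smul, mul_one]
      congr 1
      ext
      · rfl
      · rename_i j; exact j.elim0
    · intro c hc
      have := hc.self_of_nhds
      ext ⟨⟩
      simpa using this
  | succ n ih =>
    intro E _ _ _ y0 κ _ F hF
    let e := Fintype.equivFin κ
    let Ft : Fin (Fintype.card κ) → (E × (Fin n → ℝ)) × ℝ → ℝ :=
      fun i z => F (e.symm i) (z.1.1, Fin.cons z.2 z.1.2)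
    have hcons0 : (Fin.cons (0:ℝ) (0 : Fin n → ℝ) : Fin (n+1) → ℝ) = 0 := by
      ext i; refine Fin.cases ?_ (fun i => ?_) i <;> simp
    have hFt : ∀ i, AnalyticAt ℝ (Ft i) ((y0, 0), 0) := by
      intro i
      refine AnalyticAt.comp (g := F (e.symm i))
        (f := fun z : (E × (Fin n → ℝ)) × ℝ => (z.1.1, (Fin.cons z.2 z.1.2 : Fin (n+1) → ℝ))) ?_ ?_
      · simp only [hcons0]; exact hF _
      · refine AnalyticAt.prod ?_ ?_
        · exact AnalyticAt.comp (g := fun v : E × (Fin n → ℝ) => v.1) analyticAt_fst analyticAt_fst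
        · exact AnalyticAt.comp (g := fun w : (Fin n → ℝ) × ℝ => (Fin.cons w.2 w.1 : Fin (n+1) → ℝ))
            (f := fun z : (E × (Fin n → ℝ)) × ℝ => (z.1.2, z.2))
            (analyticAt_cons _) (AnalyticAt.prod (AnalyticAt.comp
              (g := fun v : E × (Fin n → ℝ) => v.2) analyticAt_snd analyticAt_fst) analyticAt_snd)
    obtain ⟨D, A, V, hA, hV, hAe⟩ := coefRep _ (E × (Fin n → ℝ)) rfl (y0, 0) _ Ft hFt
    obtain ⟨ι, _, a, W, ha, hW, hWe, hind⟩ := ih E y0 (Fin D × κ) (fun p => A p.1 (e p.2))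
      (fun p => hA _ _)
    have h1 : AnalyticAt ℝ (fun z : E × (Fin (n+1) → ℝ) => (z.1, (Fin.tail z.2 : Fin n → ℝ))) (y0, 0) :=
      analyticAt_fst.prod (AnalyticAt.comp (g := fun x : Fin (n+1) → ℝ => (Fin.tail x : Fin n → ℝ))
        (analyticAt_tail _) analyticAt_snd)
    have h2 : AnalyticAt ℝ (fun z : E × (Fin (n+1) → ℝ) => z.2 0) (y0, 0) :=
      AnalyticAt.comp (g := fun x : Fin (n+1) → ℝ => x 0) (analyticAt_proj _ _) analyticAt_snd
    have ht0 : (Fin.tail (0 : Fin (n+1) → ℝ) : Fin n → ℝ) = 0 := rfl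
    have h12 : Filter.Tendsto (fun z : E × (Fin (n+1) → ℝ) => ((z.1, (Fin.tail z.2 : Fin n → ℝ)), z.2 0))
      (𝓝 (y0, 0)) (𝓝 ((y0, 0), 0)) := (h1.prod h2).continuousAt.tendsto
    refine ⟨ι × Fin D, inferInstance, fun p i => a p.1 (p.2, i),
      fun p z => W p.1 (z.1, Fin.tail z.2) *
        ((z.2 0) ^ (p.2 : ℕ) * (1 + z.2 0 * V p.2 ((z.1, Fin.tail z.2), z.2 0))),
      fun p i => ha _ _, ?_, ?_, ?_⟩
    · rintro ⟨γ, j⟩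
      refine AnalyticAt.mul ?_ ((h2.pow _).mul (analyticAt_const.add (h2.mul ?_)))
      · exact AnalyticAt.comp (g := W γ)
          (f := fun z : E × (Fin (n+1) → ℝ) => (z.1, (Fin.tail z.2 : Fin n → ℝ))) (hW γ) h1
      · exact AnalyticAt.comp (g := V j) (f := fun z : E × (Fin (n+1) → ℝ) =>
          ((z.1, (Fin.tail z.2 : Fin n → ℝ)), z.2 0)) (hV j) (h1.prod h2)
    · have h1t : Filter.Tendsto (fun z : E × (Fin (n+1) → ℝ) => (z.1, (Fin.tail z.2 : Fin n → ℝ)))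
        (𝓝 (y0, 0)) (𝓝 (y0, 0)) := h1.continuousAt.tendsto
      filter_upwards [h12.eventually hAe, h1t.eventually hWe] with z g1 g2 i
      have g3 := g1 (e i)
      simp only [Ft, Equiv.symm_apply_apply, Fin.cons_self_tail] at g3
      have : F i z = F i (z.1, z.2) := rfl
      rw [this, g3, Fintype.sum_prod_type, Finset.sum_comm]
      refine Finset.sum_congr rfl fun j _ => ?_
      have g4 := g2 (j, i)
      simp only at g4
      rw [g4, Finset.sum_mul]
      refine Finset.sum_congr rfl fun γ _ => ?_
      ring
    · intro c hc
      have hcc : Filter.Tendsto (fun w : (Fin n → ℝ) × ℝ => (Fin.cons w.2 w.1 : Fin (n+1) → ℝ))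
          (𝓝 (0, 0)) (𝓝 0) := by
        have := (analyticAt_cons ((0 : Fin n → ℝ), (0:ℝ))).continuousAt.tendsto
        simp only [hcons0] at this
        exact this
      have hc' := (hcc.eventually hc).curry_nhds
      have hVc : ∀ᶠ x' in 𝓝 (0 : Fin n → ℝ), ∀ j, AnalyticAt ℝ (V j) ((y0, x'), 0) := by
        rw [Filter.eventually_all]
        intro j
        have : Filter.Tendsto (fun x' : Fin n → ℝ => ((y0, x'), (0:ℝ))) (𝓝 0) (𝓝 ((y0, 0), 0)) := by
          have : ContinuousAt (fun x' : Fin n → ℝ => ((y0, x'), (0:ℝ))) 0 := by fun_prop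
          exact this
        exact this.eventually (hV j).eventually_analyticAt
      have hall : ∀ᶠ x' in 𝓝 (0 : Fin n → ℝ), ∀ j : Fin D, ∑ γ, c (γ, j) * W γ (y0, x') = 0 := by
        filter_upwards [hc', hVc] with x' g1 g2
        refine poly_zero2 D (fun j => ∑ γ, c (γ, j) * W γ (y0, x'))
          (fun j t => V j ((y0, x'), t)) (fun j => ?_) ?_
        · exact (AnalyticAt.comp (g := V j) (f := fun t : ℝ => ((y0, x'), t)) (g2 j)
            (analyticAt_const.prod analyticAt_id)).continuousAt
        · apply nhdsWithin_le_nhds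
          filter_upwards [g1] with t g3
          simp only [Fin.tail_cons, Fin.cons_zero] at g3
          rw [Fintype.sum_prod_type, Finset.sum_comm] at g3
          rw [← g3]
          refine Finset.sum_congr rfl fun j _ => ?_
          rw [Finset.sum_mul]
          refine Finset.sum_congr rfl fun γ _ => ?_
          ring
      ext ⟨γ, j⟩
      have := hind (fun γ => c (γ, j)) (by filter_upwards [hall] with x' h using h j)
      exact congrFun this γ
end TA
end PartA4

section PartB1
namespace TA
open Polynomial

lemma sign_const_of_no_root {P : ℝ[X]} {a t : ℝ} (hat : a ≤ t) (h : ∀ s ∈ Icc a t, P.eval s ≠ 0) :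
    SignType.sign (P.eval a) = SignType.sign (P.eval t) := by
  have hc : ContinuousOn (fun s => P.eval s) (Icc a t) := P.continuous.continuousOn
  rcases lt_or_gt_of_ne (h a ⟨le_rfl, hat⟩) with h1 | h1 <;>
  rcases lt_or_gt_of_ne (h t ⟨hat, le_rfl⟩) with h2 | h2
  · rw [sign_neg h1, sign_neg h2]
  · obtain ⟨s, hs, h3⟩ := intermediate_value_Icc hat hc ⟨h1.le, h2.le⟩
    exact absurd h3 (h s hs)
  · obtain ⟨s, hs, h3⟩ := intermediate_value_Icc' hat hc ⟨h2.le, h1.le⟩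
    exact absurd h3 (h s hs)
  · rw [sign_pos h1, sign_pos h2]

lemma poly_rolle {P : ℝ[X]} {a b : ℝ} (hab : a < b) (h : P.eval a = P.eval b) :
    ∃ s ∈ Ioo a b, (derivative P).eval s = 0 := by
  obtain ⟨s, hs, h⟩ := exists_deriv_eq_zero (f := fun x => P.eval x) hab P.continuous.continuousOn h
  exact ⟨s, hs, by rwa [Polynomial.deriv] at h⟩

/-- no critical points and a root inside forces opposite end signs -/
lemma opp_signs {P : ℝ[X]} {a r b : ℝ} (har : a < r) (hrb : r < b) (hr : P.eval r = 0)
    (h : ∀ s ∈ Ioo a b, (derivative P).eval s ≠ 0) :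
    (P.eval a < 0 ∧ 0 < P.eval b) ∨ (0 < P.eval a ∧ P.eval b < 0) := by
  have hinj : ∀ x ∈ Icc a b, ∀ y ∈ Icc a b, x < y → P.eval x ≠ P.eval y := by
    intro x hx y hy hxy he
    obtain ⟨s, hs, h0⟩ := poly_rolle hxy he
    exact h s ⟨lt_of_le_of_lt hx.1 hs.1, lt_of_lt_of_le hs.2 hy.2⟩ h0
  have hio : InjOn (fun x => P.eval x) (Icc a b) := by
    intro x hx y hy he
    rcases lt_trichotomy x y with h1 | h1 | h1
    · exact absurd he (hinj x hx y hy h1)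
    · exact h1
    · exact absurd he.symm (hinj y hy x hx h1)
  have hab := har.trans hrb
  rcases ContinuousOn.strictMonoOn_of_injOn_Icc' hab.le P.continuous.continuousOn hio with hm | hm
  · left
    constructor
    · rw [← hr]; exact hm ⟨le_rfl, hab.le⟩ ⟨har.le, hrb.le⟩ har
    · rw [← hr]; exact hm ⟨har.le, hrb.le⟩ ⟨hab.le, le_rfl⟩ hrb
  · right
    constructor
    · rw [← hr]; exact hm ⟨le_rfl, hab.le⟩ ⟨har.le, hrb.le⟩ har
    · rw [← hr]; exact hm ⟨har.le, hrb.le⟩ ⟨hab.le, le_rfl⟩ hrb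

structure Compat (lo hi : ℝ) (M : Set (ℝ × ℝ)) : Prop where
  fin : M.Finite
  hlo : (lo, lo) ∈ M
  hhi : (hi, hi) ∈ M
  rng : ∀ z ∈ M, z.1 ∈ Icc lo hi ∧ z.2 ∈ Icc lo hi
  mono : ∀ z ∈ M, ∀ w ∈ M, (z.1 < w.1 ↔ z.2 < w.2)

def RM (M : Set (ℝ × ℝ)) (t t' : ℝ) : Prop := ∀ z ∈ M, (z.1 < t ↔ z.2 < t') ∧ (t < z.1 ↔ t' < z.2)

lemma Compat.swap {lo hi : ℝ} {M : Set (ℝ × ℝ)} (h : Compat lo hi M) :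
    Compat lo hi (Prod.swap ⁻¹' M) :=
  ⟨h.fin.preimage Prod.swap_injective.injOn, h.hlo, h.hhi, fun z hz => (h.rng _ hz).symm,
    fun z hz w hw => (h.mono _ hz _ hw).symm⟩

lemma RM.swap {M : Set (ℝ × ℝ)} {t t' : ℝ} (h : RM M t t') : RM (Prod.swap ⁻¹' M) t' t :=
  fun z hz => ⟨(h _ hz).1.symm, (h _ hz).2.symm⟩

lemma RM.swap' {M : Set (ℝ × ℝ)} {t t' : ℝ} (h : RM (Prod.swap ⁻¹' M) t' t) : RM M t t' :=
  fun z hz => ⟨(h (z.2, z.1) hz).1.symm, (h (z.2, z.1) hz).2.symm⟩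

lemma Compat.mem_RM {lo hi : ℝ} {M : Set (ℝ × ℝ)} (h : Compat lo hi M) {z : ℝ × ℝ} (hz : z ∈ M) :
    RM M z.1 z.2 := fun w hw => ⟨h.mono _ hw _ hz, h.mono _ hz _ hw⟩

lemma RM.eq_of {M : Set (ℝ × ℝ)} {t t' : ℝ} (h : RM M t t') {z : ℝ × ℝ} (hz : z ∈ M)
    (e : t = z.1) : t' = z.2 := by
  have := h z hz
  rw [e] at this
  simp only [lt_irrefl, false_iff, not_lt] at this
  exact le_antisymm this.1 this.2

lemma Compat.gap {lo hi : ℝ} {M : Set (ℝ × ℝ)} (h : Compat lo hi M) {t : ℝ} (ht : t ∈ Icc lo hi)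
    (hn : ∀ z ∈ M, z.1 ≠ t) : ∃ a ∈ M, ∃ b ∈ M, a.1 < t ∧ t < b.1 ∧
      (∀ z ∈ M, z.1 ≤ a.1 ∨ b.1 ≤ z.1) ∧ (∀ z ∈ M, z.2 ≤ a.2 ∨ b.2 ≤ z.2) ∧
      (∀ t', a.2 < t' → t' < b.2 → RM M t t') ∧ a.2 < b.2 := by
  obtain ⟨a, ha, hamax⟩ := (h.fin.subset (sep_subset M fun z => z.1 < t)).exists_maximalFor
    Prod.fst _ ⟨(lo, lo), h.hlo, lt_of_le_of_ne ht.1 (hn _ h.hlo)⟩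
  obtain ⟨b, hb, hbmin⟩ := (h.fin.subset (sep_subset M fun z => t < z.1)).exists_minimalFor
    Prod.fst _ ⟨(hi, hi), h.hhi, lt_of_le_of_ne ht.2 (hn _ h.hhi).symm⟩
  have key : ∀ z ∈ M, (z.1 < t ∧ z.1 ≤ a.1) ∨ (t < z.1 ∧ b.1 ≤ z.1) := by
    intro z hz
    rcases lt_or_gt_of_ne (hn z hz) with h1 | h1
    · left
      refine ⟨h1, ?_⟩
      by_contra hc
      push Not at hc
      exact absurd (hamax ⟨hz, h1⟩ hc.le) (not_le.2 hc)
    · right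
      refine ⟨h1, ?_⟩
      by_contra hc
      push Not at hc
      exact absurd (hbmin ⟨hz, h1⟩ hc.le) (not_le.2 hc)
  have le2 : ∀ z ∈ M, ∀ w ∈ M, z.1 ≤ w.1 → z.2 ≤ w.2 := by
    intro z hz w hw hle
    by_contra hc
    push Not at hc
    exact absurd ((h.mono _ hw _ hz).2 hc) (not_lt.2 hle)
  refine ⟨a, ha.1, b, hb.1, ha.2, hb.2, fun z hz => (key z hz).imp And.right And.right,
    fun z hz => (key z hz).imp (fun h => le2 z hz a ha.1 h.2) (fun h => le2 b hb.1 z hz h.2), ?_, ?_⟩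
  · intro t' h1 h2 z hz
    rcases key z hz with ⟨k1, k2⟩ | ⟨k1, k2⟩
    · have := le2 z hz a ha.1 k2
      constructor
      · exact ⟨fun _ => by linarith, fun _ => k1⟩
      · exact ⟨fun _ => by linarith, fun _ => by linarith⟩
    · have := le2 b hb.1 z hz k2
      constructor
      · exact ⟨fun _ => by linarith, fun _ => by linarith⟩
      · exact ⟨fun _ => by linarith, fun _ => k1⟩
  · exact (h.mono _ ha.1 _ hb.1).1 (ha.2.trans hb.2)

lemma Compat.total {lo hi : ℝ} {M : Set (ℝ × ℝ)} (h : Compat lo hi M) {t : ℝ} (ht : t ∈ Icc lo hi) :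
    ∃ t' ∈ Icc lo hi, RM M t t' := by
  by_cases hn : ∀ z ∈ M, z.1 ≠ t
  · obtain ⟨a, ha, b, hb, h1, h2, -, -, h3, h4⟩ := h.gap ht hn
    refine ⟨(a.2 + b.2) / 2, ?_, h3 _ (by linarith) (by linarith)⟩
    have := (h.rng a ha).2
    have := (h.rng b hb).2
    simp only [mem_Icc] at *
    constructor <;> linarith
  · push Not at hn
    obtain ⟨z, hz, rfl⟩ := hn
    exact ⟨z.2, (h.rng z hz).2, h.mem_RM hz⟩

lemma Compat.rootMatch {lo hi : ℝ} {M : Set (ℝ × ℝ)} (h : Compat lo hi M) {P P' : ℝ[X]}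
    (hs : ∀ z ∈ M, SignType.sign (P.eval z.1) = SignType.sign (P'.eval z.2))
    (hd : ∀ s ∈ Icc lo hi, (derivative P).eval s = 0 → ∃ z ∈ M, z.1 = s)
    {r : ℝ} (hr : r ∈ Icc lo hi) (hr0 : P.eval r = 0) :
    ∃ r' ∈ Icc lo hi, P'.eval r' = 0 ∧ RM M r r' := by
  by_cases hn : ∀ z ∈ M, z.1 ≠ r
  · obtain ⟨a, ha, b, hb, h1, h2, h3, -, h4, h5⟩ := h.gap hr hn
    have hopp := opp_signs h1 h2 hr0 (by
      intro s hs0 hds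
      obtain ⟨z, hz, rfl⟩ := hd s ⟨(h.rng a ha).1.1.trans hs0.1.le,
        hs0.2.le.trans (h.rng b hb).1.2⟩ hds
      rcases h3 z hz with h | h
      · exact absurd hs0.1 (not_lt.2 h)
      · exact absurd hs0.2 (not_lt.2 h))
    have hsa := hs a ha
    have hsb := hs b hb
    have hc : ContinuousOn (fun s => P'.eval s) (Icc a.2 b.2) := P'.continuous.continuousOn
    have : ∃ r' ∈ Ioo a.2 b.2, P'.eval r' = 0 := by
      rcases hopp with ⟨k1, k2⟩ | ⟨k1, k2⟩
      · rw [sign_neg k1] at hsa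
        rw [sign_pos k2] at hsb
        have k3 := sign_eq_neg_one_iff.1 hsa.symm
        have k4 := sign_eq_one_iff.1 hsb.symm
        exact intermediate_value_Ioo h5.le hc ⟨k3, k4⟩
      · rw [sign_pos k1] at hsa
        rw [sign_neg k2] at hsb
        have k3 := sign_eq_one_iff.1 hsa.symm
        have k4 := sign_eq_neg_one_iff.1 hsb.symm
        exact intermediate_value_Ioo' h5.le hc ⟨k4, k3⟩
    obtain ⟨r', hr', h0⟩ := this
    exact ⟨r', ⟨(h.rng a ha).2.1.trans hr'.1.le, hr'.2.le.trans (h.rng b hb).2.2⟩, h0,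
      h4 r' hr'.1 hr'.2⟩
  · push Not at hn
    obtain ⟨z, hz, rfl⟩ := hn
    refine ⟨z.2, (h.rng z hz).2, ?_, h.mem_RM hz⟩
    have := hs z hz
    rw [hr0, sign_zero] at this
    exact sign_eq_zero_iff.1 this.symm

lemma Compat.sep {lo hi : ℝ} {M : Set (ℝ × ℝ)} (h : Compat lo hi M) {P : ℝ[X]}
    (hd : ∀ s ∈ Icc lo hi, (derivative P).eval s = 0 → ∃ z ∈ M, z.1 = s)
    {r s : ℝ} (hr : r ∈ Icc lo hi) (hs : s ∈ Icc lo hi) (hrs : r < s) (hr0 : P.eval r = 0)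
    (hs0 : P.eval s = 0) : ∃ z ∈ M, r < z.1 ∧ z.1 < s := by
  obtain ⟨x, hx, h0⟩ := poly_rolle hrs (hr0.trans hs0.symm)
  obtain ⟨z, hz, rfl⟩ := hd x ⟨hr.1.trans hx.1.le, hx.2.le.trans hs.2⟩ h0
  exact ⟨z, hz, hx⟩

/-- adding the roots of `P`, `P'` -/
lemma Compat.add {lo hi : ℝ} {M : Set (ℝ × ℝ)} (h : Compat lo hi M) {P P' : ℝ[X]}
    (hP : P ≠ 0) (hP' : P' ≠ 0)
    (hs : ∀ z ∈ M, SignType.sign (P.eval z.1) = SignType.sign (P'.eval z.2))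
    (hd : ∀ s ∈ Icc lo hi, (derivative P).eval s = 0 → ∃ z ∈ M, z.1 = s)
    (hd' : ∀ s ∈ Icc lo hi, (derivative P').eval s = 0 → ∃ z ∈ M, z.2 = s) :
    ∃ M' : Set (ℝ × ℝ), Compat lo hi M' ∧ M ⊆ M' ∧
      (∀ z ∈ M', z ∈ M ∨ (z.1 ∈ Icc lo hi ∧ z.2 ∈ Icc lo hi ∧ P.eval z.1 = 0 ∧ P'.eval z.2 = 0 ∧
        RM M z.1 z.2)) ∧
      (∀ s ∈ Icc lo hi, P.eval s = 0 → ∃ z ∈ M', z.1 = s) ∧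
      (∀ s ∈ Icc lo hi, P'.eval s = 0 → ∃ z ∈ M', z.2 = s) ∧
      ∀ t ∈ Icc lo hi, ∀ t' ∈ Icc lo hi, RM M' t t' →
        SignType.sign (P.eval t) = SignType.sign (P'.eval t') := by
  have hdS : ∀ s ∈ Icc lo hi, (derivative P').eval s = 0 → ∃ z ∈ Prod.swap ⁻¹' M, z.1 = s := by
    intro s h1 h2
    obtain ⟨z, hz, rfl⟩ := hd' s h1 h2
    exact ⟨(z.2, z.1), hz, rfl⟩
  have hsS : ∀ z ∈ Prod.swap ⁻¹' M, SignType.sign (P'.eval z.1) = SignType.sign (P.eval z.2) :=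
    fun z hz => (hs (z.2, z.1) hz).symm
  set N : Set (ℝ × ℝ) := {z | z.1 ∈ Icc lo hi ∧ z.2 ∈ Icc lo hi ∧ P.eval z.1 = 0 ∧ P'.eval z.2 = 0 ∧
        RM M z.1 z.2} with hN
  have hNfin : N.Finite := by
    refine ((Polynomial.finite_setOf_isRoot hP).prod (Polynomial.finite_setOf_isRoot hP')).subset ?_
    rintro z ⟨-, -, h3, h4, -⟩
    exact ⟨h3, h4⟩
  have lt12 : ∀ z ∈ N, ∀ w ∈ N, z.1 < w.1 → z.2 < w.2 := by
    rintro z ⟨z1, z2, z3, z4, z5⟩ w ⟨w1, w2, w3, w4, w5⟩ hlt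
    obtain ⟨x, hx, h1, h2⟩ := h.sep hd z1 w1 hlt z3 w3
    exact ((z5 x hx).2.1 h1).trans ((w5 x hx).1.1 h2)
  have lt21 : ∀ z ∈ N, ∀ w ∈ N, z.2 < w.2 → z.1 < w.1 := by
    rintro z ⟨z1, z2, z3, z4, z5⟩ w ⟨w1, w2, w3, w4, w5⟩ hlt
    obtain ⟨x, hx, h1, h2⟩ := h.swap.sep hdS z2 w2 hlt z4 w4
    exact ((z5 _ hx).2.2 h1).trans ((w5 _ hx).1.2 h2)
  have hC : Compat lo hi (M ∪ N) := by
    refine ⟨h.fin.union hNfin, Or.inl h.hlo, Or.inl h.hhi, ?_, ?_⟩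
    · rintro z (hz | hz)
      · exact h.rng z hz
      · exact ⟨hz.1, hz.2.1⟩
    · rintro z (hz | hz) w (hw | hw)
      · exact h.mono z hz w hw
      · exact (hw.2.2.2.2 z hz).1
      · exact (hz.2.2.2.2 w hw).2
      · exact ⟨lt12 z hz w hw, lt21 z hz w hw⟩
  have hroot : ∀ s ∈ Icc lo hi, P.eval s = 0 → ∃ z ∈ M ∪ N, z.1 = s := by
    intro s h1 h2
    obtain ⟨r', k1, k2, k3⟩ := h.rootMatch hs hd h1 h2
    exact ⟨(s, r'), Or.inr ⟨h1, k1, h2, k2, k3⟩, rfl⟩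
  have hroot' : ∀ s ∈ Icc lo hi, P'.eval s = 0 → ∃ z ∈ M ∪ N, z.2 = s := by
    intro s h1 h2
    obtain ⟨r', k1, k2, k3⟩ := h.swap.rootMatch hsS hdS h1 h2
    exact ⟨(r', s), Or.inr ⟨k1, h1, k2, h2, k3.swap'⟩, rfl⟩
  refine ⟨M ∪ N, hC, subset_union_left, fun z hz => hz, hroot, hroot', ?_⟩
  intro t ht t' ht' hR
  by_cases hn : ∀ z ∈ M ∪ N, z.1 ≠ t
  · obtain ⟨a, ha, b, hb, h1, h2, h3, h4, -, h5⟩ := hC.gap ht hn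
    have h1' : a.2 < t' := (hR a ha).1.1 h1
    have h2' : t' < b.2 := (hR b hb).2.1 h2
    have hsM : ∀ z ∈ M ∪ N, SignType.sign (P.eval z.1) = SignType.sign (P'.eval z.2) := by
      rintro z (hz | hz)
      · exact hs z hz
      · rw [hz.2.2.1, hz.2.2.2.1]
    have hno : ∀ s, a.1 < s → s < b.1 → P.eval s ≠ 0 := by
      intro s k1 k2 k3
      obtain ⟨z, hz, rfl⟩ := hroot s ⟨(hC.rng a ha).1.1.trans k1.le, k2.le.trans (hC.rng b hb).1.2⟩ k3
      rcases h3 z hz with h | h <;> linarith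
    have hno' : ∀ s, a.2 < s → s < b.2 → P'.eval s ≠ 0 := by
      intro s k1 k2 k3
      obtain ⟨z, hz, rfl⟩ := hroot' s ⟨(hC.rng a ha).2.1.trans k1.le, k2.le.trans (hC.rng b hb).2.2⟩ k3
      rcases h4 z hz with h | h <;> linarith
    by_cases ha0 : P.eval a.1 = 0
    · by_cases hb0 : P.eval b.1 = 0
      · obtain ⟨z, hz, k1, k2⟩ := h.sep hd (hC.rng a ha).1 (hC.rng b hb).1 (h1.trans h2) ha0 hb0
        rcases h3 z (Or.inl hz) with h | h <;> linarith
      · have hb0' : P'.eval b.2 ≠ 0 := by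
          intro h0
          have := hsM b hb
          rw [h0, sign_zero] at this
          exact hb0 (sign_eq_zero_iff.1 this)
        rw [sign_const_of_no_root h2.le, hsM b hb, sign_const_of_no_root h2'.le]
        · intro s hs
          rcases hs.2.lt_or_eq with k | k
          · exact hno' s (by linarith [hs.1]) k
          · rw [k]; exact hb0'
        · intro s hs
          rcases hs.2.lt_or_eq with k | k
          · exact hno s (by linarith [hs.1]) k
          · rw [k]; exact hb0
    · have ha0' : P'.eval a.2 ≠ 0 := by
        intro h0
        have := hsM a ha
        rw [h0, sign_zero] at this
        exact ha0 (sign_eq_zero_iff.1 this)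
      rw [← sign_const_of_no_root h1.le, hsM a ha, ← sign_const_of_no_root h1'.le]
      · intro s hs
        rcases hs.1.lt_or_eq with k | k
        · exact hno' s k (by linarith [hs.2])
        · rw [← k]; exact ha0'
      · intro s hs
        rcases hs.1.lt_or_eq with k | k
        · exact hno s k (by linarith [hs.2])
        · rw [← k]; exact ha0
  · push Not at hn
    obtain ⟨z, hz, rfl⟩ := hn
    have := hR.eq_of hz rfl
    subst this
    rcases hz with hz | hz
    · exact hs z hz
    · rw [hz.2.2.1, hz.2.2.2.1]

theorem signMatch {lo hi : ℝ} (hlt : lo < hi) {J : Type} [Fintype J] (p p' : J → ℝ[X])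
    (hco : ∀ j n, SignType.sign ((p j).coeff n) = SignType.sign ((p' j).coeff n))
    (hde : ∀ j, 0 < (p j).natDegree → ∃ k, p k = derivative (p j) ∧ p' k = derivative (p' j))
    (hrem : ∀ i j, 0 < (p j).natDegree → ∃ k, (p k).natDegree < (p j).natDegree ∧
      (∃ c > (0:ℝ), ∃ q, C c * p i = q * p j + p k) ∧
      (∃ c > (0:ℝ), ∃ q, C c * p' i = q * p' j + p' k))
    (hl : ∀ j, SignType.sign ((p j).eval lo) = SignType.sign ((p' j).eval lo))
    (hh : ∀ j, SignType.sign ((p j).eval hi) = SignType.sign ((p' j).eval hi)) :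
    ∀ t ∈ Icc lo hi, ∃ t' ∈ Icc lo hi, ∀ j,
      SignType.sign ((p j).eval t) = SignType.sign ((p' j).eval t') := by
  classical
  have hco0 : ∀ j n, (p j).coeff n = 0 ↔ (p' j).coeff n = 0 := by
    intro j n
    rw [← sign_eq_zero_iff, hco, sign_eq_zero_iff]
  have hdeg : ∀ j, (p j).natDegree = (p' j).natDegree := by
    intro j
    apply le_antisymm
    · rw [Polynomial.natDegree_le_iff_coeff_eq_zero]
      intro N hN
      rw [hco0]
      exact Polynomial.coeff_eq_zero_of_natDegree_lt hN
    · rw [Polynomial.natDegree_le_iff_coeff_eq_zero]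
      intro N hN
      rw [← hco0]
      exact Polynomial.coeff_eq_zero_of_natDegree_lt hN
  have main : ∀ S : Finset J, (∀ k ∉ S, ∀ j ∈ S, (p j).natDegree ≤ (p k).natDegree) →
      ∃ M : Set (ℝ × ℝ), Compat lo hi M ∧
        (∀ z ∈ M, ∀ i, SignType.sign ((p i).eval z.1) = SignType.sign ((p' i).eval z.2)) ∧
        (∀ t ∈ Icc lo hi, ∀ t' ∈ Icc lo hi, RM M t t' → ∀ j ∈ S,
          SignType.sign ((p j).eval t) = SignType.sign ((p' j).eval t')) ∧
        (∀ j ∈ S, 0 < (p j).natDegree → ∀ s ∈ Icc lo hi, (p j).eval s = 0 → ∃ z ∈ M, z.1 = s) ∧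
        (∀ j ∈ S, 0 < (p j).natDegree → ∀ s ∈ Icc lo hi, (p' j).eval s = 0 → ∃ z ∈ M, z.2 = s) := by
    intro S
    induction S using Finset.induction_on_max_value (fun j => (p j).natDegree) with
    | empty =>
      intro _
      refine ⟨{(lo, lo), (hi, hi)}, ⟨by simp, by simp, by simp, ?_, ?_⟩, ?_, by simp, by simp, by simp⟩
      · rintro z (rfl | rfl) <;> simp [hlt.le]
      · rintro z (rfl | rfl) w (rfl | rfl) <;> simp
      · rintro z (rfl | rfl) i
        · exact hl i
        · exact hh i
    | insert j S hj hmax ih =>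
      intro hlow
      obtain ⟨M, hM, hMs, hMd, hMe, hMe'⟩ := ih (by
        intro k hk i hi
        by_cases hkj : k = j
        · subst hkj; exact hmax i hi
        · exact hlow k (by simp [hkj, hk]) i (by simp [hi]))
      have hin : ∀ k, (p k).natDegree < (p j).natDegree → k ∈ S := by
        intro k hk
        by_contra hkS
        have := hlow k (by
          simp only [Finset.mem_insert, not_or]
          exact ⟨by rintro rfl; exact lt_irrefl _ hk, hkS⟩) j (by simp)
        omega
      rcases Nat.eq_zero_or_pos (p j).natDegree with h0 | hpos
      · refine ⟨M, hM, hMs, ?_, ?_, ?_⟩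
        · intro t ht t' ht' hR i hi
          rcases Finset.mem_insert.1 hi with rfl | hi
          · have h0' := hdeg i
            rw [h0] at h0'
            rw [Polynomial.eq_C_of_natDegree_eq_zero h0, Polynomial.eq_C_of_natDegree_eq_zero h0'.symm,
              eval_C, eval_C]
            exact hco i 0
          · exact hMd t ht t' ht' hR i hi
        · intro i hi hip
          rcases Finset.mem_insert.1 hi with rfl | hi
          · omega
          · exact hMe i hi hip
        · intro i hi hip
          rcases Finset.mem_insert.1 hi with rfl | hi
          · omega
          · exact hMe' i hi hip
      · obtain ⟨k, hk, hk'⟩ := hde j hpos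
        have hpos' : 0 < (p' j).natDegree := hdeg j ▸ hpos
        have hkd : (p k).natDegree < (p j).natDegree := by
          rw [hk]; exact Polynomial.natDegree_derivative_lt hpos.ne'
        have hkS := hin k hkd
        have hd : ∀ s ∈ Icc lo hi, (derivative (p j)).eval s = 0 → ∃ z ∈ M, z.1 = s := by
          intro s hs h0
          rcases Nat.eq_zero_or_pos (p k).natDegree with hk0 | hkp
          · exfalso
            rw [hk] at hk0
            rw [Polynomial.eq_C_of_natDegree_eq_zero hk0, eval_C] at h0
            have hz : derivative (p j) = 0 := by
              rw [Polynomial.eq_C_of_natDegree_eq_zero hk0, h0, C_0]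
            exact hpos.ne' (Polynomial.natDegree_eq_zero_of_derivative_eq_zero hz)
          · rw [← hk] at h0
            exact hMe k hkS hkp s hs h0
        have hd' : ∀ s ∈ Icc lo hi, (derivative (p' j)).eval s = 0 → ∃ z ∈ M, z.2 = s := by
          intro s hs h0
          rcases Nat.eq_zero_or_pos (p k).natDegree with hk0 | hkp
          · exfalso
            rw [hdeg, hk'] at hk0
            rw [Polynomial.eq_C_of_natDegree_eq_zero hk0, eval_C] at h0
            have hz : derivative (p' j) = 0 := by
              rw [Polynomial.eq_C_of_natDegree_eq_zero hk0, h0, C_0]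
            exact hpos'.ne' (Polynomial.natDegree_eq_zero_of_derivative_eq_zero hz)
          · rw [← hk'] at h0
            exact hMe' k hkS hkp s hs h0
        obtain ⟨M', hM', hsub, hcase, hr1, hr2, hsg⟩ := hM.add
          (P := p j) (P' := p' j) (by rintro h; rw [h] at hpos; simp at hpos)
          (by rintro h; rw [h] at hpos'; simp at hpos') (fun z hz => hMs z hz j) hd hd'
        have hRsub : ∀ t t', RM M' t t' → RM M t t' := fun t t' h z hz => h z (hsub hz)
        refine ⟨M', hM', ?_, ?_, ?_, ?_⟩
        · intro z hz i
          rcases hcase z hz with hz | ⟨z1, z2, z3, z4, z5⟩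
          · exact hMs z hz i
          · obtain ⟨k, hk, ⟨c, hc, q, h1⟩, ⟨c', hc', q', h2⟩⟩ := hrem i j hpos
            have h3 := congrArg (eval z.1) h1
            have h4 := congrArg (eval z.2) h2
            simp only [eval_mul, eval_C, eval_add, z3, z4, mul_zero, zero_add] at h3 h4
            have h5 := hMd z.1 z1 z.2 z2 z5 k (hin k hk)
            rw [← h3, ← h4, sign_mul, sign_mul, sign_pos hc, sign_pos hc', one_mul, one_mul] at h5
            exact h5
        · intro t ht t' ht' hR i hi
          rcases Finset.mem_insert.1 hi with rfl | hi
          · exact hsg t ht t' ht' hR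
          · exact hMd t ht t' ht' (hRsub _ _ hR) i hi
        · intro i hi hip s hs h0
          rcases Finset.mem_insert.1 hi with rfl | hi
          · exact hr1 s hs h0
          · obtain ⟨z, hz, h⟩ := hMe i hi hip s hs h0
            exact ⟨z, hsub hz, h⟩
        · intro i hi hip s hs h0
          rcases Finset.mem_insert.1 hi with rfl | hi
          · exact hr2 s hs h0
          · obtain ⟨z, hz, h⟩ := hMe' i hi hip s hs h0
            exact ⟨z, hsub hz, h⟩
  intro t ht
  obtain ⟨M, hM, -, hMd, -, -⟩ := main Finset.univ (by simp)
  obtain ⟨t', ht', hR⟩ := hM.total ht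
  exact ⟨t', ht', fun j => hMd t ht t' ht' hR j (Finset.mem_univ j)⟩
end TA
end PartB1

section PartB2
namespace TA
open Polynomial

section
variable {A : Type} [CommRing A]

lemma exists_prem (P Q : A[X]) (hQ : 0 < Q.natDegree) : ∃ r : A[X],
    r.natDegree < Q.natDegree ∧ (P.natDegree < Q.natDegree → r = P) ∧
    ∃ (k : ℕ) (q : A[X]), C (Q.leadingCoeff ^ (2 * k)) * P = q * Q + r := by
  induction hn : P.natDegree using Nat.strong_induction_on generalizing P with
  | _ n ih =>
    subst hn
    by_cases hlt : P.natDegree < Q.natDegree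
    · exact ⟨P, hlt, fun _ => rfl, 0, 0, by simp⟩
    push Not at hlt
    set P1 : A[X] := C (Q.leadingCoeff ^ 2) * P -
      C (Q.leadingCoeff * P.leadingCoeff) * X ^ (P.natDegree - Q.natDegree) * Q with hP1
    have hle : P1.natDegree ≤ P.natDegree := by
      refine (natDegree_sub_le _ _).trans (max_le (natDegree_C_mul_le _ _) ?_)
      refine natDegree_mul_le.trans ?_
      have := natDegree_C_mul_X_pow_le (Q.leadingCoeff * P.leadingCoeff) (P.natDegree - Q.natDegree)
      omega
    have hc : P1.coeff P.natDegree = 0 := by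
      have e : P.natDegree = Q.natDegree + (P.natDegree - Q.natDegree) := by omega
      have h2 : (C (Q.leadingCoeff * P.leadingCoeff) * X ^ (P.natDegree - Q.natDegree) * Q).coeff
          P.natDegree = Q.leadingCoeff * P.leadingCoeff * Q.leadingCoeff := by
        rw [mul_assoc, coeff_C_mul, mul_comm (X ^ _) Q]
        conv_lhs => rw [e]
        rw [show Q.natDegree + (P.natDegree - Q.natDegree) - Q.natDegree = P.natDegree - Q.natDegree by omega]
        rw [coeff_mul_X_pow]; rfl
      rw [hP1, coeff_sub, coeff_C_mul, h2]
      simp only [leadingCoeff]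
      ring
    have hlt1 : P1.natDegree < P.natDegree := by
      rcases hle.lt_or_eq with h | h
      · exact h
      · exfalso
        have h0 : P1 = 0 := by
          rw [← leadingCoeff_eq_zero, leadingCoeff, h, hc]
        rw [h0] at h
        simp at h
        omega
    obtain ⟨r, hr, -, k, q, he⟩ := ih _ hlt1 P1 rfl
    refine ⟨r, hr, fun h => absurd h (not_lt.2 hlt), k + 1,
      q + C (Q.leadingCoeff ^ (2 * k)) * (C (Q.leadingCoeff * P.leadingCoeff) *
        X ^ (P.natDegree - Q.natDegree)), ?_⟩
    have e : C (Q.leadingCoeff ^ (2 * (k + 1))) * P = C (Q.leadingCoeff ^ (2 * k)) *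
        (C (Q.leadingCoeff ^ 2) * P) := by
      rw [← mul_assoc, ← C_mul]; ring_nf
    have e2 : C (Q.leadingCoeff ^ 2) * P = P1 + C (Q.leadingCoeff * P.leadingCoeff) *
        X ^ (P.natDegree - Q.natDegree) * Q := by rw [hP1]; ring
    rw [e, e2, mul_add, he]
    ring

open Classical in
noncomputable def prem (P Q : A[X]) : A[X] :=
  if hQ : 0 < Q.natDegree then (exists_prem P Q hQ).choose else 0

lemma prem_spec (P Q : A[X]) (hQ : 0 < Q.natDegree) : 
    (prem P Q).natDegree < Q.natDegree ∧ (P.natDegree < Q.natDegree → prem P Q = P) ∧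
    ∃ (k : ℕ) (q : A[X]), C (Q.leadingCoeff ^ (2 * k)) * P = q * Q + prem P Q := by
  rw [prem, dif_pos hQ]
  exact (exists_prem P Q hQ).choose_spec

open Classical in
lemma exists_closure (d : ℕ) : ∀ (H S : Finset A[X]), (∀ P ∈ S, P.natDegree ≤ d) →
    ∃ T : Finset A[X], S ⊆ T ∧ (∀ P ∈ T, P.natDegree ≤ d) ∧
      (∀ Q ∈ T, derivative Q ∈ T ∧ Q.eraseLead ∈ T) ∧
      ∀ P ∈ H ∪ T, ∀ Q ∈ T, 0 < Q.natDegree → prem P Q ∈ T := by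
  induction d with
  | zero =>
    intro H S hS
    have hT : ∀ P ∈ insert 0 S, P.natDegree = 0 := by
      intro P hP
      rcases Finset.mem_insert.1 hP with rfl | hP
      · simp
      · exact Nat.le_zero.1 (hS P hP)
    refine ⟨insert 0 S, Finset.subset_insert _ _, fun P hP => (hT P hP).le, ?_, ?_⟩
    · intro Q hQ
      rw [eq_C_of_natDegree_eq_zero (hT Q hQ)]
      simp
    · intro P _ Q hQ h0
      have := hT Q hQ
      omega
  | succ d ih =>
    intro H S hS
    set St := S.filter (fun P => P.natDegree = d + 1) with hSt
    set S' := S.filter (fun P => P.natDegree ≤ d) ∪ (St.image derivative ∪ St.image eraseLead ∪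
      ((H ∪ S) ×ˢ St).image (fun p => prem p.1 p.2)) with hS'
    obtain ⟨T, hST, hTd, hTc, hTp⟩ := ih (H ∪ St) S' (by
      intro P hP
      simp only [hS', Finset.mem_union, Finset.mem_filter, Finset.mem_image, Finset.mem_product,
        hSt] at hP
      rcases hP with hP | (⟨Q, hQ, rfl⟩ | ⟨Q, hQ, rfl⟩) | ⟨⟨P, Q⟩, hQ, rfl⟩
      · exact hP.2
      · have := natDegree_derivative_lt (p := Q) (by omega)
        omega
      · have := eraseLead_natDegree_le Q
        omega
      · have hq : Q.natDegree = d + 1 := hQ.2.2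
        have := (prem_spec P Q (by omega)).1
        show (prem P Q).natDegree ≤ d
        omega)
    refine ⟨T ∪ St, ?_, ?_, ?_, ?_⟩
    · intro P hP
      rcases (hS P hP).lt_or_eq with h | h
      · refine Finset.mem_union_left _ (hST ?_)
        rw [hS']
        refine Finset.mem_union_left _ (Finset.mem_filter.2 ⟨hP, by omega⟩)
      · exact Finset.mem_union_right _ (Finset.mem_filter.2 ⟨hP, h⟩)
    · intro P hP
      rcases Finset.mem_union.1 hP with h | h
      · exact (hTd P h).trans (by omega)
      · exact hS P (Finset.mem_filter.1 h).1
    · intro Q hQ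
      rcases Finset.mem_union.1 hQ with h | h
      · exact ⟨Finset.mem_union_left _ (hTc Q h).1, Finset.mem_union_left _ (hTc Q h).2⟩
      · constructor
        · refine Finset.mem_union_left _ (hST ?_)
          rw [hS']
          simp only [Finset.mem_union, Finset.mem_image]
          exact Or.inr (Or.inl (Or.inl ⟨Q, h, rfl⟩))
        · refine Finset.mem_union_left _ (hST ?_)
          rw [hS']
          simp only [Finset.mem_union, Finset.mem_image]
          exact Or.inr (Or.inl (Or.inr ⟨Q, h, rfl⟩))
    · intro P hP Q hQ h0
      rcases Finset.mem_union.1 hQ with h | h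
      · refine Finset.mem_union_left _ (hTp P ?_ Q h h0)
        simp only [Finset.mem_union] at hP ⊢
        tauto
      · have hQd : Q.natDegree = d + 1 := (Finset.mem_filter.1 h).2
        by_cases hPT : P ∈ T
        · rw [(prem_spec P Q h0).2.1 (by have := hTd P hPT; omega)]
          exact Finset.mem_union_left _ hPT
        · refine Finset.mem_union_left _ (hST ?_)
          rw [hS']
          refine Finset.mem_union_right _ (Finset.mem_union_right _ ?_)
          refine Finset.mem_image.2 ⟨(P, Q), Finset.mem_product.2 ⟨?_, h⟩, rfl⟩
          simp only [Finset.mem_union] at hP ⊢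
          rcases hP with hP | hP | hP
          · exact Or.inl hP
          · exact absurd hP hPT
          · exact Or.inr (Finset.mem_filter.1 hP).1

lemma effective (T : Finset A[X]) (hT : ∀ Q ∈ T, Q.eraseLead ∈ T) (ev ev' : A →+* ℝ)
    (hs : ∀ Q ∈ T, ∀ n, (ev (Q.coeff n) = 0 ↔ ev' (Q.coeff n) = 0)) (n : ℕ) :
    ∀ Q ∈ T, Q.support.card = n → Q.map ev ≠ 0 → ∃ Q' ∈ T, Q'.map ev = Q.map ev ∧ Q'.map ev' = Q.map ev' ∧
      ev Q'.leadingCoeff ≠ 0 := by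
  induction n using Nat.strong_induction_on with
  | _ n ih =>
    intro Q hQ hn h0
    by_cases hl : ev Q.leadingCoeff = 0
    · have hQ0 : Q ≠ 0 := by rintro rfl; simp at h0
      have hl' : ev' Q.leadingCoeff = 0 := (hs Q hQ Q.natDegree).1 hl
      have key : ∀ (e : A →+* ℝ), e Q.leadingCoeff = 0 → Q.eraseLead.map e = Q.map e := by
        intro e he
        have h := congrArg (Polynomial.map e) Q.eraseLead_add_C_mul_X_pow
        rwa [Polynomial.map_add, Polynomial.map_mul, map_C, he, C_0, zero_mul, add_zero] at h
      have hcard : Q.eraseLead.support.card < n := by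
        rw [← hn]; exact eraseLead_support_card_lt hQ0
      obtain ⟨Q', h1, h2, h3, h4⟩ := ih _ hcard Q.eraseLead (hT Q hQ) rfl (by rwa [key ev hl])
      exact ⟨Q', h1, h2.trans (key ev hl), h3.trans (key ev' hl'), h4⟩
    · exact ⟨Q, hQ, rfl, rfl, hl⟩

open Classical in
theorem tarski {lo hi : ℝ} (hlt : lo < hi) (l h : A) (S : Finset A[X]) :
    ∃ K : Finset A, ∀ ev ev' : A →+* ℝ, ev l = lo → ev' l = lo → ev h = hi → ev' h = hi →
      (∀ a ∈ K, SignType.sign (ev a) = SignType.sign (ev' a)) →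
      ∀ t ∈ Icc lo hi, ∃ t' ∈ Icc lo hi, ∀ P ∈ S,
        SignType.sign ((P.map ev).eval t) = SignType.sign ((P.map ev').eval t') := by
  obtain ⟨T, hST, -, hTc, hTp⟩ := exists_closure (S.sup natDegree) ∅ S
    (fun P hP => Finset.le_sup (f := natDegree) hP)
  refine ⟨T.biUnion (fun P => P.support.image P.coeff) ∪ T.image (fun P => P.eval l) ∪
    T.image (fun P => P.eval h), ?_⟩
  intro ev ev' el el' eh eh' hK t ht
  have hco : ∀ P ∈ T, ∀ n, SignType.sign (ev (P.coeff n)) = SignType.sign (ev' (P.coeff n)) := by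
    intro P hP n
    by_cases hn : P.coeff n = 0
    · rw [hn]; simp
    · apply hK
      simp only [Finset.mem_union, Finset.mem_biUnion, Finset.mem_image]
      exact Or.inl (Or.inl ⟨P, hP, n, mem_support_iff.2 hn, rfl⟩)
  have hco0 : ∀ P ∈ T, ∀ n, (ev (P.coeff n) = 0 ↔ ev' (P.coeff n) = 0) := by
    intro P hP n
    rw [← sign_eq_zero_iff, hco P hP n, sign_eq_zero_iff]
  have hsq : ∀ x : ℝ, x ≠ 0 → ∀ k, 0 < x ^ (2 * k) := by
    intro x hx k
    rw [pow_mul]; positivity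
  obtain ⟨t', ht', H⟩ := signMatch hlt (J := T) (fun P => P.1.map ev) (fun P => P.1.map ev')
    (by
      rintro ⟨P, hP⟩ n
      simp only [coeff_map]
      exact hco P hP n)
    (by
      rintro ⟨P, hP⟩ -
      exact ⟨⟨derivative P, (hTc P hP).1⟩, by simp only [derivative_map], by simp only [derivative_map]⟩)
    (by
      rintro ⟨P, hP⟩ ⟨Q, hQ⟩ hpos
      simp only at hpos
      obtain ⟨Q', hQ', e1, e2, hlc⟩ := effective T (fun Q hQ => (hTc Q hQ).2) ev ev' hco0 _ Q hQ rfl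
        (by rintro h0; rw [h0] at hpos; simp at hpos)
      have hlc' : ev' Q'.leadingCoeff ≠ 0 := fun h0 => hlc ((hco0 Q' hQ' _).2 h0)
      have hdeg : (Q'.map ev).natDegree = Q'.natDegree := natDegree_map_of_leadingCoeff_ne_zero _ hlc
      have hpos' : 0 < Q'.natDegree := by rw [← hdeg, e1]; exact hpos
      obtain ⟨h1, -, k, q, h3⟩ := prem_spec P Q' hpos'
      refine ⟨⟨prem P Q', hTp P (by simp [hP]) Q' hQ' hpos'⟩, ?_, ?_, ?_⟩
      · simp only
        rw [← e1, hdeg]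
        exact natDegree_map_le.trans_lt h1
      · refine ⟨ev Q'.leadingCoeff ^ (2 * k), hsq _ hlc k, q.map ev, ?_⟩
        have := congrArg (Polynomial.map ev) h3
        simp only [Polynomial.map_mul, Polynomial.map_add, map_C, map_pow] at this
        simp only
        rw [← e1, ← this]
        simp
      · refine ⟨ev' Q'.leadingCoeff ^ (2 * k), hsq _ hlc' k, q.map ev', ?_⟩
        have := congrArg (Polynomial.map ev') h3
        simp only [Polynomial.map_mul, Polynomial.map_add, map_C, map_pow] at this
        simp only
        rw [← e2, ← this]
        simp)
    (by
      rintro ⟨P, hP⟩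
      have := hK (P.eval l) (by
        simp only [Finset.mem_union, Finset.mem_biUnion, Finset.mem_image]
        exact Or.inl (Or.inr ⟨P, hP, rfl⟩))
      simp only [← el]
      conv_rhs => rw [el, ← el']
      simp only [eval_map_apply]
      exact this)
    (by
      rintro ⟨P, hP⟩
      have := hK (P.eval h) (by
        simp only [Finset.mem_union, Finset.mem_biUnion, Finset.mem_image]
        exact Or.inr ⟨P, hP, rfl⟩)
      simp only [← eh]
      conv_rhs => rw [eh, ← eh']
      simp only [eval_map_apply]
      exact this)
    t ht
  exact ⟨t', ht', fun P hP => H ⟨P, hST hP⟩⟩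
end
end TA
end PartB2

section PartC1
open Filter
namespace TA

def flatSet (N : ℕ) : Set (ℝ × ℝ) := {p | 0 < p.1 ∧ p.1 < 1 / ((N:ℝ) + 1) ∧ 0 < p.2 ∧ p.2 < p.1 ^ N}

lemma flatSet_anti : Antitone flatSet := by
  intro m n hmn p hp
  obtain ⟨h1, h2, h3, h4⟩ := hp
  have hle : (1:ℝ) / ((n:ℝ) + 1) ≤ 1 / ((m:ℝ) + 1) := by
    apply one_div_le_one_div_of_le (by positivity)
    have : (m:ℝ) ≤ n := by exact_mod_cast hmn
    linarith
  refine ⟨h1, h2.trans_le hle, h3, h4.trans_le ?_⟩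
  apply pow_le_pow_of_le_one h1.le _ hmn
  have : (1:ℝ) / ((n:ℝ) + 1) ≤ 1 := by
    rw [div_le_one (by positivity)]
    have : (0:ℝ) ≤ n := by positivity
    linarith
  linarith

def flat : Filter (ℝ × ℝ) := ⨅ N : ℕ, 𝓟 (flatSet N)

lemma flat_basis : flat.HasBasis (fun _ : ℕ => True) flatSet :=
  hasBasis_iInf_principal (directed_of_isDirected_le flatSet_anti)

lemma flatSet_nonempty (N : ℕ) : (flatSet N).Nonempty := by
  set r : ℝ := 1 / (2 * ((N:ℝ) + 1)) with hr
  have hr0 : 0 < r := by positivity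
  refine ⟨(r, r ^ N / 2), hr0, ?_, by positivity, ?_⟩
  · simp only [hr]
    apply one_div_lt_one_div_of_lt (by positivity)
    have : (0:ℝ) ≤ N := by positivity
    linarith
  · have : 0 < r ^ N := by positivity
    simp only
    linarith

instance : flat.NeBot := flat_basis.neBot_iff.2 fun {N} _ => flatSet_nonempty N

lemma flat_iff {P : ℝ × ℝ → Prop} : (∀ᶠ p in flat, P p) ↔ ∃ N, ∀ p ∈ flatSet N, P p := by
  rw [flat_basis.eventually_iff]
  simp

lemma flat_le : flat ≤ 𝓝 ((0:ℝ), (0:ℝ)) := by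
  have h : ∀ ε > 0, ∀ᶠ p in flat, p.1 ∈ Metric.ball (0:ℝ) ε ∧ p.2 ∈ Metric.ball (0:ℝ) ε := by
    intro ε hε
    rw [flat_iff]
    obtain ⟨N, hN⟩ := exists_nat_one_div_lt hε
    refine ⟨N + 1, fun p hp => ?_⟩
    have h1 := flatSet_anti (Nat.le_succ N) hp
    have h2 := flatSet_anti (show 1 ≤ N + 1 by omega) hp
    obtain ⟨a1, a2, a3, a4⟩ := h1
    obtain ⟨b1, b2, b3, b4⟩ := h2
    rw [pow_one] at b4
    simp only [Metric.mem_ball, dist_zero_right, Real.norm_eq_abs, abs_of_pos a1, abs_of_pos a3]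
    constructor <;> linarith
  intro s hs
  obtain ⟨ε, hε, hb⟩ := Metric.mem_nhds_iff.1 hs
  filter_upwards [h ε hε] with p hp
  apply hb
  rw [← ball_prod_same]
  exact hp

lemma flat_pos : ∀ᶠ p in flat, 0 < p.1 ∧ 0 < p.2 := by
  rw [flat_iff]
  exact ⟨0, fun p hp => ⟨hp.1, hp.2.2.1⟩⟩

lemma flat_map (k : ℕ) : Tendsto (fun p : ℝ × ℝ => (p.1, p.2 / p.1 ^ k)) flat flat := by
  rw [flat_basis.tendsto_right_iff]
  intro N _
  rw [flat_iff]
  refine ⟨N + k, fun p hp => ?_⟩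
  have h1 := flatSet_anti (Nat.le_add_right N k) hp
  obtain ⟨a1, a2, a3, a4⟩ := h1
  have a5 := hp.2.2.2
  have hk : 0 < p.1 ^ k := by positivity
  refine ⟨a1, a2, by simp only; positivity, ?_⟩
  simp only
  rw [div_lt_iff₀ hk, ← pow_add]
  exact a5

lemma flat_cancel (k : ℕ) : ∀ᶠ p in flat, p.1 ^ k * (p.2 / p.1 ^ k) = p.2 := by
  filter_upwards [flat_pos] with p hp
  have : p.1 ^ k ≠ 0 := (pow_pos hp.1 k).ne'
  field_simp

/-- Normal form after flattening. -/
lemma mono_form (A : ℝ × ℝ → ℝ) (hA : AnalyticAt ℝ A (0, 0)) (h0 : ¬ ∀ᶠ z in 𝓝 ((0:ℝ), (0:ℝ)), A z = 0) :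
    ∃ p q : ℕ, ∀ k ≥ p, ∃ U : ℝ × ℝ → ℝ, AnalyticAt ℝ U (0, 0) ∧ (k > p → U (0, 0) ≠ 0) ∧
      ∀ᶠ z in 𝓝 ((0:ℝ), (0:ℝ)), A (z.1, z.1 ^ k * z.2) = z.1 ^ (k * q + p) * z.2 ^ q * U z := by
  have step1 : ∀ (m : ℕ) (A : ℝ × ℝ → ℝ), AnalyticAt ℝ A (0, 0) →
      (¬ ∃ h : ℝ × ℝ → ℝ, AnalyticAt ℝ h (0, 0) ∧
      ∀ᶠ z in 𝓝 ((0:ℝ), (0:ℝ)), A z = z.2 ^ m * h z) →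
      ∃ (q : ℕ) (A1 : ℝ × ℝ → ℝ), AnalyticAt ℝ A1 (0, 0) ∧ (¬ ∀ᶠ r in 𝓝 (0:ℝ), A1 (r, 0) = 0) ∧
        ∀ᶠ z in 𝓝 ((0:ℝ), (0:ℝ)), A z = z.2 ^ q * A1 z := by
    intro m
    induction m with
    | zero => intro f hf h; exact absurd ⟨f, hf, by simp⟩ h
    | succ m ih =>
      intro f hf h
      by_cases h0 : ∀ᶠ y in 𝓝 (0:ℝ), f (y, 0) = 0
      · obtain ⟨Q, hQ, hQe⟩ := hadamard (0:ℝ) f hf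
        have h1 : ∀ᶠ z in 𝓝 ((0:ℝ), (0:ℝ)), f z = z.2 * Q z := by
          have hc : ContinuousAt (fun z : ℝ × ℝ => z.1) (0, 0) := by fun_prop
          filter_upwards [hQe, hc.eventually h0] with z h1 h2
          rw [h1, h2, zero_add]
        obtain ⟨q, A1, k1, k2, k3⟩ := ih Q hQ (by
          rintro ⟨w, hw, hwe⟩
          refine h ⟨w, hw, ?_⟩
          filter_upwards [h1, hwe] with z h2 h3
          rw [h2, h3]; ring)
        refine ⟨q + 1, A1, k1, k2, ?_⟩
        filter_upwards [h1, k3] with z h2 h3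
        rw [h2, h3]; ring
      · exact ⟨0, f, hf, h0, by simp⟩
  obtain ⟨m, hm⟩ := not_div (0:ℝ) A hA h0
  obtain ⟨q, A1, hA1, hA10, hAe⟩ := step1 m A hA hm
  obtain ⟨p, u, hu, hu0, hue⟩ := exists_order (h := fun r => A1 (r, 0)) (analyticAt_at_zero hA1) hA10
  obtain ⟨B, hB, hBe⟩ := hadamard (0:ℝ) A1 hA1
  refine ⟨p, q, fun k hk => ?_⟩
  have hm : AnalyticAt ℝ (fun z : ℝ × ℝ => (z.1, z.1 ^ k * z.2)) (0, 0) :=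
    analyticAt_fst.prod ((analyticAt_fst.pow k).mul analyticAt_snd)
  have hm0 : ((0:ℝ), (0:ℝ) ^ k * (0:ℝ)) = (0, 0) := by simp
  have hmt : Tendsto (fun z : ℝ × ℝ => (z.1, z.1 ^ k * z.2)) (𝓝 (0, 0)) (𝓝 (0, 0)) := by
    have := hm.continuousAt.tendsto
    simp only [hm0] at this
    exact this
  have hu' : AnalyticAt ℝ (fun z : ℝ × ℝ => u z.1) (0, 0) :=
    AnalyticAt.comp (g := u) (f := fun z : ℝ × ℝ => z.1) hu analyticAt_fst
  have hB' : AnalyticAt ℝ (fun z : ℝ × ℝ => B (z.1, z.1 ^ k * z.2)) (0, 0) :=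
    AnalyticAt.comp (g := B) (f := fun z : ℝ × ℝ => (z.1, z.1 ^ k * z.2))
      (by simp only [hm0]; exact hB) hm
  refine ⟨fun z => u z.1 + z.1 ^ (k - p) * z.2 * B (z.1, z.1 ^ k * z.2),
    hu'.add (((analyticAt_fst.pow _).mul analyticAt_snd).mul hB'), fun _ => by simpa using hu0, ?_⟩
  have hfst : Tendsto (fun z : ℝ × ℝ => z.1) (𝓝 (0, 0)) (𝓝 0) := by
    have : ContinuousAt (fun z : ℝ × ℝ => z.1) (0, 0) := by fun_prop
    exact this
  filter_upwards [hmt.eventually hAe, hmt.eventually hBe, hfst.eventually hue] with z h1 h2 h3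
  rw [h1, h2, h3]
  have e : z.1 ^ k = z.1 ^ p * z.1 ^ (k - p) := by rw [← pow_add]; congr 1; omega
  rw [mul_pow, ← pow_mul, pow_add]
  rw [e]
  ring

/-- sign of an analytic germ is eventually constant along the flat filter -/
lemma flat_sign (A : ℝ × ℝ → ℝ) (hA : AnalyticAt ℝ A (0, 0)) :
    (∀ᶠ z in flat, 0 < A z) ∨ (∀ᶠ z in flat, A z < 0) ∨ (∀ᶠ z in 𝓝 ((0:ℝ), (0:ℝ)), A z = 0) := by
  by_cases h0 : ∀ᶠ z in 𝓝 ((0:ℝ), (0:ℝ)), A z = 0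
  · exact Or.inr (Or.inr h0)
  obtain ⟨p, q, h⟩ := mono_form A hA h0
  obtain ⟨U, hU, hU0, he⟩ := h (p + 1) (by omega)
  have hU0 := hU0 (by omega)
  have he' := flat_le he
  have hpos : ∀ᶠ z in flat, 0 < z.1 ^ ((p + 1) * q + p) * z.2 ^ q := by
    filter_upwards [flat_pos] with z hz
    have := hz.1
    have := hz.2
    positivity
  rcases lt_or_gt_of_ne hU0 with hn | hp
  · right; left
    have h1 := flat_le (hU.continuousAt.eventually_lt continuousAt_const hn)
    have h2 : ∀ᶠ z in flat, A (z.1, z.1 ^ (p + 1) * z.2) < 0 := by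
      filter_upwards [he', h1, hpos] with z a b c
      rw [a]; exact mul_neg_of_pos_of_neg c b
    filter_upwards [(flat_map (p+1)).eventually h2, flat_cancel (p+1)] with z a b
    rwa [b] at a
  · left
    have h1 := flat_le (continuousAt_const.eventually_lt hU.continuousAt hp)
    have h2 : ∀ᶠ z in flat, 0 < A (z.1, z.1 ^ (p + 1) * z.2) := by
      filter_upwards [he', h1, hpos] with z a b c
      rw [a]; exact mul_pos c b
    filter_upwards [(flat_map (p+1)).eventually h2, flat_cancel (p+1)] with z a b
    rwa [b] at a

lemma flat_inv {k : ℕ} : Tendsto (fun z : ℝ × ℝ => (z.1, z.1 ^ k * z.2)) flat flat := by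
  rw [flat_basis.tendsto_right_iff]
  intro N _
  rw [flat_iff]
  refine ⟨N, fun p hp => ?_⟩
  obtain ⟨a1, a2, a3, a4⟩ := hp
  refine ⟨a1, a2, by simp only; positivity, ?_⟩
  simp only
  refine lt_of_le_of_lt ?_ a4
  have : p.1 ^ k ≤ 1 := by
    apply pow_le_one₀ a1.le
    have : (1:ℝ) / ((N:ℝ) + 1) ≤ 1 := by
      rw [div_le_one (by positivity)]
      have : (0:ℝ) ≤ N := by positivity
      linarith
    linarith
  calc p.1 ^ k * p.2 ≤ 1 * p.2 := by gcongr
    _ = p.2 := one_mul _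

/-- ratio of two nonzero germs, one way or the other -/
lemma flat_ratio (a b : ℝ × ℝ → ℝ) (ha : AnalyticAt ℝ a (0, 0)) (hb : AnalyticAt ℝ b (0, 0))
    (ha0 : ¬ ∀ᶠ z in 𝓝 ((0:ℝ), (0:ℝ)), a z = 0) (hb0 : ¬ ∀ᶠ z in 𝓝 ((0:ℝ), (0:ℝ)), b z = 0) :
    (∃ k0, ∀ k ≥ k0, ∃ R : ℝ × ℝ → ℝ, AnalyticAt ℝ R (0, 0) ∧
      ∀ᶠ z in 𝓝 ((0:ℝ), (0:ℝ)), a (z.1, z.1 ^ k * z.2) = R z * b (z.1, z.1 ^ k * z.2)) ∨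
    (∃ k, ∃ R : ℝ × ℝ → ℝ, AnalyticAt ℝ R (0, 0) ∧ R (0, 0) = 0 ∧
      ∀ᶠ z in 𝓝 ((0:ℝ), (0:ℝ)), b (z.1, z.1 ^ k * z.2) = R z * a (z.1, z.1 ^ k * z.2)) := by
  obtain ⟨p, q, h⟩ := mono_form a ha ha0
  obtain ⟨p', q', h'⟩ := mono_form b hb hb0
  have gen : ∀ (a b : ℝ × ℝ → ℝ) (p q p' q' k : ℕ) (U U' : ℝ × ℝ → ℝ),
      AnalyticAt ℝ U (0, 0) → AnalyticAt ℝ U' (0, 0) → U' (0, 0) ≠ 0 →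
      (∀ᶠ z in 𝓝 ((0:ℝ), (0:ℝ)), a z = z.1 ^ p * z.2 ^ q * U z) →
      (∀ᶠ z in 𝓝 ((0:ℝ), (0:ℝ)), b z = z.1 ^ p' * z.2 ^ q' * U' z) →
      p' ≤ p → q' ≤ q → ∃ R : ℝ × ℝ → ℝ, AnalyticAt ℝ R (0, 0) ∧ 
        (p' < p → R (0,0) = 0) ∧
        ∀ᶠ z in 𝓝 ((0:ℝ), (0:ℝ)), a z = R z * b z := by
    intro a b p q p' q' k U U' hU hU' hU0 h1 h2 hp hq
    refine ⟨fun z => z.1 ^ (p - p') * z.2 ^ (q - q') * (U z * (U' z)⁻¹),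
      ((analyticAt_fst.pow _).mul (analyticAt_snd.pow _)).mul (hU.mul (hU'.inv hU0)), ?_, ?_⟩
    · intro hlt
      have : p - p' ≠ 0 := by omega
      simp [this]
    · filter_upwards [h1, h2, hU'.continuousAt.eventually_ne hU0] with z a1 a2 a3
      rw [a1, a2]
      have e1 : z.1 ^ p = z.1 ^ (p - p') * z.1 ^ p' := by rw [← pow_add]; congr 1; omega
      have e2 : z.2 ^ q = z.2 ^ (q - q') * z.2 ^ q' := by rw [← pow_add]; congr 1; omega
      rw [e1, e2]
      field_simp
  by_cases hlex : q' < q ∨ (q' = q ∧ p' ≤ p)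
  · left
    refine ⟨p + p' + 1, fun k hk => ?_⟩
    obtain ⟨U, hU, -, hUe⟩ := h k (by omega)
    obtain ⟨U', hU', hU0, hUe'⟩ := h' k (by omega)
    obtain ⟨R, h1, h2, h3⟩ := gen (fun z => a (z.1, z.1 ^ k * z.2)) (fun z => b (z.1, z.1 ^ k * z.2)) _ _ _ _ k U U' hU hU'
      (hU0 (by omega)) hUe hUe' (by
        rcases hlex with hl | ⟨rfl, hl⟩
        · obtain ⟨m, rfl⟩ : ∃ m, q = q' + 1 + m := ⟨q - q' - 1, by omega⟩
          have : k * (q' + 1 + m) = k * q' + k + k * m := by ring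
          have : 0 ≤ k * m := by positivity
          omega
        · omega) (by omega)
    exact ⟨R, h1, h3⟩
  · right
    push Not at hlex
    refine ⟨p + p' + 1, ?_⟩
    obtain ⟨U, hU, hU0, hUe⟩ := h (p + p' + 1) (by omega)
    obtain ⟨U', hU', -, hUe'⟩ := h' (p + p' + 1) (by omega)
    obtain ⟨R, h1, h2, h3⟩ := gen (fun z => b (z.1, z.1 ^ (p+p'+1) * z.2)) (fun z => a (z.1, z.1 ^ (p+p'+1) * z.2)) _ _ _ _ (p+p'+1) U' U hU' hU
      (hU0 (by omega)) hUe' hUe (by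
        rcases hlex.1.lt_or_eq with hl | hl
        · obtain ⟨m, rfl⟩ : ∃ m, q' = q + 1 + m := ⟨q' - q - 1, by omega⟩
          have : (p+p'+1) * (q + 1 + m) = (p+p'+1) * q + (p+p'+1) + (p+p'+1) * m := by ring
          have : 0 ≤ (p+p'+1) * m := by positivity
          omega
        · have := hlex.2 hl.symm
          subst hl
          omega) (by omega)
    refine ⟨R, h1, h2 ?_, h3⟩
    rcases hlex.1.lt_or_eq with hl | hl
    · obtain ⟨m, rfl⟩ : ∃ m, q' = q + 1 + m := ⟨q' - q - 1, by omega⟩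
      have : (p+p'+1) * (q + 1 + m) = (p+p'+1) * q + (p+p'+1) + (p+p'+1) * m := by ring
      have : 0 ≤ (p+p'+1) * m := by positivity
      omega
    · have := hlex.2 hl.symm
      subst hl
      omega

open Classical in
noncomputable def Dv (a b : ℝ) : ℝ := if |a| ≤ |b| then a / b else 0

lemma Dv_abs (a b : ℝ) : |Dv a b| ≤ 1 := by
  unfold Dv
  split_ifs with h
  · rw [abs_div]; exact div_le_one_of_le₀ h (abs_nonneg _)
  · simp

lemma flat_Dv (a b : ℝ × ℝ → ℝ) (ha : AnalyticAt ℝ a (0, 0)) (hb : AnalyticAt ℝ b (0, 0)) :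
    ∃ k0, ∀ k ≥ k0, ∃ R : ℝ × ℝ → ℝ, AnalyticAt ℝ R (0, 0) ∧ |R (0, 0)| ≤ 1 ∧
      ∀ᶠ z in flat, Dv (a (z.1, z.1 ^ k * z.2)) (b (z.1, z.1 ^ k * z.2)) = R z := by
  have hzero : (∀ᶠ z in flat, Dv (a z) (b z) = 0) → ∃ k0, ∀ k ≥ k0, ∃ R : ℝ × ℝ → ℝ,
      AnalyticAt ℝ R (0, 0) ∧ |R (0, 0)| ≤ 1 ∧
      ∀ᶠ z in flat, Dv (a (z.1, z.1 ^ k * z.2)) (b (z.1, z.1 ^ k * z.2)) = R z := by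
    intro h
    refine ⟨0, fun k _ => ⟨fun _ => 0, analyticAt_const, by simp, ?_⟩⟩
    exact (flat_inv (k := k)).eventually h
  by_cases hb0 : ∀ᶠ z in 𝓝 ((0:ℝ), (0:ℝ)), b z = 0
  · apply hzero
    filter_upwards [flat_le hb0] with z hz
    simp [Dv, hz]
  by_cases ha0 : ∀ᶠ z in 𝓝 ((0:ℝ), (0:ℝ)), a z = 0
  · apply hzero
    filter_upwards [flat_le ha0] with z hz
    simp [Dv, hz]
  have hcmp : (∀ᶠ z in flat, |b z| < |a z|) ∨ (∀ᶠ z in flat, |a z| ≤ |b z|) := by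
    rcases flat_sign (fun z => a z ^ 2 - b z ^ 2) ((ha.pow 2).sub (hb.pow 2)) with h | h | h
    · left
      filter_upwards [h] with z hz
      exact sq_lt_sq.1 (by linarith)
    · right
      filter_upwards [h] with z hz
      exact sq_le_sq.1 (by linarith)
    · right
      filter_upwards [flat_le h] with z hz
      exact sq_le_sq.1 (by linarith)
  have hne : ∀ (f : ℝ × ℝ → ℝ), AnalyticAt ℝ f (0, 0) → (¬ ∀ᶠ z in 𝓝 ((0:ℝ), (0:ℝ)), f z = 0) →
      ∀ᶠ z in flat, f z ≠ 0 := by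
    intro f hf h
    rcases flat_sign f hf with h1 | h1 | h1
    · filter_upwards [h1] with z hz using hz.ne'
    · filter_upwards [h1] with z hz using hz.ne
    · exact absurd h1 h
  rcases hcmp with hc | hc
  · apply hzero
    filter_upwards [hc] with z hz
    simp [Dv, not_le.2 hz]
  rcases flat_ratio a b ha hb ha0 hb0 with ⟨k0, h⟩ | ⟨k, R, hR, hR0, he⟩
  · refine ⟨k0, fun k hk => ?_⟩
    obtain ⟨R, hR, he⟩ := h k hk
    have hb1 := (flat_inv (k := k)).eventually (hne b hb hb0)
    have hc1 := (flat_inv (k := k)).eventually hc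
    have he1 := flat_le he
    refine ⟨R, hR, ?_, ?_⟩
    · have ht : Tendsto (fun z => |R z|) flat (𝓝 |R (0, 0)|) :=
        (hR.continuousAt.abs.tendsto).mono_left flat_le
      refine le_of_tendsto ht ?_
      filter_upwards [hb1, hc1, he1] with z h1 h2 h3
      rw [h3, abs_mul] at h2
      have : 0 < |b (z.1, z.1 ^ k * z.2)| := abs_pos.2 h1
      nlinarith
    · filter_upwards [hb1, hc1, he1] with z h1 h2 h3
      rw [Dv, if_pos h2, h3]
      field_simp
  · exfalso
    have ha1 := (flat_inv (k := k)).eventually (hne a ha ha0)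
    have hc1 := (flat_inv (k := k)).eventually hc
    have he1 : ∀ᶠ z in flat, b (z.1, z.1 ^ k * z.2) = R z * a (z.1, z.1 ^ k * z.2) := flat_le he
    have hsm : ∀ᶠ z in flat, |R z| < 1 := by
      have : ContinuousAt (fun z => |R z|) (0, 0) := hR.continuousAt.abs
      exact flat_le (this.eventually_lt continuousAt_const (by simp [hR0]))
    obtain ⟨z, h1, h2, h3, h4⟩ := (ha1.and (hc1.and (he1.and hsm))).exists
    rw [h3, abs_mul] at h2
    have : 0 < |a (z.1, z.1 ^ k * z.2)| := abs_pos.2 h1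
    nlinarith
end TA
end PartC1

section PartC2
open Filter
namespace TA

lemma fin_all {E : Type*} {ι : Type*} [Fintype ι] {P : Set E → Prop} (hu : P univ)
    (hi : ∀ S T, P S → P T → P (S ∩ T)) (S : ι → Set E) (h : ∀ i, P (S i)) :
    P {y | ∀ i, y ∈ S i} := by
  classical
  have key : ∀ s : Finset ι, P {y | ∀ i ∈ s, y ∈ S i} := by
    intro s
    induction s using Finset.induction_on with
    | empty => simpa using hu
    | insert a s ha ih =>
      have : {y | ∀ i ∈ insert a s, y ∈ S i} = S a ∩ {y | ∀ i ∈ s, y ∈ S i} := by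
        ext y; simp
      rw [this]
      exact hi _ _ (h a) ih
  simpa using key Finset.univ

lemma fin_ex {E : Type*} {ι : Type*} [Fintype ι] {P : Set E → Prop} (hu : P ∅)
    (hi : ∀ S T, P S → P T → P (S ∪ T)) (S : ι → Set E) (h : ∀ i, P (S i)) :
    P {y | ∃ i, y ∈ S i} := by
  have := fin_all (P := fun S => P Sᶜ) (by simpa using hu)
    (fun S T hS hT => by rw [compl_inter]; exact hi _ _ hS hT) (fun i => (S i)ᶜ)
    (fun i => by simpa using h i)
  convert this using 1
  ext y; simp

section
variable {E E' : Type} [NormedAddCommGroup E] [NormedSpace ℝ E]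
  [NormedAddCommGroup E'] [NormedSpace ℝ E']

def QG (y0 : E) (S : Set E) : Prop :=
  ∃ (κ : Type) (_ : Fintype κ) (F : κ → E → ℝ) (φ : (κ → SignType) → Prop),
    (∀ k, AnalyticAt ℝ (F k) y0) ∧
      ∀ᶠ y in 𝓝 y0, (y ∈ S ↔ φ fun k => SignType.sign (F k y))

lemma QG.congr {y0 : E} {S S' : Set E} (h : QG y0 S) (e : ∀ᶠ y in 𝓝 y0, (y ∈ S' ↔ y ∈ S)) :
    QG y0 S' := by
  obtain ⟨κ, i, F, φ, hF, he⟩ := h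
  refine ⟨κ, i, F, φ, hF, ?_⟩
  filter_upwards [he, e] with y a b
  rw [b, a]

lemma QG.compl {y0 : E} {S : Set E} (h : QG y0 S) : QG y0 Sᶜ := by
  obtain ⟨κ, i, F, φ, hF, he⟩ := h
  refine ⟨κ, i, F, fun σ => ¬ φ σ, hF, ?_⟩
  filter_upwards [he] with y a
  rw [mem_compl_iff, a]

lemma QG.inter {y0 : E} {S S' : Set E} (h : QG y0 S) (h' : QG y0 S') : QG y0 (S ∩ S') := by
  obtain ⟨κ, i, F, φ, hF, he⟩ := h
  obtain ⟨κ', i', F', φ', hF', he'⟩ := h'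
  refine ⟨κ ⊕ κ', inferInstance, Sum.elim F F', fun σ => φ (σ ∘ Sum.inl) ∧ φ' (σ ∘ Sum.inr), ?_, ?_⟩
  · rintro (k | k)
    · exact hF k
    · exact hF' k
  · filter_upwards [he, he'] with y a b
    rw [mem_inter_iff, a, b]
    rfl

lemma QG.union {y0 : E} {S S' : Set E} (h : QG y0 S) (h' : QG y0 S') : QG y0 (S ∪ S') := by
  have := (h.compl.inter h'.compl).compl
  rwa [← compl_union, compl_compl] at this

lemma QG.sign {y0 : E} {F : E → ℝ} (hF : AnalyticAt ℝ F y0) (s : SignType → Prop) :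
    QG y0 {y | s (SignType.sign (F y))} :=
  ⟨Unit, inferInstance, fun _ => F, fun σ => s (σ ()), fun _ => hF, Eventually.of_forall fun y => Iff.rfl⟩

lemma QG.const (y0 : E) (p : Prop) : QG y0 {y : E | p} :=
  ⟨Empty, inferInstance, fun e => e.elim, fun _ => p, fun e => e.elim, Eventually.of_forall fun y => Iff.rfl⟩

lemma QG.univ (y0 : E) : QG y0 (Set.univ : Set E) := by
  have := QG.const y0 True
  simpa using this

lemma QG.empty (y0 : E) : QG y0 (∅ : Set E) := by
  have := QG.const y0 False
  simpa using this

lemma QG.all {ι : Type*} [Fintype ι] {y0 : E} {S : ι → Set E} (h : ∀ i, QG y0 (S i)) :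
    QG y0 {y | ∀ i, y ∈ S i} :=
  fin_all (QG.univ y0) (fun _ _ a b => a.inter b) S h

lemma QG.ex {ι : Type*} [Fintype ι] {y0 : E} {S : ι → Set E} (h : ∀ i, QG y0 (S i)) :
    QG y0 {y | ∃ i, y ∈ S i} :=
  fin_ex (QG.empty y0) (fun _ _ a b => a.union b) S h

lemma QG.pos {y0 : E} {F : E → ℝ} (hF : AnalyticAt ℝ F y0) : QG y0 {y | 0 < F y} := by
  have := QG.sign hF (fun s => s = 1)
  simpa only [sign_eq_one_iff] using this

lemma QG.zero {y0 : E} {F : E → ℝ} (hF : AnalyticAt ℝ F y0) : QG y0 {y | F y = 0} := by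
  have := QG.sign hF (fun s => s = 0)
  simpa only [sign_eq_zero_iff] using this

lemma QG.lt {y0 : E} {F G : E → ℝ} (hF : AnalyticAt ℝ F y0) (hG : AnalyticAt ℝ G y0) :
    QG y0 {y | F y < G y} := by
  have := QG.pos (hG.fun_sub hF)
  simpa only [sub_pos] using this

lemma QG.le {y0 : E} {F G : E → ℝ} (hF : AnalyticAt ℝ F y0) (hG : AnalyticAt ℝ G y0) :
    QG y0 {y | F y ≤ G y} := by
  have := (QG.lt hG hF).compl
  convert this using 1
  ext y; simp

lemma QG.eq {y0 : E} {F G : E → ℝ} (hF : AnalyticAt ℝ F y0) (hG : AnalyticAt ℝ G y0) :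
    QG y0 {y | F y = G y} := by
  have := QG.zero (hF.fun_sub hG)
  simpa only [sub_eq_zero] using this

lemma QG.abs_le {y0 : E} {F G : E → ℝ} (hF : AnalyticAt ℝ F y0) (hG : AnalyticAt ℝ G y0) :
    QG y0 {y | |F y| ≤ |G y|} := by
  have := QG.le (hF.fun_pow 2) (hG.fun_pow 2)
  simpa only [sq_le_sq] using this

lemma QG.eventually {y0 : E} {S : Set E} (h : QG y0 S) : ∀ᶠ y in 𝓝 y0, QG y S := by
  obtain ⟨κ, i, F, φ, hF, he⟩ := h
  have h1 : ∀ᶠ y in 𝓝 y0, ∀ k, AnalyticAt ℝ (F k) y :=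
    eventually_all.2 fun k => (hF k).eventually_analyticAt
  filter_upwards [h1, he.eventually_nhds] with y a b
  exact ⟨κ, i, F, φ, a, b⟩

lemma QG.pull {g : E' → E} {y0 : E'} {S : Set E} (h : QG (g y0) S) (hg : AnalyticAt ℝ g y0) :
    QG y0 (g ⁻¹' S) := by
  obtain ⟨κ, i, F, φ, hF, he⟩ := h
  exact ⟨κ, i, fun k => F k ∘ g, φ, fun k => (hF k).comp hg, hg.continuousAt.eventually he⟩

/-- projections of relatively compact families -/
def SG (y0 : E) (S : Set E) : Prop :=
  ∃ (κ : Type) (_ : Fintype κ) (K : Set (κ → ℝ)) (T : Set (E × (κ → ℝ))), IsCompact K ∧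
    (∀ z ∈ T, z.2 ∈ K) ∧ (∀ x0 ∈ K, QG (y0, x0) T) ∧ ∀ᶠ y in 𝓝 y0, (y ∈ S ↔ ∃ x, (y, x) ∈ T)

lemma SG.congr {y0 : E} {S S' : Set E} (h : SG y0 S) (e : ∀ᶠ y in 𝓝 y0, (y ∈ S' ↔ y ∈ S)) :
    SG y0 S' := by
  obtain ⟨κ, i, K, T, hK, hT, hq, he⟩ := h
  refine ⟨κ, i, K, T, hK, hT, hq, ?_⟩
  filter_upwards [he, e] with y a b
  rw [b, a]

lemma QG_off {κ : Type} [Fintype κ] {K : Set (κ → ℝ)} {T : Set (E × (κ → ℝ))} {y0 : E} (hK : IsCompact K)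
    (hT : ∀ z ∈ T, z.2 ∈ K) (hq : ∀ x0 ∈ K, QG (y0, x0) T) (x0 : κ → ℝ) : QG (y0, x0) T := by
  by_cases hx : x0 ∈ K
  · exact hq x0 hx
  · refine (QG.empty _).congr ?_
    have : ∀ᶠ z in 𝓝 (y0, x0), z.2 ∈ Kᶜ :=
      continuousAt_snd.eventually (hK.isClosed.isOpen_compl.mem_nhds hx)
    filter_upwards [this] with z hz
    simp only [mem_empty_iff_false, iff_false]
    exact fun h => hz (hT z h)

lemma SG.of_QG {y0 : E} {S : Set E} (h : QG y0 S) : SG y0 S := by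
  refine ⟨Empty, inferInstance, Set.univ, Prod.fst ⁻¹' S, isCompact_univ, fun _ _ => mem_univ _, ?_, ?_⟩
  · intro x0 _
    exact QG.pull (g := Prod.fst) (y0 := (y0, x0)) h analyticAt_fst
  · refine Eventually.of_forall fun y => ?_
    simp

lemma compact_sum {κ κ' : Type} {K : Set (κ → ℝ)} {K' : Set (κ' → ℝ)} (h : IsCompact K) (h' : IsCompact K') :
    IsCompact {x : κ ⊕ κ' → ℝ | x ∘ Sum.inl ∈ K ∧ x ∘ Sum.inr ∈ K'} := by
  have := (Homeomorph.sumArrowHomeomorphProdArrow (X := ℝ) (ι := κ) (ι' := κ')).isCompact_preimage.2 (h.prod h')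
  exact this

lemma analyticAt_inl {κ κ' : Type} [Fintype κ] [Fintype κ'] (y0 : E) (x0 : κ ⊕ κ' → ℝ) :
    AnalyticAt ℝ (fun z : E × (κ ⊕ κ' → ℝ) => (z.1, z.2 ∘ Sum.inl)) (y0, x0) := by
  refine analyticAt_fst.prod (analyticAt_pi_iff.2 fun k => ?_)
  exact ((ContinuousLinearMap.proj (R := ℝ) (φ := fun _ : κ ⊕ κ' => ℝ) (Sum.inl k)).analyticAt _).comp analyticAt_snd

lemma analyticAt_inr {κ κ' : Type} [Fintype κ] [Fintype κ'] (y0 : E) (x0 : κ ⊕ κ' → ℝ) :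
    AnalyticAt ℝ (fun z : E × (κ ⊕ κ' → ℝ) => (z.1, z.2 ∘ Sum.inr)) (y0, x0) := by
  refine analyticAt_fst.prod (analyticAt_pi_iff.2 fun k => ?_)
  exact ((ContinuousLinearMap.proj (R := ℝ) (φ := fun _ : κ ⊕ κ' => ℝ) (Sum.inr k)).analyticAt _).comp analyticAt_snd

lemma SG.inter {y0 : E} {S S' : Set E} (h : SG y0 S) (h' : SG y0 S') : SG y0 (S ∩ S') := by
  obtain ⟨κ, i, K, T, hK, hT, hq, he⟩ := h
  obtain ⟨κ', i', K', T', hK', hT', hq', he'⟩ := h'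
  refine ⟨κ ⊕ κ', inferInstance, _, (fun z : E × (κ ⊕ κ' → ℝ) => (z.1, z.2 ∘ Sum.inl)) ⁻¹' T ∩
    (fun z : E × (κ ⊕ κ' → ℝ) => (z.1, z.2 ∘ Sum.inr)) ⁻¹' T', compact_sum hK hK', ?_, ?_, ?_⟩
  · rintro z ⟨h1, h2⟩
    exact ⟨hT _ h1, hT' _ h2⟩
  · rintro x0 ⟨h1, h2⟩
    exact (QG.pull (y0 := (y0, x0)) (hq _ h1) (analyticAt_inl y0 x0)).inter
      (QG.pull (y0 := (y0, x0)) (hq' _ h2) (analyticAt_inr y0 x0))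
  · filter_upwards [he, he'] with y a b
    rw [mem_inter_iff, a, b]
    constructor
    · rintro ⟨⟨x, hx⟩, x', hx'⟩
      exact ⟨Sum.elim x x', hx, hx'⟩
    · rintro ⟨x, h1, h2⟩
      exact ⟨⟨_, h1⟩, ⟨_, h2⟩⟩

lemma QG_fib_zero {κ : Type} [Fintype κ] (g : E → κ → ℝ) (y0 : E) (hg : AnalyticAt ℝ g y0) :
    QG y0 {y | g y = 0} := by
  have := QG.all (S := fun k => {y | g y k = 0}) (y0 := y0) (fun k => QG.zero (analyticAt_pi_iff.1 hg k))
  convert this using 1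
  ext y
  simp [funext_iff]

lemma SG.union {y0 : E} {S S' : Set E} (h : SG y0 S) (h' : SG y0 S') : SG y0 (S ∪ S') := by
  obtain ⟨κ, i, K, T, hK, hT, hq, he⟩ := h
  obtain ⟨κ', i', K', T', hK', hT', hq', he'⟩ := h'
  have Q := QG_off hK hT hq
  have Q' := QG_off hK' hT' hq'
  have hl := fun x0 => (analyticAt_inl (κ := κ) (κ' := κ') y0 x0)
  have hr := fun x0 => (analyticAt_inr (κ := κ) (κ' := κ') y0 x0)
  refine ⟨κ ⊕ κ', inferInstance, _,
    ((fun z : E × (κ ⊕ κ' → ℝ) => (z.1, z.2 ∘ Sum.inl)) ⁻¹' T ∩ {z | z.2 ∘ Sum.inr = 0}) ∪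
    ((fun z : E × (κ ⊕ κ' → ℝ) => (z.1, z.2 ∘ Sum.inr)) ⁻¹' T' ∩ {z | z.2 ∘ Sum.inl = 0}),
    compact_sum (hK.union (isCompact_singleton (x := 0))) (hK'.union (isCompact_singleton (x := 0))), ?_, ?_, ?_⟩
  · rintro z (⟨h1, h2⟩ | ⟨h1, h2⟩)
    · exact ⟨Or.inl (hT _ h1), Or.inr h2⟩
    · exact ⟨Or.inr h2, Or.inl (hT' _ h1)⟩
  · rintro x0 -
    refine ((QG.pull (y0 := (y0, x0)) (Q _) (hl x0)).inter ?_).union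
      ((QG.pull (y0 := (y0, x0)) (Q' _) (hr x0)).inter ?_)
    · exact QG_fib_zero _ _ (analyticAt_snd.comp (hr x0))
    · exact QG_fib_zero _ _ (analyticAt_snd.comp (hl x0))
  · filter_upwards [he, he'] with y a b
    rw [mem_union, a, b]
    constructor
    · rintro (⟨x, hx⟩ | ⟨x', hx'⟩)
      · exact ⟨Sum.elim x 0, Or.inl ⟨hx, rfl⟩⟩
      · exact ⟨Sum.elim 0 x', Or.inr ⟨hx', rfl⟩⟩
    · rintro ⟨x, (⟨h1, h2⟩ | ⟨h1, h2⟩)⟩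
      · exact Or.inl ⟨_, h1⟩
      · exact Or.inr ⟨_, h1⟩

lemma SG.pull {g : E' → E} {y0 : E'} {S : Set E} (h : SG (g y0) S) (hg : AnalyticAt ℝ g y0) :
    SG y0 (g ⁻¹' S) := by
  obtain ⟨κ, i, K, T, hK, hT, hq, he⟩ := h
  refine ⟨κ, i, K, (fun z : E' × (κ → ℝ) => (g z.1, z.2)) ⁻¹' T, hK, fun z hz => hT _ hz, ?_,
    hg.continuousAt.eventually he⟩
  intro x0 hx
  refine QG.pull (y0 := (y0, x0)) (hq x0 hx) ?_
  exact (AnalyticAt.comp (g := g) (f := Prod.fst) (x := (y0, x0)) hg analyticAt_fst).prod analyticAt_snd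

lemma SG.all {ι : Type*} [Fintype ι] {y0 : E} {S : ι → Set E} (h : ∀ i, SG y0 (S i)) :
    SG y0 {y | ∀ i, y ∈ S i} :=
  fin_all (SG.of_QG (QG.univ y0)) (fun _ _ a b => a.inter b) S h

lemma SG.ex {ι : Type*} [Fintype ι] {y0 : E} {S : ι → Set E} (h : ∀ i, SG y0 (S i)) :
    SG y0 {y | ∃ i, y ∈ S i} :=
  fin_ex (SG.of_QG (QG.empty y0)) (fun _ _ a b => a.union b) S h

/-- squared norm -/
def qn {ι : Type} [Fintype ι] (x : ι → ℝ) : ℝ := ∑ i, x i ^ 2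

lemma qn_nonneg {ι : Type} [Fintype ι] (x : ι → ℝ) : 0 ≤ qn x := Finset.sum_nonneg fun i _ => sq_nonneg _

lemma qn_zero {ι : Type} [Fintype ι] : qn (0 : ι → ℝ) = 0 := by simp [qn]

lemma norm_sq_le_qn {ι : Type} [Fintype ι] (x : ι → ℝ) : ‖x‖ ^ 2 ≤ qn x := by
  have : ‖x‖ ≤ Real.sqrt (qn x) := by
    rw [pi_norm_le_iff_of_nonneg (Real.sqrt_nonneg _)]
    intro i
    rw [Real.norm_eq_abs]
    apply Real.abs_le_sqrt
    exact Finset.single_le_sum (f := fun i => x i ^ 2) (fun i _ => sq_nonneg _) (Finset.mem_univ i)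
  calc ‖x‖ ^ 2 ≤ Real.sqrt (qn x) ^ 2 := by gcongr
    _ = qn x := Real.sq_sqrt (qn_nonneg x)

lemma qn_analytic {ι : Type} [Fintype ι] (x : ι → ℝ) : AnalyticAt ℝ (qn : (ι → ℝ) → ℝ) x := by
  unfold qn
  refine Finset.analyticAt_fun_sum _ fun i _ => ?_
  exact ((ContinuousLinearMap.proj (R := ℝ) (φ := fun _ : ι => ℝ) i).analyticAt _).fun_pow 2

lemma qn_continuous {ι : Type} [Fintype ι] : Continuous (qn : (ι → ℝ) → ℝ) := by
  unfold qn; fun_prop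

lemma qn_compact {ι : Type} [Fintype ι] (v0 : ι → ℝ) (e : ℝ) : IsCompact {v : ι → ℝ | qn (v - v0) ≤ e} := by
  apply Metric.isCompact_of_isClosed_isBounded
  · exact isClosed_le (qn_continuous.comp (continuous_id.sub continuous_const)) continuous_const
  · refine (Metric.isBounded_closedBall (x := v0) (r := Real.sqrt e)).subset fun v hv => ?_
    rw [mem_closedBall_iff_norm]
    exact Real.le_sqrt_of_sq_le ((norm_sq_le_qn _).trans hv)

lemma qn_small {ι : Type} [Fintype ι] {v0 : ι → ℝ} {P : (ι → ℝ) → Prop} (h : ∀ᶠ v in 𝓝 v0, P v) :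
    ∃ e > 0, ∀ v, qn (v - v0) ≤ e → P v := by
  obtain ⟨r, hr, hb⟩ := Metric.eventually_nhds_iff.1 h
  refine ⟨(r / 2) ^ 2, by positivity, fun v hv => hb ?_⟩
  rw [dist_eq_norm]
  have h1 : ‖v - v0‖ ^ 2 ≤ (r / 2) ^ 2 := (norm_sq_le_qn _).trans hv
  have h2 : ‖v - v0‖ ≤ r / 2 := le_of_sq_le_sq h1 (by positivity)
  linarith

lemma qn_nhds {ι : Type} [Fintype ι] (v0 : ι → ℝ) {e : ℝ} (he : 0 < e) : ∀ᶠ v in 𝓝 v0, qn (v - v0) < e := by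
  have : ContinuousAt (fun v => qn (v - v0)) v0 :=
    (qn_continuous.comp (continuous_id.sub continuous_const)).continuousAt
  exact this.eventually_lt continuousAt_const (by simp [qn_zero, he])

lemma SG_ball {ι : Type} [Fintype ι] {y0 : E} {v0 : ι → ℝ} {S : Set (E × (ι → ℝ))} (h : SG (y0, v0) S) :
    ∃ e > 0, SG y0 {y | ∃ v, qn (v - v0) ≤ e ∧ (y, v) ∈ S} := by
  obtain ⟨κ, i, K, T, hK, hT, hq, he⟩ := h
  have h1 : ∀ᶠ w in 𝓝 (y0, v0), ∀ x ∈ K, QG (w, x) T := by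
    apply hK.eventually_forall_of_forall_eventually
    intro x hx
    exact (hq x hx).eventually
  obtain ⟨P1, hP1, P2, hP2, hP⟩ := eventually_prod_iff.1 (nhds_prod_eq (x := y0) (y := v0) ▸ (h1.and he))
  obtain ⟨e, he0, hsm⟩ := qn_small hP2
  refine ⟨e, he0, ι ⊕ κ, inferInstance, _, {z : E × (ι ⊕ κ → ℝ) | qn (z.2 ∘ Sum.inl - v0) ≤ e} ∩
    (fun z : E × (ι ⊕ κ → ℝ) => ((z.1, z.2 ∘ Sum.inl), z.2 ∘ Sum.inr)) ⁻¹' T,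
    compact_sum (qn_compact v0 e) hK, ?_, ?_, ?_⟩
  · rintro z ⟨a, b⟩
    exact ⟨a, hT _ b⟩
  · rintro x0 ⟨a, b⟩
    have hl := (analyticAt_inl (κ := ι) (κ' := κ) y0 x0)
    have hr := (analyticAt_inr (κ := ι) (κ' := κ) y0 x0)
    refine QG.inter ?_ ?_
    · refine QG.le ?_ analyticAt_const
      exact (qn_analytic _).comp ((analyticAt_snd.comp hl).fun_sub analyticAt_const)
    · exact QG.pull (y0 := (y0, x0)) ((hP hP1.self_of_nhds (hsm _ a)).1 _ b) (hl.prod (analyticAt_snd.comp hr))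
  · filter_upwards [hP1] with y hy
    constructor
    · rintro ⟨v, hv, hS⟩
      obtain ⟨x, hx⟩ := (hP hy (hsm v hv)).2.1 hS
      exact ⟨Sum.elim v x, hv, hx⟩
    · rintro ⟨x, hx, hx'⟩
      exact ⟨x ∘ Sum.inl, hx, (hP hy (hsm _ hx)).2.2 ⟨_, hx'⟩⟩

lemma cover {ι : Type} [Fintype ι] {K : Set (ι → ℝ)} (hK : IsCompact K) (e : (ι → ℝ) → ℝ)
    (he : ∀ v ∈ K, 0 < e v) : ∃ t : Finset (ι → ℝ), (∀ v ∈ t, v ∈ K) ∧ ∀ v ∈ K, ∃ w ∈ t, qn (v - w) ≤ e w := by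
  obtain ⟨t, ht, hc⟩ := hK.elim_nhds_subcover (fun w => {v | qn (v - w) ≤ e w})
    (fun w hw => (qn_nhds w (he w hw)).mono fun v hv => le_of_lt hv)
  refine ⟨t, ht, fun v hv => ?_⟩
  simpa using hc hv

lemma SG_exists {ι : Type} [Fintype ι] {y0 : E} {K : Set (ι → ℝ)} (hK : IsCompact K)
    {S : Set (E × (ι → ℝ))} (hS : ∀ z ∈ S, z.2 ∈ K) (h : ∀ v ∈ K, SG (y0, v) S) :
    SG y0 {y | ∃ v, (y, v) ∈ S} := by
  have : ∀ v, ∃ e : ℝ, v ∈ K → 0 < e ∧ SG y0 {y | ∃ w, qn (w - v) ≤ e ∧ (y, w) ∈ S} := by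
    intro v
    by_cases hv : v ∈ K
    · obtain ⟨e, a, b⟩ := SG_ball (h v hv)
      exact ⟨e, fun _ => ⟨a, b⟩⟩
    · exact ⟨0, fun h => absurd h hv⟩
  choose e he using this
  obtain ⟨t, ht, hc⟩ := cover hK e (fun v hv => (he v hv).1)
  have h2 : ∀ w : t, SG y0 {y | ∃ v, qn (v - (w : ι → ℝ)) ≤ e (w : ι → ℝ) ∧ (y, v) ∈ S} :=
    fun w => (he w (ht w w.2)).2
  have h3 := SG.ex h2
  apply SG.congr h3
  apply Eventually.of_forall
  intro y
  constructor
  · rintro ⟨v, hv⟩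
    obtain ⟨w, hw, h⟩ := hc v (hS _ hv)
    exact ⟨⟨w, hw⟩, v, h, hv⟩
  · rintro ⟨w, v, -, h⟩
    exact ⟨v, h⟩

/-- eventual constancy along flat germs -/
def Lam (y : E) (S : Set E) : Prop :=
  ∀ H : ℝ × ℝ → E, AnalyticAt ℝ H (0, 0) → H (0, 0) = y →
    (∀ᶠ p in flat, H p ∈ S) ∨ (∀ᶠ p in flat, H p ∉ S)

lemma Lam.compl {y : E} {S : Set E} (h : Lam y S) : Lam y Sᶜ := by
  intro H hH h0
  rcases h H hH h0 with h | h
  · right; simpa using h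
  · left; exact h

lemma Lam.inter {y : E} {S S' : Set E} (h : Lam y S) (h' : Lam y S') : Lam y (S ∩ S') := by
  intro H hH h0
  rcases h H hH h0 with h | h
  · rcases h' H hH h0 with h' | h'
    · left; filter_upwards [h, h'] with p a b using ⟨a, b⟩
    · right; filter_upwards [h'] with p a using fun b => a b.2
  · right; filter_upwards [h] with p a using fun b => a b.1

lemma Lam.pull {g : E' → E} {y0 : E'} {S : Set E} (h : Lam (g y0) S) (hg : AnalyticAt ℝ g y0) :
    Lam y0 (g ⁻¹' S) := by
  intro H hH h0
  subst h0
  exact h (g ∘ H) (hg.comp hH) rfl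

lemma Lam.congr {y0 : E} {S S' : Set E} (h : Lam y0 S) (e : ∀ᶠ y in 𝓝 y0, (y ∈ S' ↔ y ∈ S)) :
    Lam y0 S' := by
  intro H hH h0
  have h1 : ∀ᶠ p in flat, (H p ∈ S' ↔ H p ∈ S) := by
    have := hH.continuousAt.tendsto
    rw [h0] at this
    exact flat_le (this.eventually e)
  rcases h H hH h0 with h | h
  · left; filter_upwards [h, h1] with p a b using b.2 a
  · right; filter_upwards [h, h1] with p a b using fun c => a (b.1 c)

lemma Lam.of_QG {y0 : E} {S : Set E} (h : QG y0 S) : Lam y0 S := by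
  obtain ⟨κ, i, F, φ, hF, he⟩ := h
  intro H hH h0
  subst h0
  have h1 : ∀ k, ∃ s : SignType, ∀ᶠ p in flat, SignType.sign (F k (H p)) = s := by
    intro k
    rcases flat_sign (F k ∘ H) ((hF k).comp hH) with h | h | h
    · exact ⟨1, by filter_upwards [h] with p hp using sign_eq_one_iff.2 hp⟩
    · exact ⟨-1, by filter_upwards [h] with p hp using sign_eq_neg_one_iff.2 hp⟩
    · exact ⟨0, by filter_upwards [flat_le h] with p hp using sign_eq_zero_iff.2 hp⟩
  choose s hs using h1
  have h2 : ∀ᶠ p in flat, ∀ k, SignType.sign (F k (H p)) = s k := eventually_all.2 hs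
  have h3 : ∀ᶠ p in flat, (H p ∈ S ↔ φ fun k => SignType.sign (F k (H p))) :=
    flat_le (hH.continuousAt.eventually he)
  by_cases hφ : φ s
  · left; filter_upwards [h2, h3] with p a b
    rw [b, funext a]; exact hφ
  · right; filter_upwards [h2, h3] with p a b
    rw [b, funext a]; exact hφ

structure D1 (y : E) (S : Set E) : Prop where
  sg : SG y S
  sgc : SG y Sᶜ
  lam : Lam y S

lemma D1.compl {y : E} {S : Set E} (h : D1 y S) : D1 y Sᶜ :=
  ⟨h.sgc, by rw [compl_compl]; exact h.sg, h.lam.compl⟩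

lemma D1.inter {y : E} {S S' : Set E} (h : D1 y S) (h' : D1 y S') : D1 y (S ∩ S') :=
  ⟨h.sg.inter h'.sg, by rw [compl_inter]; exact h.sgc.union h'.sgc, h.lam.inter h'.lam⟩

lemma D1.pull {g : E' → E} {y0 : E'} {S : Set E} (h : D1 (g y0) S) (hg : AnalyticAt ℝ g y0) :
    D1 y0 (g ⁻¹' S) :=
  ⟨h.sg.pull hg, h.sgc.pull hg, h.lam.pull hg⟩

lemma D1.congr {y0 : E} {S S' : Set E} (h : D1 y0 S) (e : ∀ᶠ y in 𝓝 y0, (y ∈ S' ↔ y ∈ S)) :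
    D1 y0 S' :=
  ⟨h.sg.congr e, h.sgc.congr (e.mono fun y hy => not_congr hy), h.lam.congr e⟩

lemma D1.of_QG {y0 : E} {S : Set E} (h : QG y0 S) : D1 y0 S :=
  ⟨SG.of_QG h, SG.of_QG h.compl, Lam.of_QG h⟩

def DD (y0 : E) (S : Set E) : Prop := ∀ᶠ y in 𝓝 y0, D1 y S

lemma DD.self {y : E} {S : Set E} (h : DD y S) : D1 y S := h.self_of_nhds

lemma DD.eventually {y : E} {S : Set E} (h : DD y S) : ∀ᶠ y' in 𝓝 y, DD y' S := h.eventually_nhds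

lemma DD.compl {y : E} {S : Set E} (h : DD y S) : DD y Sᶜ := h.mono fun _ h => h.compl

lemma DD.inter {y : E} {S S' : Set E} (h : DD y S) (h' : DD y S') : DD y (S ∩ S') := by
  filter_upwards [h, h'] with z a b using a.inter b

lemma DD.union {y0 : E} {S S' : Set E} (h : DD y0 S) (h' : DD y0 S') : DD y0 (S ∪ S') := by
  have := (h.compl.inter h'.compl).compl
  rwa [← compl_union, compl_compl] at this

lemma DD.pull [CompleteSpace E] {g : E' → E} {y0 : E'} {S : Set E} (h : DD (g y0) S) (hg : AnalyticAt ℝ g y0) :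
    DD y0 (g ⁻¹' S) := by
  filter_upwards [hg.continuousAt.eventually h, hg.eventually_analyticAt] with y a b using a.pull b

lemma DD.congr {y0 : E} {S S' : Set E} (h : DD y0 S) (e : ∀ᶠ y in 𝓝 y0, (y ∈ S' ↔ y ∈ S)) :
    DD y0 S' := by
  filter_upwards [h, e.eventually_nhds] with y a b using a.congr b

lemma DD.of_QG {y0 : E} {S : Set E} (h : QG y0 S) : DD y0 S := h.eventually.mono fun _ h => D1.of_QG h

lemma DD.all {ι : Type*} [Fintype ι] {y0 : E} {S : ι → Set E} (h : ∀ i, DD y0 (S i)) :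
    DD y0 {y | ∀ i, y ∈ S i} :=
  fin_all (DD.of_QG (QG.univ y0)) (fun _ _ a b => a.inter b) S h

lemma DD.ex {ι : Type*} [Fintype ι] {y0 : E} {S : ι → Set E} (h : ∀ i, DD y0 (S i)) :
    DD y0 {y | ∃ i, y ∈ S i} :=
  fin_ex (DD.of_QG (QG.empty y0)) (fun _ _ a b => a.union b) S h

lemma cube_compact (ι : Type) [Fintype ι] : IsCompact {v : ι → ℝ | ∀ γ, |v γ| ≤ 1} := by
  have : {v : ι → ℝ | ∀ γ, |v γ| ≤ 1} = Set.pi Set.univ (fun _ => Icc (-1) 1) := by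
    ext v; simp only [mem_setOf_eq, abs_le, Set.mem_pi, mem_univ, forall_true_left, mem_Icc]
  rw [this]
  exact isCompact_univ_pi fun _ => isCompact_Icc

lemma QG_graph {ι : Type} [Fintype ι] {a : ι → E → ℝ} {b : E → ℝ} {y0 : E} (v0 : ι → ℝ)
    (ha : ∀ γ, AnalyticAt ℝ (a γ) y0) (hb : AnalyticAt ℝ b y0) :
    QG (y0, v0) {z : E × (ι → ℝ) | z.2 = fun γ => Dv (a γ z.1) (b z.1)} := by
  have hb' : AnalyticAt ℝ (fun z : E × (ι → ℝ) => b z.1) (y0, v0) :=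
    AnalyticAt.comp (g := b) (f := Prod.fst) (x := (y0, v0)) hb analyticAt_fst
  have key : ∀ γ, QG (y0, v0) {z : E × (ι → ℝ) | z.2 γ = Dv (a γ z.1) (b z.1)} := by
    intro γ
    have ha' : AnalyticAt ℝ (fun z : E × (ι → ℝ) => a γ z.1) (y0, v0) :=
      AnalyticAt.comp (g := a γ) (f := Prod.fst) (x := (y0, v0)) (ha γ) analyticAt_fst
    have hv : AnalyticAt ℝ (fun z : E × (ι → ℝ) => z.2 γ) (y0, v0) :=
      ((ContinuousLinearMap.proj (R := ℝ) (φ := fun _ : ι => ℝ) γ).analyticAt _).comp analyticAt_snd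
    have h1 := ((QG.abs_le ha' hb').inter (QG.zero hb').compl).inter (QG.eq (hv.fun_mul hb') ha')
    have h2 := (QG.zero hb').inter (QG.zero hv)
    have h3 := (QG.abs_le ha' hb').compl.inter (QG.zero hv)
    refine ((h1.union h2).union h3).congr (Eventually.of_forall fun z => ?_)
    simp only [mem_setOf_eq, mem_union, mem_inter_iff, mem_compl_iff, Dv]
    by_cases hz : b z.1 = 0
    · by_cases h : |a γ z.1| ≤ |b z.1| <;> simp [hz, h] <;> simp_all
    · by_cases h : |a γ z.1| ≤ |b z.1|
      · simp [hz, h, eq_div_iff]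
      · simp [hz, h]
  convert QG.all key using 1
  ext z
  simp [funext_iff]

lemma SG_div {ι : Type} [Fintype ι] {a : ι → E → ℝ} {b : E → ℝ} {y0 : E} {S : Set (E × (ι → ℝ))}
    (ha : ∀ γ, AnalyticAt ℝ (a γ) y0) (hb : AnalyticAt ℝ b y0)
    (h : ∀ v0 : ι → ℝ, (∀ γ, |v0 γ| ≤ 1) → SG (y0, v0) S) :
    SG y0 {y | (y, fun γ => Dv (a γ y) (b y)) ∈ S} := by
  have h1 := SG_exists (y0 := y0) (cube_compact ι)
    (S := {z : E × (ι → ℝ) | z.2 = fun γ => Dv (a γ z.1) (b z.1)} ∩ S) ?_ ?_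
  · convert h1 using 1
    ext y; simp
  · rintro z ⟨hz, -⟩ γ
    rw [hz]
    exact Dv_abs _ _
  · intro v hv
    exact (SG.of_QG (QG_graph v ha hb)).inter (h v hv)

lemma Lam_div {ι : Type} [Fintype ι] {a : ι → E → ℝ} {b : E → ℝ} {y0 : E} {S : Set (E × (ι → ℝ))}
    (ha : ∀ γ, AnalyticAt ℝ (a γ) y0) (hb : AnalyticAt ℝ b y0)
    (h : ∀ v0 : ι → ℝ, (∀ γ, |v0 γ| ≤ 1) → Lam (y0, v0) S) :
    Lam y0 {y | (y, fun γ => Dv (a γ y) (b y)) ∈ S} := by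
  intro H hH h0
  subst h0
  have h1 := fun γ => flat_Dv (a γ ∘ H) (b ∘ H) ((ha γ).comp hH) (hb.comp hH)
  choose k0 hk0 using h1
  set k := ∑ γ, k0 γ with hk
  have hkk : ∀ γ, k0 γ ≤ k := fun γ => Finset.single_le_sum (fun _ _ => Nat.zero_le _) (Finset.mem_univ γ)
  choose R hR hR1 hRe using fun γ => hk0 γ k (hkk γ)
  have hm : AnalyticAt ℝ (fun z : ℝ × ℝ => (z.1, z.1 ^ k * z.2)) (0, 0) :=
    analyticAt_fst.prod ((analyticAt_fst.pow _).mul analyticAt_snd)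
  have hHm : AnalyticAt ℝ (fun z : ℝ × ℝ => H (z.1, z.1 ^ k * z.2)) (0, 0) :=
    AnalyticAt.comp (g := H) (f := fun z : ℝ × ℝ => (z.1, z.1 ^ k * z.2)) (by simp only [mul_zero]; exact hH) hm
  have hH' : AnalyticAt ℝ (fun z : ℝ × ℝ => (H (z.1, z.1 ^ k * z.2), fun γ => R γ z)) (0, 0) :=
    hHm.prod (analyticAt_pi_iff.2 hR)
  have hRe' := eventually_all.2 hRe
  have main := h (fun γ => R γ (0, 0)) hR1 _ hH' (by simp)
  have fin : ∀ {P : E → Prop}, (∀ᶠ z in flat, P (H (z.1, z.1 ^ k * z.2))) → ∀ᶠ z in flat, P (H z) := by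
    intro P hP
    filter_upwards [(flat_map k).eventually hP, flat_cancel k] with z a b
    rwa [b] at a
  rcases main with m | m
  · left
    apply fin
    filter_upwards [m, hRe'] with z a b
    simp only [Function.comp] at b
    simp only [mem_setOf_eq, b]
    exact a
  · right
    refine fin (P := fun y => y ∉ {y | (y, fun γ => Dv (a γ y) (b y)) ∈ S}) ?_
    filter_upwards [m, hRe'] with z a b
    simp only [Function.comp] at b
    simp only [mem_setOf_eq, b]
    exact a

lemma DD_div {ι : Type} [Fintype ι] {a : ι → E → ℝ} {b : E → ℝ} {y0 : E} {S : Set (E × (ι → ℝ))}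
    (ha : ∀ γ, AnalyticAt ℝ (a γ) y0) (hb : AnalyticAt ℝ b y0)
    (h : ∀ v0 : ι → ℝ, (∀ γ, |v0 γ| ≤ 1) → DD (y0, v0) S) :
    DD y0 {y | (y, fun γ => Dv (a γ y) (b y)) ∈ S} := by
  have h1 : ∀ᶠ y in 𝓝 y0, ∀ v ∈ {v : ι → ℝ | ∀ γ, |v γ| ≤ 1}, D1 (y, v) S := by
    apply (cube_compact ι).eventually_forall_of_forall_eventually
    intro v hv
    exact h v hv
  have h2 : ∀ᶠ y in 𝓝 y0, ∀ γ, AnalyticAt ℝ (a γ) y := eventually_all.2 fun γ => (ha γ).eventually_analyticAt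
  filter_upwards [h1, h2, hb.eventually_analyticAt] with y g1 g2 g3
  exact ⟨SG_div g2 g3 fun v hv => (g1 v hv).sg, SG_div g2 g3 fun v hv => (g1 v hv).sgc,
    Lam_div g2 g3 fun v hv => (g1 v hv).lam⟩
end
end TA
end PartC2

section PartC3
open Filter
namespace TA

def anRing {B : Type} [NormedAddCommGroup B] [NormedSpace ℝ B] (b0 : B) : Subring (B → ℝ) where
  carrier := {f | AnalyticAt ℝ f b0}
  mul_mem' := fun ha hb => AnalyticAt.mul ha hb
  one_mem' := analyticAt_const
  add_mem' := fun ha hb => AnalyticAt.add ha hb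
  zero_mem' := analyticAt_const
  neg_mem' := fun ha => AnalyticAt.neg ha

lemma elim1 {B : Type} [NormedAddCommGroup B] [NormedSpace ℝ B] [FiniteDimensional ℝ B] (b0 : B)
    {κ : Type} [Fintype κ] (F : κ → B × ℝ → ℝ) (hF : ∀ k, AnalyticAt ℝ (F k) (b0, 0))
    (hreg : ∀ k, ¬ ∀ᶠ t in 𝓝 (0:ℝ), F k (b0, t) = 0) (φ : (κ → SignType) → Prop) :
    ∃ δ > 0, QG b0 {b | ∃ t ∈ Icc (-δ) δ, φ fun k => SignType.sign (F k (b, t))} := by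
  classical
  choose d r U hr hU hU0 he using fun k => wprep b0 (F k) (hF k) (hreg k)
  have hs : ∀ᶠ z in 𝓝 (b0, (0:ℝ)), ∀ k, SignType.sign (U k z) = SignType.sign (U k (b0, 0)) := by
    refine eventually_all.2 fun k => ?_
    rcases lt_or_gt_of_ne (hU0 k) with h | h
    · filter_upwards [(hU k).continuousAt.eventually_lt continuousAt_const h] with z hz
      rw [sign_neg h, sign_neg hz]
    · filter_upwards [continuousAt_const.eventually_lt (hU k).continuousAt h] with z hz
      rw [sign_pos h, sign_pos hz]
  have hh := hs.and (eventually_all.2 he)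
  rw [nhds_prod_eq] at hh
  obtain ⟨P1, hP1, P2, hP2, hP⟩ := eventually_prod_iff.1 hh
  obtain ⟨δ', hδ', hb⟩ := Metric.eventually_nhds_iff.1 hP2
  refine ⟨δ' / 2, by positivity, ?_⟩
  set δ := δ' / 2 with hδ
  have hδ0 : 0 < δ := by positivity
  have hb' : ∀ t ∈ Icc (-δ) δ, P2 t := by
    intro t ht
    apply hb
    rw [Real.dist_0_eq_abs]
    have := abs_le.2 ht
    linarith
  let ev : B → (anRing b0 →+* ℝ) := fun b => (Pi.evalRingHom (fun _ : B => ℝ) b).comp (anRing b0).subtype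
  have hev : ∀ b a, ev b a = a.1 b := fun _ _ => rfl
  let P : κ → Polynomial (anRing b0) := fun k =>
    Polynomial.X ^ (d k) + ∑ j : Fin (d k), Polynomial.C ⟨r k j, hr k j⟩ * Polynomial.X ^ (j : ℕ)
  have hPe : ∀ k b t, ((P k).map (ev b)).eval t = t ^ (d k) + ∑ j, r k j b * t ^ (j : ℕ) := by
    intro k b t
    simp [P, Polynomial.eval_finset_sum, Polynomial.map_sum, hev]
  obtain ⟨K, hK⟩ := tarski (A := anRing b0) (lo := -δ) (hi := δ) (by linarith) ⟨fun _ => -δ, analyticAt_const⟩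
    ⟨fun _ => δ, analyticAt_const⟩ (Finset.univ.image P)
  set G : Set B := {b | ∃ t ∈ Icc (-δ) δ, φ fun k => SignType.sign (F k (b, t))} with hG
  refine ⟨K, inferInstance, fun a => a.1.1, fun σ => ∃ b, P1 b ∧ (∀ a : K, SignType.sign (a.1.1 b) = σ a) ∧ b ∈ G,
    fun a => a.1.2, ?_⟩
  filter_upwards [hP1] with b hb1
  constructor
  · intro h
    exact ⟨b, hb1, fun _ => rfl, h⟩
  · rintro ⟨b', hb1', hs, t', ht', hφ⟩
    obtain ⟨t, ht, hte⟩ := hK (ev b') (ev b) rfl rfl rfl rfl (fun a ha => hs ⟨a, ha⟩) t' ht'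
    refine ⟨t, ht, ?_⟩
    convert hφ using 2 with k
    obtain ⟨h1, h2⟩ := hP hb1 (hb' t ht)
    obtain ⟨h1', h2'⟩ := hP hb1' (hb' t' ht')
    have h3 := hte (P k) (Finset.mem_image_of_mem _ (Finset.mem_univ k))
    rw [hPe, hPe] at h3
    rw [h2, h2', sign_mul, sign_mul, h1, h1', h3]

section
variable {E : Type} [NormedAddCommGroup E] [NormedSpace ℝ E]

lemma small_ev {ι : Type} [Fintype ι] {y0 : E} {P : E × (ι → ℝ) → Prop} (h : ∀ᶠ z in 𝓝 (y0, 0), P z) :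
    ∀ᶠ w in 𝓝 (y0, (0:ℝ)), ∀ x, qn x ≤ w.2 → P (w.1, x) := by
  rw [nhds_prod_eq] at h
  obtain ⟨P1, hP1, P2, hP2, hP⟩ := eventually_prod_iff.1 h
  obtain ⟨e, he, hb⟩ := qn_small hP2
  rw [nhds_prod_eq]
  refine eventually_prod_iff.2 ⟨P1, hP1, fun s => s < e, gt_mem_nhds he, ?_⟩
  intro y hy s hs x hx
  exact hP hy (hb x (by rw [sub_zero]; linarith))

def exS {ι : Type} [Fintype ι] (T : Set (E × (ι → ℝ))) : Set (E × ℝ) := {w | ∃ x, qn x ≤ w.2 ∧ (w.1, x) ∈ T}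

lemma exS_congr {ι : Type} [Fintype ι] {y0 : E} {T T' : Set (E × (ι → ℝ))}
    (h : ∀ᶠ z in 𝓝 (y0, 0), (z ∈ T ↔ z ∈ T')) : ∀ᶠ w in 𝓝 (y0, (0:ℝ)), (w ∈ exS T ↔ w ∈ exS T') := by
  filter_upwards [small_ev h] with w hw
  exact exists_congr fun x => and_congr_right fun hx => hw x hx

lemma germ_mul {f g : E → ℝ} {p : E} (hf : AnalyticAt ℝ f p) (hg : AnalyticAt ℝ g p)
    (h : ∀ᶠ z in 𝓝 p, f z * g z = 0) : (∀ᶠ z in 𝓝 p, f z = 0) ∨ (∀ᶠ z in 𝓝 p, g z = 0) := by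
  obtain ⟨ε, hε, hb⟩ := Metric.eventually_nhds_iff_ball.1
    ((hf.eventually_analyticAt.and hg.eventually_analyticAt).and h)
  by_cases h1 : ∀ z ∈ Metric.ball p ε, f z = 0
  · left; exact Metric.eventually_nhds_iff_ball.2 ⟨ε, hε, h1⟩
  · right
    push Not at h1
    obtain ⟨z, hz, hfz⟩ := h1
    refine Metric.eventually_nhds_iff_ball.2 ⟨ε, hε, ?_⟩
    have ha : AnalyticOnNhd ℝ g (Metric.ball p ε) := fun x hx => (hb x hx).1.2
    refine ha.eqOn_zero_of_preconnected_of_eventuallyEq_zero (convex_ball p ε).isPreconnected hz ?_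
    have h2 : ∀ᶠ x in 𝓝 z, f x ≠ 0 := (hb z hz).1.1.continuousAt.eventually_ne hfz
    filter_upwards [h2, Metric.isOpen_ball.mem_nhds hz] with x a b
    simpa [a] using (hb x b).2

lemma germ_prod {κ : Type} (s : Finset κ) {f : κ → E → ℝ} {p : E} (hf : ∀ k, AnalyticAt ℝ (f k) p)
    (h : ∀ᶠ z in 𝓝 p, ∏ k ∈ s, f k z = 0) : ∃ k ∈ s, ∀ᶠ z in 𝓝 p, f k z = 0 := by
  classical
  induction s using Finset.induction_on with
  | empty => 
    exfalso
    simpa using h.self_of_nhds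
  | insert a s ha ih =>
    have h' : ∀ᶠ z in 𝓝 p, f a z * ∏ k ∈ s, f k z = 0 := by
      filter_upwards [h] with z hz
      rwa [Finset.prod_insert ha] at hz
    rcases germ_mul (hf a) (Finset.analyticAt_fun_prod s fun k _ => hf k) h' with h1 | h1
    · exact ⟨a, Finset.mem_insert_self _ _, h1⟩
    · obtain ⟨k, hk, h2⟩ := ih h1
      exact ⟨k, Finset.mem_insert_of_mem hk, h2⟩

lemma common_dir {n : ℕ} {κ : Type} [Fintype κ] {f : κ → (Fin (n+1) → ℝ) → ℝ} (hf : ∀ k, AnalyticAt ℝ (f k) 0)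
    (hreg : ∀ k, ¬ ∀ᶠ x in 𝓝 0, f k x = 0) :
    ∃ c : Fin (n+1) → ℝ, c ≠ 0 ∧ ∀ k, ¬ ∀ᶠ t in 𝓝 (0:ℝ), f k (t • c) = 0 := by
  have hq : ¬ ∀ᶠ x in 𝓝 (0 : Fin (n+1) → ℝ), qn x = 0 := by
    intro h
    have ht : Tendsto (fun t : ℝ => t • (1 : Fin (n+1) → ℝ)) (𝓝 0) (𝓝 0) := by
      have : Continuous (fun t : ℝ => t • (1 : Fin (n+1) → ℝ)) := by fun_prop
      simpa using this.tendsto 0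
    have h1 : ∀ᶠ t in 𝓝 (0:ℝ), t = 0 := by
      filter_upwards [ht.eventually h] with t ht
      have h2 := norm_sq_le_qn (t • (1 : Fin (n+1) → ℝ))
      rw [ht] at h2
      have h3 : ‖t • (1 : Fin (n+1) → ℝ)‖ = 0 := by nlinarith [norm_nonneg (t • (1 : Fin (n+1) → ℝ))]
      have h4 := congrFun (norm_eq_zero.1 h3) 0
      simpa using h4
    obtain ⟨ε, hε, hb⟩ := Metric.eventually_nhds_iff.1 h1
    have := @hb (ε / 2) (by rw [Real.dist_0_eq_abs, abs_of_pos (by positivity)]; linarith)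
    linarith
  have hpr : AnalyticAt ℝ (fun x => ∏ k, f k x) 0 := Finset.analyticAt_fun_prod _ fun k _ => hf k
  obtain ⟨c, hc⟩ := exists_dir (f := fun x => qn x * ∏ k, f k x) (p := 0) ((qn_analytic 0).fun_mul hpr) (by
    intro h
    rcases germ_mul (qn_analytic 0) hpr h with h1 | h1
    · exact hq h1
    · obtain ⟨k, -, h2⟩ := germ_prod _ hf h1
      exact hreg k h2)
  refine ⟨c, ?_, fun k h => hc ?_⟩
  · rintro rfl
    apply hc
    simp [qn_zero]
  · filter_upwards [h] with t ht
    rw [zero_add, Finset.prod_eq_zero (Finset.mem_univ k) ht, mul_zero]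
end

def Pe (n : ℕ) : Prop := ∀ (E : Type) [NormedAddCommGroup E] [NormedSpace ℝ E] [FiniteDimensional ℝ E]
  (y0 : E) (T : Set (E × (Fin n → ℝ))), QG (y0, 0) T → DD (y0, (0:ℝ)) (exS T)

lemma Pe_zero : Pe 0 := by
  intro E _ _ _ y0 T hT
  have : exS T = {w : E × ℝ | 0 ≤ w.2} ∩ (fun w : E × ℝ => (w.1, (0 : Fin 0 → ℝ))) ⁻¹' T := by
    ext w
    simp only [exS, mem_setOf_eq, mem_inter_iff, mem_preimage]
    constructor
    · rintro ⟨x, h1, h2⟩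
      obtain rfl : x = 0 := Subsingleton.elim _ _
      exact ⟨by simpa [qn] using h1, h2⟩
    · rintro ⟨h1, h2⟩
      exact ⟨0, by simpa [qn] using h1, h2⟩
  rw [this]
  apply DD.of_QG
  refine (QG.le analyticAt_const analyticAt_snd).inter (QG.pull (y0 := (y0, (0:ℝ))) hT ?_)
  exact analyticAt_fst.prod analyticAt_const

lemma qn_L {n m : ℕ} (L : (Fin n → ℝ) →L[ℝ] (Fin m → ℝ)) : ∃ C : ℝ, ∀ x, qn (L x) ≤ C * qn x := by
  refine ⟨m * ‖L‖ ^ 2, fun x => ?_⟩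
  have h1 : qn (L x) ≤ m * ‖L x‖ ^ 2 := by
    unfold qn
    calc ∑ i, (L x) i ^ 2 ≤ ∑ i : Fin m, ‖L x‖ ^ 2 := by
          refine Finset.sum_le_sum fun i _ => ?_
          rw [← sq_abs]
          have := norm_le_pi_norm (L x) i
          rw [Real.norm_eq_abs] at this
          gcongr
      _ = m * ‖L x‖ ^ 2 := by simp
  have h2 : ‖L x‖ ≤ ‖L‖ * ‖x‖ := L.le_opNorm x
  have h3 := norm_sq_le_qn x
  calc qn (L x) ≤ m * ‖L x‖ ^ 2 := h1
    _ ≤ m * (‖L‖ * ‖x‖) ^ 2 := by gcongr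
    _ = m * ‖L‖ ^ 2 * ‖x‖ ^ 2 := by ring
    _ ≤ m * ‖L‖ ^ 2 * qn x := by gcongr

lemma reg_step {n : ℕ} (ih : Pe n) {E : Type} [NormedAddCommGroup E] [NormedSpace ℝ E] [FiniteDimensional ℝ E]
    (y0 : E) {κ : Type} [Fintype κ] (F : κ → E × (Fin (n+1) → ℝ) → ℝ) (φ : (κ → SignType) → Prop)
    (hF : ∀ k, AnalyticAt ℝ (F k) (y0, 0)) (hreg : ∀ k, ¬ ∀ᶠ x in 𝓝 0, F k (y0, x) = 0) :
    DD (y0, (0:ℝ)) (exS {z | φ fun k => SignType.sign (F k z)}) := by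
  have hin : ∀ k, AnalyticAt ℝ (fun x => F k (y0, x)) 0 := fun k =>
    AnalyticAt.comp (g := F k) (f := fun x => (y0, x)) (hF k) (analyticAt_const.prod analyticAt_id)
  obtain ⟨c, hc0, hc⟩ := common_dir hin hreg
  obtain ⟨L, hL⟩ := exists_coord (n := n) (by simp) hc0
  have hLs : ∀ t : ℝ, L.symm (0, t) = t • c := by
    intro t
    rw [ContinuousLinearEquiv.symm_apply_eq, map_smul, hL]
    simp
  -- the family over the base `(E × ℝ) × (Fin n → ℝ)`
  let Fh : Option κ → ((E × ℝ) × (Fin n → ℝ)) × ℝ → ℝ := fun o => match o with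
    | none => fun z => z.1.1.2 - qn (L.symm (z.1.2, z.2))
    | some k => fun z => F k (z.1.1.1, L.symm (z.1.2, z.2))
  have hls : AnalyticAt ℝ (fun z : ((E × ℝ) × (Fin n → ℝ)) × ℝ => L.symm (z.1.2, z.2)) (((y0, 0), 0), 0) := by
    refine AnalyticAt.comp (g := L.symm) (f := fun z : ((E × ℝ) × (Fin n → ℝ)) × ℝ => (z.1.2, z.2))
      (L.symm.toContinuousLinearMap.analyticAt _) ?_
    exact (analyticAt_snd.comp analyticAt_fst).prod analyticAt_snd
  have hFh : ∀ o, AnalyticAt ℝ (Fh o) (((y0, 0), 0), 0) := by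
    rintro (_ | k)
    · refine AnalyticAt.fun_sub ?_ ((qn_analytic _).comp hls)
      exact analyticAt_snd.comp (analyticAt_fst.comp analyticAt_fst)
    · refine AnalyticAt.comp (g := F k) (f := fun z : ((E × ℝ) × (Fin n → ℝ)) × ℝ =>
        (z.1.1.1, L.symm (z.1.2, z.2))) ?_ ?_
      · have : ((0 : Fin n → ℝ), (0:ℝ)) = 0 := rfl
        simp only [this, map_zero]
        exact hF k
      · exact (analyticAt_fst.comp (analyticAt_fst.comp analyticAt_fst)).prod hls
  have hreg' : ∀ o, ¬ ∀ᶠ t in 𝓝 (0:ℝ), Fh o (((y0, 0), 0), t) = 0 := by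
    rintro (_ | k) h
    · obtain ⟨ε, hε, hb⟩ := Metric.eventually_nhds_iff.1 h
      have h1 := @hb (ε / 2) (by rw [Real.dist_0_eq_abs, abs_of_pos (by positivity)]; linarith)
      simp only [Fh, hLs, zero_sub, neg_eq_zero] at h1
      have h2 := norm_sq_le_qn ((ε / 2) • c)
      rw [h1] at h2
      have h3 : ‖(ε / 2) • c‖ = 0 := by nlinarith [norm_nonneg ((ε / 2) • c)]
      rw [norm_eq_zero, smul_eq_zero] at h3
      rcases h3 with h3 | h3
      · linarith
      · exact hc0 h3
    · simp only [Fh, hLs] at h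
      exact hc k h
  obtain ⟨δ, hδ, hG⟩ := elim1 ((y0, (0:ℝ)), (0 : Fin n → ℝ)) Fh hFh hreg'
    (fun σ => σ none ≠ -1 ∧ φ fun k => σ (some k))
  have hD := ih (E × ℝ) (y0, 0) _ hG
  obtain ⟨C, hC⟩ := qn_L ((ContinuousLinearMap.fst ℝ (Fin n → ℝ) ℝ).comp L.toContinuousLinearMap)
  have hp : AnalyticAt ℝ (fun w : E × ℝ => (w, |C| * w.2)) (y0, 0) :=
    analyticAt_id.prod (analyticAt_const.mul analyticAt_snd)
  have hD' := DD.pull (g := fun w : E × ℝ => (w, |C| * w.2)) (y0 := (y0, 0)) (by simpa using hD) hp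
  refine hD'.congr ?_
  have hsmall : ∀ᶠ z in 𝓝 (y0, (0 : Fin (n+1) → ℝ)), (L z.2).2 ∈ Icc (-δ) δ := by
    have : ContinuousAt (fun z : E × (Fin (n+1) → ℝ) => (L z.2).2) (y0, 0) := by
      have hc : Continuous (fun z : E × (Fin (n+1) → ℝ) => (L z.2).2) := by fun_prop
      exact hc.continuousAt
    exact this.eventually (Icc_mem_nhds (by simpa using hδ) (by simpa using hδ))
  filter_upwards [small_ev hsmall] with w hw
  simp only [exS, mem_setOf_eq, mem_preimage, Fh, ne_eq, sign_eq_neg_one_iff, not_lt, sub_nonneg]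
  constructor
  · rintro ⟨x, hx, hφ⟩
    refine ⟨(L x).1, ?_, (L x).2, hw x hx, ?_, ?_⟩
    · calc qn (L x).1 ≤ C * qn x := hC x
        _ ≤ |C| * w.2 := by
          have := qn_nonneg x
          have := le_abs_self C
          have := abs_nonneg C
          nlinarith
    · simpa using hx
    · simpa using hφ
  · rintro ⟨x', hx', t, ht, h1, h2⟩
    exact ⟨_, h1, h2⟩
end TA
end PartC3

section PartC4
open Filter
namespace TA

lemma irr {n : ℕ} (ih : Pe n) (N : ℕ) : ∀ (E : Type) [NormedAddCommGroup E] [NormedSpace ℝ E]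
    [FiniteDimensional ℝ E]
    (y0 : E) (κ : Type) [Fintype κ] (F : κ → E × (Fin (n+1) → ℝ) → ℝ) (φ : (κ → SignType) → Prop)
    (hF : ∀ k, AnalyticAt ℝ (F k) (y0, 0)) (hN : {k | ∀ᶠ x in 𝓝 0, F k (y0, x) = 0}.ncard ≤ N),
    DD (y0, (0:ℝ)) (exS {z | φ fun k => SignType.sign (F k z)}) := by
  classical
  induction N with
  | zero =>
    intro E _ _ _ y0 κ _ F φ hF hN
    refine reg_step ih y0 F φ hF fun k hk => ?_
    have h1 := (Set.ncard_eq_zero (Set.toFinite _)).1 (Nat.le_zero.1 hN)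
    have : k ∈ {k | ∀ᶠ x in 𝓝 0, F k (y0, x) = 0} := hk
    rw [h1] at this
    exact this
  | succ N IH =>
    intro E _ _ _ y0 κ _ F φ hF hN
    by_cases hall : ∀ k, ¬ ∀ᶠ x in 𝓝 0, F k (y0, x) = 0
    · exact reg_step ih y0 F φ hF hall
    push Not at hall
    obtain ⟨j0, hj0⟩ := hall
    obtain ⟨ι, _, a, W, ha, hW, he, hind⟩ := good (n+1) E y0 Unit (fun _ => F j0) (fun _ => hF j0)
    have hcount : ∀ (E' : Type) [NormedAddCommGroup E'] (y0' : E') (F' : κ → E' × (Fin (n+1) → ℝ) → ℝ),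
        (¬ ∀ᶠ x in 𝓝 0, F' j0 (y0', x) = 0) → (∀ k ≠ j0, ∀ x, F' k (y0', x) = F k (y0, x)) →
        {k | ∀ᶠ x in 𝓝 0, F' k (y0', x) = 0}.ncard ≤ N := by
      intro E' _ y0' F' h1 h2
      have hss : {k | ∀ᶠ x in 𝓝 0, F' k (y0', x) = 0} ⊂ {k | ∀ᶠ x in 𝓝 0, F k (y0, x) = 0} := by
        rw [Set.ssubset_iff_of_subset]
        · exact ⟨j0, hj0, h1⟩
        · intro k hk
          have hkj : k ≠ j0 := by rintro rfl; exact h1 hk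
          have hk' : ∀ᶠ x in 𝓝 0, F' k (y0', x) = 0 := hk
          show ∀ᶠ x in 𝓝 0, F k (y0, x) = 0
          filter_upwards [hk'] with x hx
          rw [← h2 k hkj, hx]
      have := Set.ncard_lt_ncard hss (Set.toFinite _)
      omega
    -- the twisted formula
    let φs : SignType → (κ → SignType) → Prop := fun s σ => φ (Function.update σ j0 (s * σ j0))
    -- zero piece
    let F0 : κ → E × (Fin (n+1) → ℝ) → ℝ := Function.update F j0 (fun _ => 1)
    have hF0 : ∀ k, AnalyticAt ℝ (F0 k) (y0, 0) := by
      intro k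
      by_cases hk : k = j0
      · subst hk; simp only [F0, Function.update_self]; exact analyticAt_const
      · simp only [F0, Function.update_of_ne hk]; exact hF k
    have hD0 := IH E y0 κ F0 (φs 0) hF0 (hcount E y0 F0 (fun h => by simpa [F0] using h.self_of_nhds) (by intro k hk x; simp [F0, hk]))
    -- main pieces
    let G : ι → κ → (E × (ι → ℝ)) × (Fin (n+1) → ℝ) → ℝ := fun β => Function.update
      (fun k z => F k (z.1.1, z.2)) j0 (fun z => ∑ γ, Function.update z.1.2 β 1 γ * W γ (z.1.1, z.2))
    have hpr : ∀ v0 : ι → ℝ, AnalyticAt ℝ (fun z : (E × (ι → ℝ)) × (Fin (n+1) → ℝ) => (z.1.1, z.2)) ((y0, v0), 0) :=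
      fun v0 => (analyticAt_fst.comp analyticAt_fst).prod analyticAt_snd
    have hGan : ∀ β v0 k, AnalyticAt ℝ (G β k) ((y0, v0), 0) := by
      intro β v0 k
      by_cases hk : k = j0
      · subst hk
        simp only [G, Function.update_self]
        refine Finset.analyticAt_fun_sum _ fun γ _ => AnalyticAt.fun_mul ?_ ?_
        · by_cases hγ : γ = β
          · subst hγ; simp only [Function.update_self]; exact analyticAt_const
          · simp only [Function.update_of_ne hγ]
            exact ((ContinuousLinearMap.proj (R := ℝ) (φ := fun _ : ι => ℝ) γ).analyticAt _).comp
              (analyticAt_snd.comp analyticAt_fst)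
        · exact AnalyticAt.comp (g := W γ) (f := fun z : (E × (ι → ℝ)) × (Fin (n+1) → ℝ) => (z.1.1, z.2))
            (hW γ) (hpr v0)
      · simp only [G, Function.update_of_ne hk]
        exact AnalyticAt.comp (g := F k) (f := fun z : (E × (ι → ℝ)) × (Fin (n+1) → ℝ) => (z.1.1, z.2))
            (hF k) (hpr v0)
    have hDG : ∀ β s v0, DD ((y0, v0), (0:ℝ)) (exS {z | φs s fun k => SignType.sign (G β k z)}) := by
      intro β s v0
      refine IH (E × (ι → ℝ)) (y0, v0) κ (G β) (φs s) (hGan β v0) (hcount _ (y0, v0) (G β) ?_ ?_)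
      · intro h
        have h1 := hind (Function.update v0 β 1) (by simpa [G] using h)
        have h2 := congrFun h1 β
        simp at h2
      · intro k hk x
        simp [G, hk]
    have hre : ∀ v0 : ι → ℝ, AnalyticAt ℝ (fun z : (E × ℝ) × (ι → ℝ) => ((z.1.1, z.2), z.1.2)) ((y0, 0), v0) :=
      fun v0 => ((analyticAt_fst.comp analyticAt_fst).prod analyticAt_snd).prod (analyticAt_snd.comp analyticAt_fst)
    have ha' : ∀ β, AnalyticAt ℝ (fun w : E × ℝ => a β () w.1) (y0, (0:ℝ)) := fun β =>
      AnalyticAt.comp (g := a β ()) (f := Prod.fst) (x := (y0, (0:ℝ))) (ha β ()) analyticAt_fst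
    have hpiece : ∀ p : ι × SignType, DD (y0, (0:ℝ)) (({w : E × ℝ | SignType.sign (a p.1 () w.1) = p.2} ∩
        {w | ∀ γ, |a γ () w.1| ≤ |a p.1 () w.1|}) ∩
        {w | (w, fun γ => Dv (a γ () w.1) (a p.1 () w.1)) ∈
          (fun z : (E × ℝ) × (ι → ℝ) => ((z.1.1, z.2), z.1.2)) ⁻¹'
            exS {z | φs p.2 fun k => SignType.sign (G p.1 k z)}}) := by
      rintro ⟨β, s⟩
      refine DD.inter (DD.of_QG (QG.inter (QG.sign (ha' β) (fun t => t = s)) (QG.all fun γ => QG.abs_le (ha' γ) (ha' β)))) ?_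
      refine DD_div ha' (ha' β) fun v0 _ => ?_
      exact DD.pull (y0 := ((y0, (0:ℝ)), v0)) (hDG β s v0) (hre v0)
    have hzero : DD (y0, (0:ℝ)) ({w : E × ℝ | ∀ β, a β () w.1 = 0} ∩ exS {z | φs 0 fun k => SignType.sign (F0 k z)}) :=
      (DD.of_QG (QG.all fun β => QG.zero (ha' β))).inter hD0
    refine (hzero.union (DD.ex hpiece)).congr ?_
    filter_upwards [small_ev he] with w hw
    have hz : (∀ β, a β () w.1 = 0) → (w ∈ exS {z | φ fun k => SignType.sign (F k z)} ↔
        w ∈ exS {z | φs 0 fun k => SignType.sign (F0 k z)}) := by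
      intro hz
      refine exists_congr fun x => and_congr_right fun hx => ?_
      have h1 : F j0 (w.1, x) = 0 := by rw [hw x hx ()]; simp [hz]
      simp only [mem_setOf_eq, φs]
      have : (fun k => SignType.sign (F k (w.1, x))) = Function.update (fun k => SignType.sign (F0 k (w.1, x))) j0
          (0 * SignType.sign (F0 j0 (w.1, x))) := by
        funext k
        by_cases hk : k = j0
        · subst hk; simp [h1]
        · simp [hk, F0]
      rw [this]
    have hp : ∀ β, (∀ γ, |a γ () w.1| ≤ |a β () w.1|) → (w ∈ exS {z | φ fun k => SignType.sign (F k z)} ↔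
        ((w.1, fun γ => Dv (a γ () w.1) (a β () w.1)), w.2) ∈
          exS {z | φs (SignType.sign (a β () w.1)) fun k => SignType.sign (G β k z)}) := by
      intro β hβ
      refine exists_congr fun x => and_congr_right fun hx => ?_
      simp only [mem_setOf_eq, φs]
      have h1 : F j0 (w.1, x) = a β () w.1 * G β j0 ((w.1, fun γ => Dv (a γ () w.1) (a β () w.1)), x) := by
        rw [hw x hx ()]
        simp only [G, Function.update_self, Finset.mul_sum]
        refine Finset.sum_congr rfl fun γ _ => ?_
        rw [← mul_assoc]
        congr 1
        by_cases hγ : γ = β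
        · subst hγ; simp
        · simp only [Function.update_of_ne hγ, Dv, if_pos (hβ γ)]
          by_cases h0 : a β () w.1 = 0
          · have := hβ γ
            rw [h0, abs_zero] at this
            rw [h0, abs_nonpos_iff.1 this]; simp
          · field_simp
      have : (fun k => SignType.sign (F k (w.1, x))) = Function.update
          (fun k => SignType.sign (G β k ((w.1, fun γ => Dv (a γ () w.1) (a β () w.1)), x))) j0
          (SignType.sign (a β () w.1) * SignType.sign (G β j0 ((w.1, fun γ => Dv (a γ () w.1) (a β () w.1)), x))) := by
        funext k
        by_cases hk : k = j0
        · subst hk; rw [Function.update_self, ← sign_mul, ← h1]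
        · simp [hk, G]
      rw [this]
    constructor
    · intro h
      by_cases hi : Nonempty ι
      · right
        obtain ⟨β, hβ⟩ := Finite.exists_max (fun β => |a β () w.1|)
        exact ⟨(β, SignType.sign (a β () w.1)), ⟨rfl, hβ⟩, (hp β hβ).1 h⟩
      · left
        have hz0 : ∀ β, a β () w.1 = 0 := fun β => absurd ⟨β⟩ hi
        exact ⟨hz0, (hz hz0).1 h⟩
    · rintro (⟨h1, h2⟩ | ⟨⟨β, s⟩, ⟨h1, h2⟩, h3⟩)
      · exact (hz h1).2 h2
      · have h1' : SignType.sign (a β () w.1) = s := h1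
        subst h1'
        exact (hp β h2).2 h3

lemma Pe_all (n : ℕ) : Pe n := by
  induction n with
  | zero => exact Pe_zero
  | succ n ih =>
    intro E _ _ _ y0 T hT
    obtain ⟨κ, i, F, φ, hF, he⟩ := hT
    exact (irr ih _ E y0 κ F φ hF le_rfl).congr (exS_congr he)

section
variable {E : Type} [NormedAddCommGroup E] [NormedSpace ℝ E] [FiniteDimensional ℝ E]

lemma qn_reindex {ι ι' : Type} [Fintype ι] [Fintype ι'] (σ : ι ≃ ι') (x : ι' → ℝ) : qn (x ∘ σ) = qn x := by
  unfold qn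
  exact Equiv.sum_comp σ (fun i => x i ^ 2)

/-- local bounded projection, general index type and centre -/
lemma DD_ball {ι : Type} [Fintype ι] {y0 : E} {x0 : ι → ℝ} {T : Set (E × (ι → ℝ))} (hT : QG (y0, x0) T) :
    ∃ e > 0, DD y0 {y | ∃ x, qn (x - x0) ≤ e ∧ (y, x) ∈ T} := by
  let σ := Fintype.equivFin ι
  have hg : AnalyticAt ℝ (fun z : E × (Fin (Fintype.card ι) → ℝ) => (z.1, (z.2 ∘ σ) + x0)) (y0, 0) := by
    refine analyticAt_fst.prod (AnalyticAt.fun_add (analyticAt_pi_iff.2 fun k => ?_) analyticAt_const)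
    exact ((ContinuousLinearMap.proj (R := ℝ) (φ := fun _ : Fin (Fintype.card ι) => ℝ) (σ k)).analyticAt _).comp analyticAt_snd
  have h0 : ((0 : Fin (Fintype.card ι) → ℝ) ∘ σ) + x0 = x0 := by funext i; simp
  have h1 := Pe_all _ E y0 _ (QG.pull (y0 := (y0, (0 : Fin (Fintype.card ι) → ℝ))) (by simp only [h0]; exact hT) hg)
  have h2 := h1.eventually
  obtain ⟨ε, hε, hb⟩ := Metric.eventually_nhds_iff.1 h2
  have h3 := @hb (y0, ε / 2) (by rw [Prod.dist_eq, dist_self, Real.dist_0_eq_abs, abs_of_pos (by positivity)]; simp; linarith)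
  refine ⟨ε / 2, by positivity, ?_⟩
  have h4 := DD.pull (g := fun y => (y, ε / 2)) (y0 := y0) h3 (analyticAt_id.prod analyticAt_const)
  refine h4.congr (Eventually.of_forall fun y => ?_)
  simp only [mem_setOf_eq, mem_preimage, exS]
  constructor
  · rintro ⟨x, h1, h2⟩
    refine ⟨(x - x0) ∘ σ.symm, ?_, ?_⟩
    · rw [qn_reindex]; exact h1
    · convert h2 using 2
      funext i; simp
  · rintro ⟨x, h1, h2⟩
    refine ⟨x ∘ σ + x0, ?_, h2⟩
    rw [add_sub_cancel_right, qn_reindex]; exact h1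

lemma SG.dd {y0 : E} {S : Set E} (h : SG y0 S) : DD y0 S := by
  obtain ⟨κ, i, K, T, hK, hT, hq, he⟩ := h
  have : ∀ v, ∃ e : ℝ, v ∈ K → 0 < e ∧ DD y0 {y | ∃ w, qn (w - v) ≤ e ∧ (y, w) ∈ T} := by
    intro v
    by_cases hv : v ∈ K
    · obtain ⟨e, a, b⟩ := DD_ball (hq v hv)
      exact ⟨e, fun _ => ⟨a, b⟩⟩
    · exact ⟨0, fun h => absurd h hv⟩
  choose e he' using this
  obtain ⟨t, ht, hc⟩ := cover hK e (fun v hv => (he' v hv).1)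
  have h2 : ∀ w : t, DD y0 {y | ∃ v, qn (v - (w : κ → ℝ)) ≤ e (w : κ → ℝ) ∧ (y, v) ∈ T} :=
    fun w => (he' w (ht w w.2)).2
  have h3 := DD.ex h2
  apply DD.congr h3
  filter_upwards [he] with y hy
  rw [hy]
  constructor
  · rintro ⟨v, hv⟩
    obtain ⟨w, hw, h⟩ := hc v (hT _ hv)
    exact ⟨⟨w, hw⟩, v, h, hv⟩
  · rintro ⟨w, v, -, h⟩
    exact ⟨v, h⟩

lemma DD_exists {ι : Type} [Fintype ι] {y0 : E} {K : Set (ι → ℝ)} (hK : IsCompact K)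
    {S : Set (E × (ι → ℝ))} (hS : ∀ z ∈ S, z.2 ∈ K) (h : ∀ v ∈ K, DD (y0, v) S) :
    DD y0 {y | ∃ v, (y, v) ∈ S} :=
  (SG_exists hK hS fun v hv => (h v hv).self.sg).dd

/-- existential over a shrinking ball -/
lemma DD_shrink {ι : Type} [Fintype ι] {y0 : E} {v0 : ι → ℝ} {S : Set (E × (ι → ℝ))} (h : DD (y0, v0) S) :
    DD (y0, (0:ℝ)) {w : E × ℝ | ∃ v, qn (v - v0) ≤ w.2 ∧ (w.1, v) ∈ S} := by
  have h1 : SG ((y0, (0:ℝ)), v0) ({z : (E × ℝ) × (ι → ℝ) | qn (z.2 - v0) ≤ z.1.2} ∩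
      (fun z : (E × ℝ) × (ι → ℝ) => (z.1.1, z.2)) ⁻¹' S) := by
    refine (SG.of_QG (QG.le ?_ ?_)).inter (SG.pull (y0 := ((y0, (0:ℝ)), v0)) h.self.sg ?_)
    · exact (qn_analytic _).comp (analyticAt_snd.fun_sub analyticAt_const)
    · exact analyticAt_snd.comp analyticAt_fst
    · exact (analyticAt_fst.comp analyticAt_fst).prod analyticAt_snd
  obtain ⟨e, he, h2⟩ := SG_ball h1
  refine h2.dd.congr ?_
  have : ∀ᶠ w in 𝓝 (y0, (0:ℝ)), w.2 < e := continuousAt_snd.eventually (gt_mem_nhds he)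
  filter_upwards [this] with w hw
  constructor
  · rintro ⟨v, a, b⟩
    exact ⟨v, by linarith, a, b⟩
  · rintro ⟨v, a, b, c⟩
    exact ⟨v, b, c⟩
end
end TA
end PartC4

section PartF1
open Filter
namespace TA
section
variable {E : Type} [NormedAddCommGroup E] [NormedSpace ℝ E]

lemma QG_of_semi {B : Set E} (h : Semianalytic B) (z : E) : QG z B := by
  obtain ⟨U, hU, p, q, f, g, hf, hg, he⟩ := h z
  have h1 : QG z {y | ∃ i, y ∈ {y | ∀ j, y ∈ {y | f i j y = 0} ∩ {y | 0 < g i j y}}} :=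
    QG.ex fun i => QG.all fun j => (QG.zero (hf i j z (mem_of_mem_nhds hU))).inter (QG.pos (hg i j z (mem_of_mem_nhds hU)))
  refine h1.congr ?_
  filter_upwards [hU] with y hy
  have := Set.ext_iff.1 he y
  simp only [mem_inter_iff, hy, and_true] at this
  rw [this]
  simp

lemma SG_of_sub {A : Set E} (h : Subanalytic A) (y : E) : SG y A := by
  obtain ⟨U, hU, m, B, hB, hc, he⟩ := h y
  refine ⟨Fin m, inferInstance, Prod.snd '' closure B, B, hc.image continuous_snd,
    fun z hz => ⟨z, subset_closure hz, rfl⟩, fun x _ => QG_of_semi hB _, ?_⟩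
  filter_upwards [hU] with y hy
  have := Set.ext_iff.1 he y
  simp only [mem_inter_iff, hy, and_true] at this
  rw [this]
  simp

lemma DD_shrink' [FiniteDimensional ℝ E] {ι : Type} [Fintype ι] {b0 : E} {v0 : ι → ℝ} {S : Set (E × (ι → ℝ))}
    (h : DD (b0, v0) S) {η : E → ℝ} (hη : AnalyticAt ℝ η b0) (h0 : η b0 = 0) :
    DD b0 {b | ∃ v, qn (v - v0) ≤ η b ∧ (b, v) ∈ S} := by
  have := DD.pull (g := fun b => (b, η b)) (y0 := b0) (S := {w : E × ℝ | ∃ v, qn (v - v0) ≤ w.2 ∧ (w.1, v) ∈ S})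
    (by rw [h0]; exact DD_shrink h) (analyticAt_id.prod hη)
  exact this
end

lemma core {m n : ℕ} (f : (Fin m → ℝ) → (Fin n → ℝ)) (hf : ∀ x, AnalyticAt ℝ f x) (Z : Set (Fin n → ℝ))
    (hZ : IsClosed Z) (p : Fin m → ℝ) (hD : DD (f p) Z) :
    ∃ ε > 0, ∀ η η2 : ℝ, 0 < η → η < ε → 0 < η2 → η2 < ε → ∃ N : ℕ, ∀ r : ℝ, 0 < r → r < 1 / ((N:ℝ) + 1) →
      ∀ x y, qn (x - p) ≤ η → qn (y - f p) ≤ η2 → y ∈ Z →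
        (∀ x', qn (x' - p) ≤ η → f x' ∈ Z → r ^ 2 ≤ qn (x' - x)) → (r ^ N / 2) ^ 2 < qn (f x - y) := by
  -- base: ((r, s), (η, η2))
  let B0 := (ℝ × ℝ) × (ℝ × ℝ)
  let b0 : B0 := ((0, 0), (0, 0))
  have ar : ∀ b : B0, AnalyticAt ℝ (fun b : B0 => b.1.1) b := fun b => analyticAt_fst.comp analyticAt_fst
  have as : ∀ b : B0, AnalyticAt ℝ (fun b : B0 => b.1.2) b := fun b => analyticAt_snd.comp analyticAt_fst
  have ae : ∀ b : B0, AnalyticAt ℝ (fun b : B0 => b.2.1) b := fun b => analyticAt_fst.comp analyticAt_snd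
  have ae2 : ∀ b : B0, AnalyticAt ℝ (fun b : B0 => b.2.2) b := fun b => analyticAt_snd.comp analyticAt_snd
  have hC : DD (b0, p) {w : B0 × (Fin m → ℝ) | ∃ x', qn (x' - p) ≤ w.1.2.1 ∧ (w, x') ∈
      {z : (B0 × (Fin m → ℝ)) × (Fin m → ℝ) | qn (z.2 - z.1.2) < z.1.1.1.1 ^ 2} ∩
        (fun z : (B0 × (Fin m → ℝ)) × (Fin m → ℝ) => f z.2) ⁻¹' Z} := by
    refine DD_shrink' (DD.inter (DD.of_QG (QG.lt ?_ ?_)) (DD.pull (y0 := ((b0, p), p)) hD ?_)) (η := fun w : B0 × (Fin m → ℝ) => w.1.2.1) ?_ rfl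
    · exact (qn_analytic _).comp (analyticAt_snd.fun_sub (analyticAt_snd.comp analyticAt_fst))
    · refine AnalyticAt.fun_pow ?_ 2
      exact AnalyticAt.comp (g := fun b : B0 => b.1.1) (f := fun z : (B0 × (Fin m → ℝ)) × (Fin m → ℝ) => z.1.1)
        (ar _) (analyticAt_fst.comp analyticAt_fst)
    · exact AnalyticAt.comp (g := f) (f := Prod.snd) (hf _) analyticAt_snd
    · exact AnalyticAt.comp (g := fun b : B0 => b.2.1) (f := Prod.fst) (ae _) analyticAt_fst
  set C : Set (B0 × (Fin m → ℝ)) := {w | ∃ x', qn (x' - p) ≤ w.1.2.1 ∧ (w, x') ∈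
      {z : (B0 × (Fin m → ℝ)) × (Fin m → ℝ) | qn (z.2 - z.1.2) < z.1.1.1.1 ^ 2} ∩
        (fun z : (B0 × (Fin m → ℝ)) × (Fin m → ℝ) => f z.2) ⁻¹' Z} with hCdef
  have hS2 : DD (b0, p) {w : B0 × (Fin m → ℝ) | ∃ y, qn (y - f p) ≤ w.1.2.2 ∧ (w, y) ∈
      (Prod.fst ⁻¹' Cᶜ ∩ Prod.snd ⁻¹' Z) ∩
      {z : (B0 × (Fin m → ℝ)) × (Fin n → ℝ) | qn (f z.1.2 - z.2) ≤ z.1.1.1.2 ^ 2}} := by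
    refine DD_shrink' (DD.inter (DD.inter ?_ ?_) (DD.of_QG (QG.le ?_ ?_))) (η := fun w : B0 × (Fin m → ℝ) => w.1.2.2) ?_ rfl
    · exact DD.pull (y0 := ((b0, p), f p)) hC.compl analyticAt_fst
    · exact DD.pull (y0 := ((b0, p), f p)) hD analyticAt_snd
    · refine (qn_analytic _).comp (AnalyticAt.fun_sub ?_ analyticAt_snd)
      exact AnalyticAt.comp (g := f) (f := fun z : (B0 × (Fin m → ℝ)) × (Fin n → ℝ) => z.1.2) (hf _)
        (analyticAt_snd.comp analyticAt_fst)
    · refine AnalyticAt.fun_pow ?_ 2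
      exact AnalyticAt.comp (g := fun b : B0 => b.1.2) (f := fun z : (B0 × (Fin m → ℝ)) × (Fin n → ℝ) => z.1.1)
        (as _) (analyticAt_fst.comp analyticAt_fst)
    · exact AnalyticAt.comp (g := fun b : B0 => b.2.2) (f := Prod.fst) (ae2 _) analyticAt_fst
  have hG := DD_shrink' hS2 (η := fun b : B0 => b.2.1) (ae _) rfl
  obtain ⟨ε, hε, hb⟩ := Metric.eventually_nhds_iff.1 hG
  refine ⟨ε, hε, fun η η2 h1 h2 h3 h4 => ?_⟩
  have hd : dist (((0, 0), (η, η2)) : B0) b0 < ε := by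
    simp only [b0, Prod.dist_eq, Real.dist_0_eq_abs, dist_self, abs_of_pos h1, abs_of_pos h3]
    simp [h2, h4, hε]
  have hL := (hb hd).lam (fun w => (w, (η, η2))) (analyticAt_id.prod analyticAt_const) rfl
  rcases hL with hL | hL
  · exfalso
    obtain ⟨N, hN⟩ := flat_iff.1 hL
    set r : ℝ := 1 / (2 * ((N:ℝ) + 1)) with hr
    have hr0 : 0 < r := by positivity
    have hr1 : r < 1 / ((N:ℝ) + 1) := by
      rw [hr]
      apply one_div_lt_one_div_of_lt (by positivity)
      have : (0:ℝ) ≤ N := by positivity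
      linarith
    have hrN : 0 < r ^ N := by positivity
    have hex : ∀ j : ℕ, ∃ x y, qn (x - p) ≤ η ∧ y ∈ Z ∧ (∀ x', qn (x' - p) ≤ η → f x' ∈ Z → r ^ 2 ≤ qn (x' - x)) ∧
        qn (f x - y) ≤ (r ^ N / (j + 2)) ^ 2 := by
      intro j
      have hj : (0:ℝ) ≤ j := by positivity
      obtain ⟨x, hx, y, hy, ⟨hc, hyZ⟩, hq⟩ := hN (r, r ^ N / (j + 2)) ⟨hr0, hr1, by positivity, by
        show r ^ N / (j + 2) < r ^ N
        rw [div_lt_iff₀ (by positivity)]; nlinarith⟩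
      refine ⟨x, y, hx, hyZ, fun x' hx' hfx' => ?_, hq⟩
      by_contra hcon
      push Not at hcon
      exact hc ⟨x', hx', hcon, hfx'⟩
    choose x y hx hy hc hq using hex
    obtain ⟨a, ha, θ, hθ, ht⟩ := (qn_compact p η).tendsto_subseq (x := x) hx
    have hfx : Tendsto (fun j => f (x (θ j))) atTop (𝓝 (f a)) := (hf a).continuousAt.tendsto.comp ht
    have hs : Tendsto (fun j => r ^ N / ((θ j : ℕ) + 2 : ℝ)) atTop (𝓝 0) := by
      refine Tendsto.comp (g := fun j : ℕ => r ^ N / ((j : ℝ) + 2)) ?_ hθ.tendsto_atTop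
      exact tendsto_const_nhds.div_atTop (tendsto_atTop_add_const_right _ _ tendsto_natCast_atTop_atTop)
    have hdiff : Tendsto (fun j => f (x (θ j)) - y (θ j)) atTop (𝓝 0) := by
      refine squeeze_zero_norm (fun j => ?_) hs
      have h1 := (norm_sq_le_qn (f (x (θ j)) - y (θ j))).trans (hq (θ j))
      exact le_of_sq_le_sq h1 (by positivity)
    have hyt : Tendsto (fun j => y (θ j)) atTop (𝓝 (f a)) := by
      have := hfx.sub hdiff
      simpa using this
    have haZ : f a ∈ Z := hZ.mem_of_tendsto hyt (Eventually.of_forall fun j => hy _)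
    have hlim : Tendsto (fun j => qn (a - x (θ j))) atTop (𝓝 0) := by
      have h1 : Tendsto (fun j => a - x (θ j)) atTop (𝓝 (a - a)) := tendsto_const_nhds.sub ht
      rw [sub_self] at h1
      have := (qn_continuous.tendsto (0 : Fin m → ℝ)).comp h1
      rw [qn_zero] at this
      exact this
    have hge : r ^ 2 ≤ 0 := ge_of_tendsto hlim (Eventually.of_forall fun j => hc (θ j) a ha haZ)
    have : 0 < r ^ 2 := by positivity
    linarith
  · obtain ⟨N, hN⟩ := flat_iff.1 hL
    refine ⟨N, fun r hr0 hr1 x y hx hy hyZ hc => ?_⟩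
    by_contra hcon
    push Not at hcon
    have hrN : 0 < r ^ N := by positivity
    refine hN (r, r ^ N / 2) ⟨hr0, hr1, by positivity, by show r ^ N / 2 < r ^ N; linarith⟩
      ⟨x, hx, y, hy, ⟨?_, hyZ⟩, hcon⟩
    rintro ⟨x', h1, h2, h3⟩
    have h2' : qn (x' - x) < r ^ 2 := h2
    have := hc x' h1 h3
    linarith
end TA
end PartF1

section PartF2
open Filter
namespace TA

lemma qn_dist {n : ℕ} (u v : EuclideanSpace ℝ (Fin n)) : qn (u.ofLp - v.ofLp) = dist u v ^ 2 := by
  rw [EuclideanSpace.dist_eq, Real.sq_sqrt (Finset.sum_nonneg fun i _ => sq_nonneg _)]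
  unfold qn
  refine Finset.sum_congr rfl fun i _ => ?_
  rw [Real.dist_eq, sq_abs]
  rfl

lemma loj {m n : ℕ} (f : EuclideanSpace ℝ (Fin m) → EuclideanSpace ℝ (Fin n))
    (hf : AnalyticOnNhd ℝ f Set.univ) (V : Set (EuclideanSpace ℝ (Fin n))) (hVo : IsOpen V)
    (hVs : Subanalytic V) (p : EuclideanSpace ℝ (Fin m)) :
    ∃ ε > 0, ∀ ρ ρ2 : ℝ, 0 < ρ → ρ < ε → 0 < ρ2 → ρ2 < ε → ∃ N : ℕ, ∀ r : ℝ, 0 < r → r < 1 / ((N:ℝ) + 1) →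
      ∀ x y, dist x p ≤ ρ → dist y (f p) ≤ ρ2 → y ∉ V →
        (∀ x', dist x' p ≤ ρ → f x' ∉ V → r ≤ dist x' x) → r ^ N / 2 < dist (f x) y := by
  let eX := PiLp.continuousLinearEquiv 2 ℝ (fun _ : Fin m => ℝ)
  let eY := PiLp.continuousLinearEquiv 2 ℝ (fun _ : Fin n => ℝ)
  let g : (Fin m → ℝ) → (Fin n → ℝ) := fun v => eY (f (eX.symm v))
  have hg : ∀ x, AnalyticAt ℝ g x := by
    intro x
    refine AnalyticAt.comp (g := eY) (f := fun v => f (eX.symm v)) (eY.toContinuousLinearMap.analyticAt _) ?_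
    exact AnalyticAt.comp (g := f) (f := eX.symm) (hf _ (mem_univ _)) (eX.symm.toContinuousLinearMap.analyticAt _)
  let Z : Set (Fin n → ℝ) := eY.symm ⁻¹' Vᶜ
  have hZ : IsClosed Z := hVo.isClosed_compl.preimage eY.symm.continuous
  have hD : DD (g (eX p)) Z := by
    refine DD.pull (g := eY.symm) ?_ (eY.symm.toContinuousLinearMap.analyticAt _)
    exact ((SG_of_sub hVs _).dd).compl
  obtain ⟨ε, hε, h⟩ := core g hg Z hZ (eX p) hD
  refine ⟨min 1 ε, lt_min one_pos hε, fun ρ ρ2 h1 h2 h3 h4 => ?_⟩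
  have hsq : ∀ t : ℝ, 0 < t → t < min 1 ε → t ^ 2 < ε := by
    intro t ht ht'
    have := lt_min_iff.1 ht'
    nlinarith
  obtain ⟨N, hN⟩ := h (ρ ^ 2) (ρ2 ^ 2) (by positivity) (hsq _ h1 h2) (by positivity) (hsq _ h3 h4)
  refine ⟨N, fun r hr0 hr1 x y hx hy hyV hc => ?_⟩
  have key := hN r hr0 hr1 (eX x) (eY y) ?_ ?_ ?_ ?_
  · have e : qn (g (eX x) - eY y) = dist (f x) y ^ 2 := by
      simp only [g, ContinuousLinearEquiv.symm_apply_apply]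
      exact qn_dist _ _
    rw [e] at key
    exact lt_of_pow_lt_pow_left₀ 2 dist_nonneg key
  · have : qn (eX x - eX p) = dist x p ^ 2 := qn_dist _ _
    rw [this]
    have := dist_nonneg (x := x) (y := p)
    gcongr
  · have : qn (eY y - g (eX p)) = dist y (f p) ^ 2 := by
      simp only [g, ContinuousLinearEquiv.symm_apply_apply]
      exact qn_dist _ _
    rw [this]
    have := dist_nonneg (x := y) (y := f p)
    gcongr
  · simp only [Z, mem_preimage, ContinuousLinearEquiv.symm_apply_apply]
    exact hyV
  · intro x' hx' hfx'
    have e1 : qn (x' - eX p) = dist (eX.symm x') p ^ 2 := by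
      have := qn_dist (eX.symm x') p
      rw [← this]; rfl
    have e2 : qn (x' - eX x) = dist (eX.symm x') x ^ 2 := by
      have := qn_dist (eX.symm x') x
      rw [← this]; rfl
    rw [e1] at hx'
    rw [e2]
    have h5 := hc (eX.symm x') (le_of_sq_le_sq hx' h1.le) (by
      simpa only [Z, g, mem_preimage, mem_compl_iff, ContinuousLinearEquiv.symm_apply_apply] using hfx')
    gcongr
end TA
end PartF2

/-- **Invariance of temperedness under real-analytic pullback.**
Let `f : ℝᵐ → ℝⁿ` be real analytic, `V` a subanalytic open subset of `ℝⁿ` and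
`U = f⁻¹(V)`.  If `ψ` is a tempered smooth function on `V`, then `ψ ∘ f` is a
tempered smooth function on `U`. -/
theorem isTemperedOn_comp {m n : ℕ}
    (f : EuclideanSpace ℝ (Fin m) → EuclideanSpace ℝ (Fin n))
    (hf : AnalyticOnNhd ℝ f Set.univ)
    (V : Set (EuclideanSpace ℝ (Fin n))) (hVo : IsOpen V) (hVs : Subanalytic V)
    (ψ : EuclideanSpace ℝ (Fin n) → ℂ) (hψ : ContDiffOn ℝ (⊤ : ℕ∞) ψ V)
    (htemp : IsTemperedOn ψ V) :
    IsTemperedOn (ψ ∘ f) (f ⁻¹' V) := by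
  intro k p
  have hfc : ContDiff ℝ (⊤ : ℕ∞) f := by
    rw [← contDiffOn_univ]
    exact hf.contDiffOn uniqueDiffOn_univ
  have hcont : Continuous f := hfc.continuous
  have hUo : IsOpen (f ⁻¹' V) := hVo.preimage hcont
  by_cases hp : p ∈ f ⁻¹' V
  · obtain ⟨ρ, hρ, hb⟩ := Metric.nhds_basis_closedBall.mem_iff.1 (hUo.mem_nhds hp)
    refine ⟨Metric.closedBall p ρ, isCompact_closedBall p ρ, Metric.closedBall_mem_nhds p hρ, 1, one_pos, 0, ?_⟩
    intro x hx
    rw [diff_eq_empty.2 hb]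
    simp
  have hq : f p ∉ V := hp
  obtain ⟨ε, hε, hloj⟩ := TA.loj f hf V hVo hVs p
  choose Kv hKc hKn Nv hNv Cv hCv using fun i => htemp i (f p)
  -- common neighbourhood for the first `k` derivatives
  have hnb : ∀ᶠ y in 𝓝 (f p), ∀ i : Fin (k+1), y ∈ Kv i := Filter.eventually_all.2 fun i => hKn i
  set ρ2 : ℝ := ε / 2 with hρ2
  have hρ20 : 0 < ρ2 := by positivity
  have hev : ∀ᶠ x in 𝓝 p, (∀ i : Fin (k+1), f x ∈ Kv i) ∧ dist (f x) (f p) < ρ2 / 2 :=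
    (hcont.continuousAt.eventually hnb).and
      (hcont.continuousAt.eventually (Metric.ball_mem_nhds (f p) (by positivity)))
  obtain ⟨ρ', hρ', hb⟩ := Metric.eventually_nhds_iff.1 hev
  set ρ : ℝ := min (ρ' / 2) (min (ε / 2) 1) with hρ
  have hρ0 : 0 < ρ := by positivity
  have hρle : ρ ≤ ρ' / 2 := min_le_left _ _
  have hρle2 : ρ ≤ ε / 2 := (min_le_right _ _).trans (min_le_left _ _)
  have hρle3 : ρ ≤ 1 := (min_le_right _ _).trans (min_le_right _ _)
  obtain ⟨N, hN⟩ := hloj ρ ρ2 hρ0 (by linarith) hρ20 (by linarith)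
  set K := Metric.closedBall p ρ with hK
  have hKcomp : IsCompact K := isCompact_closedBall p ρ
  -- bound on derivatives of f
  have hDb : ∃ D : ℝ, 1 ≤ D ∧ ∀ x ∈ K, ∀ i : Fin (k+1), ‖iteratedFDeriv ℝ i f x‖ ≤ D := by
    have : ∀ i : Fin (k+1), ∃ D : ℝ, ∀ x ∈ K, ‖iteratedFDeriv ℝ i f x‖ ≤ D := by
      intro i
      have hc : Continuous (iteratedFDeriv ℝ (i:ℕ) f) := hfc.continuous_iteratedFDeriv (by exact_mod_cast le_top)
      exact hKcomp.exists_bound_of_continuousOn hc.continuousOn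
    choose D hD using this
    refine ⟨1 + ∑ i, |D i|, ?_, fun x hx i => ?_⟩
    · have : 0 ≤ ∑ i, |D i| := Finset.sum_nonneg fun i _ => abs_nonneg _
      linarith
    · have h1 := hD i x hx
      have h2 : |D i| ≤ ∑ i, |D i| := Finset.single_le_sum (f := fun i => |D i|) (fun i _ => abs_nonneg _) (Finset.mem_univ i)
      have := le_abs_self (D i)
      linarith
  obtain ⟨D, hD1, hD⟩ := hDb
  -- constants
  set c : ℝ := 1 / (2 * ((N:ℝ) + 1)) with hc
  have hc0 : 0 < c := by positivity
  have hcN : c < 1 / ((N:ℝ) + 1) := by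
    rw [hc]
    apply one_div_lt_one_div_of_lt (by positivity)
    have : (0:ℝ) ≤ N := by positivity
    linarith
  set c' : ℝ := min (c ^ N / 2) (ρ2 / 2) with hc'
  have hc'0 : 0 < c' := by positivity
  set M : ℕ := 1 + ∑ i : Fin (k+1), N * Nv i with hM
  set C' : ℝ := ∑ i : Fin (k+1), |Cv i| / c' ^ Nv i with hC'
  have hC'0 : 0 ≤ C' := Finset.sum_nonneg fun i _ => by positivity
  refine ⟨K, hKcomp, Metric.closedBall_mem_nhds p hρ0, M, by omega, (k.factorial : ℝ) * C' * D ^ k, ?_⟩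
  rintro x ⟨hxK, hxU⟩
  have hxK' : dist x p ≤ ρ := hxK
  set d := Metric.infDist x (K \ f ⁻¹' V) with hd
  have hpK : p ∈ K \ f ⁻¹' V := ⟨Metric.mem_closedBall_self hρ0.le, hp⟩
  have hne : (K \ f ⁻¹' V).Nonempty := ⟨p, hpK⟩
  have hd0 : 0 ≤ d := Metric.infDist_nonneg
  have hdρ : d ≤ ρ := (Metric.infDist_le_dist_of_mem hpK).trans hxK'
  have hd1 : d ≤ 1 := hdρ.trans hρle3
  rcases hd0.eq_or_lt with hd00 | hdpos
  · rw [← hd00, zero_pow (by omega), zero_mul]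
    positivity
  have hfx := hb (show dist x p < ρ' by linarith)
  have hlow : ∀ i : Fin (k+1), c' * d ^ N ≤ Metric.infDist (f x) (Kv i \ V) := by
    intro i
    have hqK : f p ∈ Kv i \ V := ⟨mem_of_mem_nhds (hKn i), hq⟩
    rw [Metric.le_infDist ⟨f p, hqK⟩]
    rintro y ⟨hyK, hyV⟩
    have hdN1 : d ^ N ≤ 1 := pow_le_one₀ hd0 hd1
    have hdN0 : 0 < d ^ N := by positivity
    by_cases hy : dist y (f p) ≤ ρ2
    · have h1 := hN (c * d) (by positivity) (by nlinarith) x y hxK' hy hyV (by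
        intro x' hx' hfx'
        have h2 : d ≤ dist x x' := Metric.infDist_le_dist_of_mem ⟨hx', hfx'⟩
        rw [dist_comm] at h2
        have hc1 : c ≤ 1 := by
          rw [hc, div_le_one (by positivity)]
          have : (0:ℝ) ≤ N := by positivity
          linarith
        nlinarith)
      have h2 : c' ≤ c ^ N / 2 := min_le_left _ _
      rw [mul_pow] at h1
      nlinarith
    · push Not at hy
      have h2 : c' ≤ ρ2 / 2 := min_le_right _ _
      have h3 := dist_triangle y (f x) (f p)
      rw [dist_comm y (f x)] at h3
      have h4 := hfx.2
      nlinarith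
  have hψb : ∀ i : Fin (k+1), d ^ M * ‖iteratedFDerivWithin ℝ i ψ V (f x)‖ ≤ C' := by
    intro i
    have h1 := hCv i (f x) ⟨hfx.1 i, hxU⟩
    rw [norm_norm] at h1
    set a := ‖iteratedFDerivWithin ℝ i ψ V (f x)‖ with ha
    have ha0 : 0 ≤ a := norm_nonneg _
    have h2 : (c' * d ^ N) ^ Nv i * a ≤ Cv i := by
      refine le_trans ?_ h1
      have := hlow i
      gcongr
    rw [mul_pow, ← pow_mul] at h2
    have h3 : d ^ M ≤ d ^ (N * Nv i) := by
      apply pow_le_pow_of_le_one hd0 hd1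
      have : N * Nv i ≤ ∑ i : Fin (k+1), N * Nv i :=
        Finset.single_le_sum (f := fun i : Fin (k+1) => N * Nv i) (fun _ _ => Nat.zero_le _) (Finset.mem_univ i)
      omega
    have h4 : d ^ (N * Nv i) * a ≤ |Cv i| / c' ^ Nv i := by
      rw [le_div_iff₀ (by positivity)]
      calc d ^ (N * Nv i) * a * c' ^ Nv i = c' ^ Nv i * d ^ (N * Nv i) * a := by ring
        _ ≤ Cv i := h2
        _ ≤ |Cv i| := le_abs_self _
    have h5 : |Cv i| / c' ^ Nv i ≤ C' :=
      Finset.single_le_sum (f := fun i : Fin (k+1) => |Cv i| / c' ^ Nv i) (fun i _ => by positivity) (Finset.mem_univ i)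
    calc d ^ M * a ≤ d ^ (N * Nv i) * a := by gcongr
      _ ≤ C' := h4.trans h5
  have hdM : 0 < d ^ M := by positivity
  have main := norm_iteratedFDerivWithin_comp_le (𝕜 := ℝ) (g := ψ) (f := f) (n := k) (s := f ⁻¹' V) (t := V) (x := x)
    (N := ((⊤ : ℕ∞) : WithTop ℕ∞)) hψ hfc.contDiffOn (by exact_mod_cast le_top) hVo.uniqueDiffOn hUo.uniqueDiffOn (fun _ h => h) hxU
    (C := C' / d ^ M) (D := D) (fun i hi => by
      rw [le_div_iff₀ hdM, mul_comm]
      exact hψb ⟨i, by omega⟩)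
    (fun i h1 hi => by
      rw [iteratedFDerivWithin_of_isOpen i hUo hxU]
      refine (hD x hxK ⟨i, by omega⟩).trans ?_
      exact le_self_pow₀ hD1 (by omega))
  rw [norm_norm]
  calc d ^ M * ‖iteratedFDerivWithin ℝ k (ψ ∘ f) (f ⁻¹' V) x‖
      ≤ d ^ M * ((k.factorial : ℝ) * (C' / d ^ M) * D ^ k) := by gcongr
    _ = (k.factorial : ℝ) * C' * D ^ k := by field_simp
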